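/- Let G be a group and S a generating set of G such that (G, d_S) is Gromov hyperbolic (four-point condition), the left multiplication action of G on (G, d_S) is acylindrical, and this action is of general type, i.e., G contains two independent loxodromic elements for this action. Then there exist at least 2^{ℵ₀} pairwise non-equivalent generating sets T of G such that (G, d_T) is Gromov hyperbolic, the left multiplication action of G on (G, d_T) is acylindrical, and the set of elements of G that are loxodromic for the action on (G, d_T) coincides with the set of elements loxodromic for the action on (G, d_S). -/

import Mathlib

noncomputable section

open Metric

/-- The Gromov product of `x` and `y` at `w` with respect to a distance function `d`. -/
def gromovProd {α : Type*} (d : α → α → ℝ) (w x y : α) : ℝ :=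
  (d w x + d w y - d x y) / 2

/-- Gromov hyperbolicity via the four-point condition, for an arbitrary distance function. -/
def FourPointHyperbolic {α : Type*} (d : α → α → ℝ) : Prop :=
  ∃ δ : ℝ, 0 ≤ δ ∧ ∀ w x y z : α,
    min (gromovProd d w x z) (gromovProd d w z y) - δ ≤ gromovProd d w x y

/-- A geodesic from `x` to `y`, parametrized by arc length on `[0, dist x y]`. -/
def IsGeodesicSeg {X : Type*} [MetricSpace X] (x y : X) (f : ℝ → X) : Prop :=
  f 0 = x ∧ f (dist x y) = y ∧
    ∀ s ∈ Set.Icc (0 : ℝ) (dist x y), ∀ t ∈ Set.Icc (0 : ℝ) (dist x y),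
      dist (f s) (f t) = |s - t|

/-- A geodesic metric space: any two points are joined by a geodesic. -/
def GeodesicSpace (X : Type*) [MetricSpace X] : Prop :=
  ∀ x y : X, ∃ f : ℝ → X, IsGeodesicSeg x y f

/-- The image (as a set) of a geodesic segment from `x` to `y`. -/
def geodSet {X : Type*} [MetricSpace X] (x y : X) (f : ℝ → X) : Set X :=
  f '' Set.Icc (0 : ℝ) (dist x y)

/-- `p` lies within distance `δ` of the set `S` (i.e. in the closed `δ`-neighborhood). -/
def WithinDistOf {X : Type*} [MetricSpace X] (δ : ℝ) (p : X) (S : Set X) : Prop :=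
  ∃ q ∈ S, dist p q ≤ δ

/-- Rips condition: each side of every geodesic triangle is contained in the union of the
closed `δ`-neighborhoods of the other two sides. -/
def RipsHyperbolic (X : Type*) [MetricSpace X] (δ : ℝ) : Prop :=
  ∀ x y z : X, ∀ fxy fyz fxz : ℝ → X,
    IsGeodesicSeg x y fxy → IsGeodesicSeg y z fyz → IsGeodesicSeg x z fxz →
      (∀ p ∈ geodSet x y fxy, WithinDistOf δ p (geodSet y z fyz ∪ geodSet x z fxz)) ∧
      (∀ p ∈ geodSet y z fyz, WithinDistOf δ p (geodSet x y fxy ∪ geodSet x z fxz)) ∧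
      (∀ p ∈ geodSet x z fxz, WithinDistOf δ p (geodSet x y fxy ∪ geodSet y z fyz))

/-- An (isometric) action of a group `G` on a metric space `X`. -/
structure IsIsomAction (G : Type*) [Group G] (X : Type*) [MetricSpace X]
    (act : G → X → X) : Prop where
  act_one : ∀ x : X, act 1 x = x
  act_mul : ∀ (g h : G) (x : X), act (g * h) x = act g (act h x)
  isometry : ∀ (g : G) (x y : X), dist (act g x) (act g y) = dist x y

/-- A cobounded action: some (hence any) orbit is coarsely dense. -/
def CoboundedAction {G X : Type*} [Group G] [MetricSpace X] (act : G → X → X) : Prop :=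
  ∃ (x : X) (R : ℝ), 0 ≤ R ∧ ∀ y : X, ∃ g : G, dist y (act g x) ≤ R

/-- A quasi-isometric embedding between two "spaces" given by distance functions. -/
def IsQIEmbWith {α β : Type*} (dα : α → α → ℝ) (dβ : β → β → ℝ) (f : α → β) : Prop :=
  ∃ A B : ℝ, 1 ≤ A ∧ 0 ≤ B ∧ ∀ x y : α,
    dα x y / A - B ≤ dβ (f x) (f y) ∧ dβ (f x) (f y) ≤ A * dα x y + B

/-- The image of `f` is coarsely dense. -/
def CoarselyDenseWith {α β : Type*} (dβ : β → β → ℝ) (f : α → β) : Prop :=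
  ∃ C : ℝ, 0 ≤ C ∧ ∀ y : β, ∃ x : α, dβ (f x) y ≤ C

/-- A quasi-isometry between two "spaces" given by distance functions. -/
def IsQuasiIsometryWith {α β : Type*} (dα : α → α → ℝ) (dβ : β → β → ℝ) (f : α → β) : Prop :=
  IsQIEmbWith dα dβ f ∧ CoarselyDenseWith dβ f

/-- The standard distance on `ℤ`. -/
def zdist : ℤ → ℤ → ℝ := fun m n => |(m : ℝ) - (n : ℝ)|

/-- `g` is loxodromic for the action `act`: for some basepoint `x`, the orbit map
`n ↦ g ^ n • x` is a quasi-isometric embedding of `ℤ`. -/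
def LoxodromicWith {G α : Type*} [Group G] (d : α → α → ℝ) (act : G → α → α) (g : G) : Prop :=
  ∃ x : α, IsQIEmbWith zdist d (fun n : ℤ => act (g ^ n) x)

/-- Acylindricity of an action, with respect to a distance function. -/
def AcylindricalWith {G α : Type*} (d : α → α → ℝ) (act : G → α → α) : Prop :=
  ∀ ε : ℝ, 0 < ε → ∃ (R : ℝ) (N : ℕ), 0 ≤ R ∧ ∀ x y : α, R ≤ d x y →
    {g : G | d x (act g x) ≤ ε ∧ d y (act g y) ≤ ε}.Finite ∧
    Nat.card {g : G | d x (act g x) ≤ ε ∧ d y (act g y) ≤ ε} ≤ N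

/-- Two subsets are within finite Hausdorff distance of each other. -/
def FinHausdorffClose {α : Type*} (d : α → α → ℝ) (A B : Set α) : Prop :=
  ∃ C : ℝ, (∀ a ∈ A, ∃ b ∈ B, d a b ≤ C) ∧ (∀ b ∈ B, ∃ a ∈ A, d a b ≤ C)

/-- The positive (`pos = true`) or negative (`pos = false`) orbit ray of `g` at `x`. -/
def orbitRay {G α : Type*} [Group G] (act : G → α → α) (g : G) (x : α) (pos : Bool) : Set α :=
  Set.range fun n : ℕ => act (g ^ (if pos then (n : ℤ) else -(n : ℤ))) x

/-- Independence of two loxodromic elements with respect to the basepoint `x`: no orbit ray of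
`g` is within finite Hausdorff distance of an orbit ray of `h`. -/
def IndepWith {G α : Type*} [Group G] (d : α → α → ℝ) (act : G → α → α) (x : α)
    (g h : G) : Prop :=
  ∀ s t : Bool, ¬ FinHausdorffClose d (orbitRay act g x s) (orbitRay act h x t)

/-- A group is virtually cyclic if it has a cyclic subgroup of finite index. -/
def VirtuallyCyclic (G : Type*) [Group G] : Prop :=
  ∃ H : Subgroup G, IsCyclic ↥H ∧ H.FiniteIndex

/-- `S` is a generating set of `G`. -/
def IsGenSet {G : Type*} [Group G] (S : Set G) : Prop :=
  Subgroup.closure S = ⊤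

/-- The word length of `g` with respect to `S`: the least `n` such that `g` is a product of
`n` elements of `S ∪ S⁻¹`. -/
def wordLength {G : Type*} [Group G] (S : Set G) (g : G) : ℕ :=
  sInf {n : ℕ | ∃ l : List G, l.length = n ∧ (∀ s ∈ l, s ∈ S ∨ s⁻¹ ∈ S) ∧ l.prod = g}

/-- The word metric `d_S(g,h) = ‖g⁻¹h‖_S` on `G`. -/
def wordDist {G : Type*} [Group G] (S : Set G) : G → G → ℝ :=
  fun g h => (wordLength S (g⁻¹ * h) : ℝ)

/-- `S ⪯ T` : `S` is dominated by `T`, i.e. `sup_{t ∈ T} ‖t‖_S < ∞`. -/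
def GenSetDominated {G : Type*} [Group G] (S T : Set G) : Prop :=
  ∃ M : ℕ, ∀ t ∈ T, wordLength S t ≤ M

/-- Equivalence of generating sets: mutual domination. -/
def GenSetEquiv {G : Type*} [Group G] (S T : Set G) : Prop :=
  GenSetDominated S T ∧ GenSetDominated T S

/-- The left multiplication action of a group on itself. -/
def leftTranslation {G : Type*} [Group G] : G → G → G := fun g x => g * x

universe uX uG

/-- A bundled isometric action of `G` on a geodesic, δ-hyperbolic (Rips condition)
metric space. -/
structure GrpActHypSpace (G : Type uG) [Group G] : Type (max uG (uX + 1)) where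
  carrier : Type uX
  [inst : MetricSpace carrier]
  act : G → carrier → carrier
  isIsomAction : IsIsomAction G carrier act
  δ : ℝ
  δ_nonneg : 0 ≤ δ
  geodesic : GeodesicSpace carrier
  rips : RipsHyperbolic carrier δ

attribute [instance] GrpActHypSpace.inst

/-- Property (NL): no isometric action of `G` on a geodesic Gromov-hyperbolic metric space
has a loxodromic element. -/
def PropNL (G : Type uG) [Group G] : Prop :=
  ∀ A : GrpActHypSpace.{uX, uG} G, ∀ g : G,
    ¬ LoxodromicWith (fun a b : A.carrier => dist a b) A.act g

/-- A distance function with natural values in which any two points are joined by a discrete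
geodesic. -/
structure DiscreteGeodesic {α : Type*} (d : α → α → ℝ) : Prop where
  self : ∀ x, d x x = 0
  eq_of : ∀ x y, d x y = 0 → x = y
  symm : ∀ x y, d x y = d y x
  tri : ∀ x y z, d x z ≤ d x y + d y z
  nat : ∀ x y, ∃ n : ℕ, d x y = n
  split : ∀ (x y) (n : ℕ), (n : ℝ) ≤ d x y → ∃ z, d x z = n ∧ d z y = d x y - n

/-- A discretely geodesic distance satisfying the four-point inequality in its two largest sums
form. -/
structure DiscreteHyperbolic {α : Type*} (d : α → α → ℝ) (δ : ℝ) : Prop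
    extends DiscreteGeodesic d where
  one_le : 1 ≤ δ
  fourPoint : ∀ w x y z, d w x + d y z ≤ d w y + d x z + δ ∨ d w x + d y z ≤ d w z + d x y + δ

/-- `y` lies between `x` and `z` up to the additive defect `c`. -/
abbrev NearlyBtw {α : Type*} (d : α → α → ℝ) (c : ℝ) (x y z : α) : Prop := d x y + d y z ≤ d x z + c

section Geometry

variable {α : Type*} {d : α → α → ℝ} {δ : ℝ}

namespace DiscreteGeodesic

theorem nonneg (hd : DiscreteGeodesic d) (x y : α) : 0 ≤ d x y := by
  obtain ⟨n, hn⟩ := hd.nat x y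
  rw [hn]; positivity

theorem btw_symm (hd : DiscreteGeodesic d) {c : ℝ} {x y z : α} (h : NearlyBtw d c x y z) :
    NearlyBtw d c z y x := by
  have h1 := hd.symm x y
  have h2 := hd.symm y z
  have h3 := hd.symm x z
  unfold NearlyBtw at *
  linarith

/-- Betweenness only changes by twice the displacement of an endpoint. -/
theorem btw_of_close (hd : DiscreteGeodesic d) {c s t : ℝ} {x x' y z z' : α}
    (h : NearlyBtw d c x y z) (hx : d x x' ≤ s) (hz : d z z' ≤ t) :
    NearlyBtw d (c + 2 * s + 2 * t) x' y z' := by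
  have h1 := hd.tri x' x y
  have h2 := hd.tri y z z'
  have h3 := hd.tri x x' z
  have h4 := hd.tri x' z' z
  have h5 := hd.symm x x'
  have h6 := hd.symm z z'
  unfold NearlyBtw at *
  linarith

theorem btw_of_close_mid (hd : DiscreteGeodesic d) {c s : ℝ} {x y y' z : α}
    (h : NearlyBtw d c x y z) (hy : d y y' ≤ s) : NearlyBtw d (c + 2 * s) x y' z := by
  have h1 := hd.tri x y y'
  have h2 := hd.tri y' y z
  have h5 := hd.symm y y'
  unfold NearlyBtw at *
  linarith

theorem btw_inner (hd : DiscreteGeodesic d) {c c' : ℝ} {x p w q : α}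
    (h : NearlyBtw d c x p q) (h' : NearlyBtw d c' p w q) :
    NearlyBtw d (c + c') x p w ∧ NearlyBtw d (c + c') x w q := by
  have h1 := hd.tri x w q
  have h2 := hd.tri x p w
  unfold NearlyBtw at *
  constructor <;> linarith

end DiscreteGeodesic

namespace DiscreteHyperbolic

theorem btw_order (hd : DiscreteHyperbolic d δ) {c : ℝ} {u p q v : α}
    (hq : NearlyBtw d c u q v) (hp : NearlyBtw d c u p v) (h : d u q ≤ d u p) :
    NearlyBtw d (c + δ) u q p ∧ NearlyBtw d (2 * c + δ) q p v := by
  have s1 := hd.symm p q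
  have s2 := hd.symm u q
  have s3 := hd.symm u p
  have t := hd.tri u q v
  unfold NearlyBtw at *
  rcases hd.fourPoint p q u v with h1 | h1 <;> constructor <;> linarith

theorem btw_order_three (hd : DiscreteHyperbolic d δ) {c : ℝ} {x y p q r : α}
    (hp : NearlyBtw d c x p y) (hq : NearlyBtw d c x q y) (hr : NearlyBtw d c x r y)
    (hpq : d x p ≤ d x q) (hqr : d x q ≤ d x r) : NearlyBtw d (2 * c + 2 * δ) p q r := by
  have h1 := (hd.btw_order hp hq hpq).1
  have h2 := (hd.btw_order hq hr hqr).1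
  have h3 := hd.tri x p r
  unfold NearlyBtw at *
  linarith

theorem dist_le_of_btw (hd : DiscreteHyperbolic d δ) {c : ℝ} {x y p q : α}
    (hp : NearlyBtw d c x p y) (hq : NearlyBtw d c x q y) : d p q ≤ |d p y - d q y| + c + δ := by
  have s1 := hd.symm x p
  have s2 := hd.symm x q
  have s4 := hd.symm p q
  have t1 := hd.tri x p y
  have t2 := hd.tri x q y
  have := hd.fourPoint p q x y
  unfold NearlyBtw at *
  rcases this with h | h
  · have := neg_abs_le (d p y - d q y)
    linarith
  · have := le_abs_self (d p y - d q y)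
    linarith

theorem exists_near_geodesic (hd : DiscreteHyperbolic d δ) {c : ℝ} {x y z : α}
    (h : NearlyBtw d c x y z) : ∃ p, d x p + d p z = d x z ∧ d y p ≤ c + δ := by
  by_cases hxy : d x y ≤ d x z
  · obtain ⟨n, hn⟩ := hd.nat x y
    obtain ⟨p, hp1, hp2⟩ := hd.split x z n (hn ▸ hxy)
    refine ⟨p, by linarith, ?_⟩
    have s1 := hd.symm x y
    have s2 := hd.symm x p
    unfold NearlyBtw at *
    have := hd.tri x y z
    rcases hd.fourPoint y p x z with h1 | h1 <;> linarith
  · refine ⟨z, by rw [hd.self]; ring, ?_⟩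
    have := hd.one_le
    unfold NearlyBtw at *
    linarith

/-- A point close to a geodesic is between two consecutive terms of any coarsely geodesic
sequence with the same endpoints. -/
theorem exists_btw_consecutive (hd : DiscreteHyperbolic d δ) {c : ℝ} {y : ℕ → α}
    {m n : ℕ} (hmn : m < n) (hy : ∀ j, m ≤ j → j ≤ n → NearlyBtw d c (y m) (y j) (y n)) {p : α}
    (hp : NearlyBtw d c (y m) p (y n)) :
    ∃ j, m ≤ j ∧ j < n ∧ NearlyBtw d (2 * c + 2 * δ) (y j) p (y (j + 1)) := by
  have h1δ := hd.one_le
  by_cases hlast : d (y m) (y (n - 1)) ≤ d (y m) p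
  · have hb := hd.btw_order (hy (n - 1) (by omega) (by omega)) hp hlast
    refine ⟨n - 1, by omega, by omega, ?_⟩
    rw [show n - 1 + 1 = n by omega]
    have := hb.2
    unfold NearlyBtw at *
    linarith
  · have hex : ∃ k, d (y m) p < d (y m) (y (m + k)) := ⟨n - 1 - m, by
      rw [show m + (n - 1 - m) = n - 1 by omega]; exact lt_of_not_ge hlast⟩
    classical
    have hspec := Nat.find_spec hex
    have hle : Nat.find hex ≤ n - 1 - m := Nat.find_min' hex (by
      rw [show m + (n - 1 - m) = n - 1 by omega]; exact lt_of_not_ge hlast)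
    have hpos : Nat.find hex ≠ 0 := by
      intro h0
      rw [h0, add_zero, hd.self] at hspec
      exact absurd (hd.nonneg (y m) p) (not_le.mpr hspec)
    obtain ⟨k, hk⟩ := Nat.exists_eq_succ_of_ne_zero hpos
    have hprev : d (y m) (y (m + k)) ≤ d (y m) p :=
      not_lt.mp (Nat.find_min hex (by omega))
    rw [hk] at hspec hle
    refine ⟨m + k, by omega, by omega, ?_⟩
    exact hd.btw_order_three (hy _ (by omega) (by omega)) hp (hy (m + k + 1) (by omega) (by omega))
      hprev hspec.le

/-- Repeated use of the four-point inequality along a path with at most `2 ^ k` edges. -/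
theorem exists_btw_of_path (hd : DiscreteHyperbolic d δ) {f : ℕ → α} {e : α → α → ℝ}
    (he : ∀ x, e x x = 0) (w : α) (k : ℕ) :
    ∀ {a b : ℕ}, a ≤ b → b ≤ a + 2 ^ k → (∀ i, a ≤ i → i < b → e (f i) (f (i + 1)) ≤ 1) →
    ∀ {c : ℝ}, NearlyBtw d c (f a) w (f b) →
    ∃ i v, a ≤ i ∧ i ≤ b ∧ e (f i) v ≤ 1 ∧ NearlyBtw d (c + k * δ) (f i) w v := by
  induction k with
  | zero =>
    intro a b hab hb hf c h
    rcases Nat.eq_or_lt_of_le hab with rfl | hlt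
    · exact ⟨a, f a, le_rfl, le_rfl, by rw [he]; exact zero_le_one, by simpa using h⟩
    · obtain rfl : b = a + 1 := by simp at hb; omega
      exact ⟨a, f (a + 1), le_rfl, by omega, hf a le_rfl hlt, by simpa using h⟩
  | succ k ih =>
    intro a b hab hb hf c h
    by_cases hsmall : b ≤ a + 2 ^ k
    · obtain ⟨i, v, h1, h2, h3, h4⟩ := ih hab hsmall hf h
      refine ⟨i, v, h1, h2, h3, h4.trans ?_⟩
      have := hd.one_le
      push_cast
      linarith
    · have hpow : 2 ^ (k + 1) = 2 ^ k + 2 ^ k := by ring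
      have key : NearlyBtw d (c + δ) (f a) w (f (a + 2 ^ k)) ∨ NearlyBtw d (c + δ) (f (a + 2 ^ k)) w (f b) := by
        have s1 := hd.symm w (f b)
        have s2 := hd.symm w (f (a + 2 ^ k))
        have s3 := hd.symm w (f a)
        have s4 := hd.symm (f b) (f (a + 2 ^ k))
        unfold NearlyBtw at *
        rcases hd.fourPoint (f a) (f b) w (f (a + 2 ^ k)) with h1 | h1
        · right; linarith
        · left; linarith
      rcases key with h' | h'
      · obtain ⟨i, v, h1, h2, h3, h4⟩ := ih (by omega) le_rfl
          (fun i hi hi' => hf i hi (by omega)) h'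
        refine ⟨i, v, h1, by omega, h3, h4.trans ?_⟩
        push_cast
        linarith
      · obtain ⟨i, v, h1, h2, h3, h4⟩ := ih (by omega) (by omega)
          (fun i hi hi' => hf i (by omega) hi') h'
        refine ⟨i, v, by omega, h2, h3, h4.trans ?_⟩
        push_cast
        linarith

/-- The Gromov product inequality, in terms of betweenness. -/
theorem btw_or_btw (hd : DiscreteHyperbolic d δ) {c : ℝ} {x y z w : α} (h : NearlyBtw d c x w y) :
    NearlyBtw d (c + δ) x w z ∨ NearlyBtw d (c + δ) z w y := by
  have s1 := hd.symm w y
  have s2 := hd.symm w z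
  have s3 := hd.symm w x
  have s4 := hd.symm y z
  unfold NearlyBtw at *
  rcases hd.fourPoint x y w z with h1 | h1
  · right; linarith
  · left; linarith

/-- If the endpoints are moved by a small amount compared with the distance to `w`, then
betweenness of `w` is preserved up to a uniform error. -/
theorem btw_of_far (hd : DiscreteHyperbolic d δ) {c s : ℝ} {x x' y y' w : α}
    (h : NearlyBtw d c x w y) (hx : d x x' ≤ s) (hy : d y y' ≤ s)
    (hxw : s + c + 2 * δ < d x w) (hyw : s + c + 2 * δ < d y w) : NearlyBtw d (c + 2 * δ) x' w y' := by
  have hδ := hd.one_le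
  have s1 := hd.symm w x'
  have s2 := hd.symm y w
  have s3 := hd.symm y y'
  have t1 := hd.tri x x' w
  have t2 := hd.tri y y' w
  have s4 := hd.symm y' w
  have hc := hd.tri x w y
  rcases hd.btw_or_btw (z := x') h with h1 | h1
  · unfold NearlyBtw at *; linarith
  · rcases hd.btw_or_btw (z := y') h1 with h2 | h2
    · unfold NearlyBtw at *; linarith
    · unfold NearlyBtw at *; linarith

section BrokenGeodesic

variable {x : ℕ → α} {K : ℕ} {c s : ℝ}

theorem btw_succ_of_broken (hd : DiscreteHyperbolic d δ)
    (hx : ∀ i, i + 2 ≤ K → NearlyBtw d c (x i) (x (i + 1)) (x (i + 2)))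
    (hs : ∀ i, i + 1 ≤ K → s ≤ d (x i) (x (i + 1))) (hcs : c + 2 * δ < s) {i k : ℕ} (hik : i < k)
    (hk : k + 1 ≤ K) : NearlyBtw d (c + δ) (x i) (x k) (x (k + 1)) := by
  have hδ := hd.one_le
  induction k, hik using Nat.le_induction with
  | base =>
    have := hx i hk
    simp only [Nat.succ_eq_add_one] at *
    unfold NearlyBtw at *
    linarith
  | succ k hik ih =>
    have h1 := ih (by omega)
    have h2 := hx k hk
    have h3 := hs k (by omega)
    rcases hd.btw_or_btw (z := x i) h2 with h | h
    · have s1 := hd.symm (x k) (x i)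
      have s2 := hd.symm (x (k + 1)) (x i)
      unfold NearlyBtw at *
      linarith
    · exact h

theorem btw_of_broken (hd : DiscreteHyperbolic d δ)
    (hx : ∀ i, i + 2 ≤ K → NearlyBtw d c (x i) (x (i + 1)) (x (i + 2)))
    (hs : ∀ i, i + 1 ≤ K → s ≤ d (x i) (x (i + 1))) (hc : 0 ≤ c) (hcs : c + 2 * δ < s)
    {i j k : ℕ} (hij : i ≤ j) (hjk : j ≤ k) (hk : k ≤ K) :
    NearlyBtw d (c + 2 * δ) (x i) (x j) (x k) := by
  have hδ := hd.one_le
  rcases Nat.eq_or_lt_of_le hij with rfl | hij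
  · unfold NearlyBtw; rw [hd.self]; linarith
  rcases Nat.eq_or_lt_of_le hjk with rfl | hjk
  · unfold NearlyBtw; rw [hd.self]; linarith
  have hfwd := hd.btw_succ_of_broken hx hs hcs hij (by omega)
  rcases Nat.eq_or_lt_of_le (Nat.succ_le_of_lt hjk) with rfl | hjk'
  · unfold NearlyBtw at *
    simp only [Nat.succ_eq_add_one]
    linarith
  have hbwd : NearlyBtw d (c + δ) (x j) (x (j + 1)) (x k) := by
    have := hd.btw_succ_of_broken (x := fun t => x (K - t)) (K := K) (c := c) (s := s)
      (i := K - k) (k := K - (j + 1)) (fun i hi => by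
        have := hd.btw_symm (hx (K - (i + 2)) (by omega))
        rwa [show K - (i + 2) + 1 = K - (i + 1) by omega,
          show K - (i + 2) + 2 = K - i by omega] at this)
      (fun i hi => by
        have := hs (K - (i + 1)) (by omega)
        rw [hd.symm]
        rwa [show K - (i + 1) + 1 = K - i by omega] at this) hcs (by omega) (by omega)
    simp only [show K - (K - k) = k by omega, show K - (K - (j + 1)) = j + 1 by omega,
      show K - (K - (j + 1) + 1) = j by omega] at this
    exact hd.btw_symm this
  have h3 := hs j (by omega)
  rcases hd.btw_or_btw (z := x k) hfwd with h | h
  · unfold NearlyBtw at *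
    linarith
  · have s1 := hd.symm (x k) (x j)
    have s2 := hd.symm (x k) (x (j + 1))
    unfold NearlyBtw at *
    linarith

theorem mul_le_dist_of_broken (hd : DiscreteHyperbolic d δ)
    (hx : ∀ i, i + 2 ≤ K → NearlyBtw d c (x i) (x (i + 1)) (x (i + 2)))
    (hs : ∀ i, i + 1 ≤ K → s ≤ d (x i) (x (i + 1))) (hc : 0 ≤ c) (hcs : c + 2 * δ < s)
    {i k : ℕ} (hik : i ≤ k) (hk : k ≤ K) : (k - i : ℝ) * (s - c - δ) ≤ d (x i) (x k) := by
  have hδ := hd.one_le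
  induction k, hik using Nat.le_induction with
  | base => simp [hd.self]
  | succ k hik ih =>
    have h1 := ih (by omega)
    have h3 := hs k (by omega)
    rcases Nat.eq_or_lt_of_le hik with rfl | hlt
    · push_cast
      linarith
    · have h2 := hd.btw_succ_of_broken hx hs hcs hlt (by omega)
      push_cast
      unfold NearlyBtw at *
      linarith

end BrokenGeodesic

end DiscreteHyperbolic

end Geometry

theorem exists_forall_mul_add_lt_two_pow (A B : ℝ) :
    ∃ k₀ : ℕ, ∀ k ≥ k₀, k * A + B < (2 : ℝ) ^ k := by
  have h1 := tendsto_pow_const_div_const_pow_of_one_lt 1 (one_lt_two (α := ℝ))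
  have h0 := tendsto_pow_const_div_const_pow_of_one_lt 0 (one_lt_two (α := ℝ))
  have h := (h1.mul_const A).add (h0.mul_const B)
  simp only [zero_mul, add_zero] at h
  obtain ⟨k₀, hk⟩ := Filter.eventually_atTop.mp (h.eventually (gt_mem_nhds one_pos))
  refine ⟨k₀, fun k hk' => ?_⟩
  have := hk k hk'
  have h2 : (0 : ℝ) < 2 ^ k := by positivity
  simp only [pow_one, pow_zero] at this
  rw [div_mul_eq_mul_div, div_mul_eq_mul_div, ← add_div, div_lt_one h2] at this
  linarith

theorem exists_log_lt (A B : ℝ) (hA : 0 ≤ A) :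
    ∃ r₀ : ℕ, ∀ r ≥ r₀, ∃ k : ℕ, 8 * r ≤ 2 ^ k ∧ k * A + B < r := by
  obtain ⟨k₀, hk₀⟩ := exists_forall_mul_add_lt_two_pow (16 * A) (16 * B)
  refine ⟨max (⌈k₀ * A + B⌉₊ + 1) 1, fun r hr => ?_⟩
  have hr0 : 1 ≤ r := le_trans (le_max_right _ _) hr
  have hr1 : ⌈k₀ * A + B⌉₊ + 1 ≤ r := le_trans (le_max_left _ _) hr
  refine ⟨Nat.clog 2 (8 * r), Nat.le_pow_clog one_lt_two _, ?_⟩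
  set k := Nat.clog 2 (8 * r) with hk
  rcases le_total k₀ k with h | h
  · have h1 := hk₀ k h
    have h2 : 2 ^ (k - 1) < 8 * r := Nat.pow_pred_clog_lt_self one_lt_two (by omega)
    have hkpos : 0 < k := Nat.clog_pos one_lt_two (by omega)
    have h3 : 2 ^ k < 16 * r := by
      rw [show k = (k - 1) + 1 by omega, pow_succ]; omega
    have h4 : (2 : ℝ) ^ k < 16 * r := by exact_mod_cast h3
    linarith
  · have h1 : (k : ℝ) ≤ k₀ := by exact_mod_cast h
    have h2 := Nat.le_ceil (k₀ * A + B)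
    have h3 : ((⌈k₀ * A + B⌉₊ : ℕ) : ℝ) + 1 ≤ r := by exact_mod_cast hr1
    have := mul_le_mul_of_nonneg_right h1 hA
    linarith

section Geometry

variable {α : Type*} {d e : α → α → ℝ} {δ : ℝ}

namespace DiscreteGeodesic

theorem exists_path (hd : DiscreteGeodesic d) (n : ℕ) : ∀ {x z : α}, d x z = n →
    ∃ f : ℕ → α, f 0 = x ∧ f n = z ∧ ∀ i < n, d (f i) (f (i + 1)) = 1 := by
  induction n with
  | zero =>
    intro x z h
    exact ⟨fun _ => x, rfl, hd.eq_of _ _ (by simpa using h), by simp⟩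
  | succ n ih =>
    intro x z h
    obtain ⟨y, hy1, hy2⟩ := hd.split x z 1 (by rw [h]; push_cast; linarith [n.cast_nonneg (α := ℝ)])
    obtain ⟨f, hf0, hfn, hf⟩ := ih (x := y) (z := z) (by rw [hy2, h]; push_cast; ring)
    refine ⟨fun i => if i = 0 then x else f (i - 1), by simp, by simpa using hfn, ?_⟩
    intro i hi
    rcases i with _ | i
    · simpa [hf0] using hy1
    · simpa using hf i (by omega)


theorem dist_le_of_steps (hd : DiscreteGeodesic d) {f : ℕ → α} {D : ℝ} {a b : ℕ} (hab : a ≤ b)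
    (hf : ∀ i, a ≤ i → i < b → d (f i) (f (i + 1)) ≤ D) : d (f a) (f b) ≤ (b - a) * D := by
  induction b, hab using Nat.le_induction with
  | base => simp [hd.self]
  | succ b hab ih =>
    have h1 := ih fun i hi hi' => hf i hi (by omega)
    have h2 := hf b hab (by omega)
    have h3 := hd.tri (f a) (f b) (f (b + 1))
    push_cast
    linarith

/-- Two points are joined by a sequence that realises the distances between its terms. -/
theorem exists_isometric_path (hd : DiscreteGeodesic d) {n : ℕ} {x z : α} (h : d x z = n) :
    ∃ f : ℕ → α, f 0 = x ∧ f n = z ∧ ∀ i j, i ≤ j → j ≤ n → d (f i) (f j) = j - i := by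
  obtain ⟨f, h0, hn, hf⟩ := hd.exists_path n h
  refine ⟨f, h0, hn, fun i j hij hj => ?_⟩
  have h1 := hd.dist_le_of_steps (f := f) (D := 1) (Nat.zero_le i) fun k _ hk =>
    (hf k (by omega)).le
  have h2 := hd.dist_le_of_steps (f := f) (D := 1) hij fun k _ hk => (hf k (by omega)).le
  have h3 := hd.dist_le_of_steps (f := f) (D := 1) hj fun k _ hk => (hf k (by omega)).le
  have t1 := hd.tri (f 0) (f i) (f n)
  have t2 := hd.tri (f i) (f j) (f n)
  rw [h0, hn, h] at t1
  rw [hn] at h3 t2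
  rw [h0] at h1
  push_cast at h1
  linarith

end DiscreteGeodesic

namespace DiscreteHyperbolic

/-- A coarse version of the Gromov product tree of geodesics: `w` nearly between the ends of a
short `e`-path is nearly between the ends of one of its edges. -/
theorem exists_edge_of_btw (hd : DiscreteHyperbolic d δ) (he : DiscreteGeodesic e) {k : ℕ} {c : ℝ}
    {a b w : α} (hk : e a b ≤ 2 ^ k) (h : NearlyBtw d c a w b) :
    ∃ u v, e u v ≤ 1 ∧ NearlyBtw d (c + k * δ) u w v ∧ e a u + e u b = e a b := by
  obtain ⟨n, hn⟩ := he.nat a b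
  obtain ⟨f, rfl, rfl, hf⟩ := he.exists_isometric_path hn
  obtain ⟨i, v, -, hi, hv, hb⟩ := hd.exists_btw_of_path he.self w k (Nat.zero_le n)
    (by rw [hn] at hk; simpa using (by exact_mod_cast hk : n ≤ 2 ^ k))
    (fun i _ hi => by rw [hf i (i + 1) (by omega) (by omega)]; push_cast; linarith) h
  exact ⟨f i, v, hv, hb, by
    rw [hf _ _ (Nat.zero_le i) hi, hf _ _ hi le_rfl, hn]; push_cast; ring⟩

/-- Along a `d`-geodesic from `y` to `x`, every small enough value of `e y` is attained. -/
theorem exists_eq_on_geodesic (hd : DiscreteGeodesic d) (he : DiscreteGeodesic e)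
    (hle : ∀ x y, e x y ≤ d x y) {x y : α} {r : ℕ} (h : (r : ℝ) ≤ e y x) :
    ∃ x', d x x' + d x' y = d x y ∧ e y x' = r := by
  obtain ⟨n, hn⟩ := hd.nat x y
  induction n generalizing x with
  | zero =>
    obtain rfl := hd.eq_of _ _ (by simpa using hn)
    exact ⟨x, by rw [hd.self]; ring, le_antisymm (by rw [he.self]; positivity) h⟩
  | succ n ih =>
    rcases eq_or_lt_of_le h with h | h
    · exact ⟨x, by rw [hd.self]; ring, h.symm⟩
    · obtain ⟨z, hz1, hz2⟩ := hd.split x y 1 (by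
        rw [hn]; push_cast; linarith [n.cast_nonneg (α := ℝ)])
      push_cast at hz1 hz2
      have t := he.tri y z x
      have l := hle z x
      rw [hd.symm, hz1] at l
      obtain ⟨m, hm⟩ := he.nat y x
      rw [hm] at h t
      have h' : (r : ℝ) + 1 ≤ m := by exact_mod_cast Nat.succ_le_of_lt (by exact_mod_cast h)
      obtain ⟨x', h1, h2⟩ := ih (x := z) (by linarith) (by rw [hz2, hn]; push_cast; ring)
      refine ⟨x', ?_, h2⟩
      have t1 := hd.tri x z x'
      have t2 := hd.tri x x' y
      linarith

/-- Geodesics of `d` are uniformly coarse geodesics for any smaller discretely geodesic distance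
all of whose edges span `d`-geodesics of bounded `e`-diameter. -/
theorem exists_reverse_triangle (hd : DiscreteHyperbolic d δ) (he : DiscreteGeodesic e)
    (hle : ∀ x y, e x y ≤ d x y) {C₀ : ℝ}
    (hedge : ∀ x y p, e x y ≤ 1 → d x p + d p y = d x y → e x p ≤ C₀) :
    ∃ C, 0 ≤ C ∧ ∀ x y z, d x y + d y z = d x z → e x y + e y z ≤ e x z + C := by
  have hδ := hd.one_le
  obtain ⟨r₀, hr₀⟩ := exists_log_lt δ (C₀ + 3 * δ) (by linarith)
  refine ⟨2 * r₀, by positivity, fun x y z hxyz => ?_⟩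
  obtain ⟨L, hL⟩ := he.nat x z
  obtain ⟨f, hf0, hfL, hf⟩ := he.exists_isometric_path hL
  suffices H : ∃ r ≤ r₀, ∀ y, d x y + d y z = d x z → ∃ i ≤ L, e y (f i) ≤ r by
    obtain ⟨r, hr, H⟩ := H
    obtain ⟨i, hi, hyi⟩ := H y hxyz
    have h1 := hf 0 i (Nat.zero_le i) hi
    have h2 := hf i L hi le_rfl
    rw [hf0] at h1
    rw [hfL] at h2
    have t1 := he.tri x (f i) y
    have t2 := he.tri y (f i) z
    have s := he.symm y (f i)
    have : (r : ℝ) ≤ r₀ := by exact_mod_cast hr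
    push_cast at h1
    linarith
  have hex : ∃ r : ℕ, ∀ y, d x y + d y z = d x z → ∃ i ≤ L, e y (f i) ≤ r := by
    obtain ⟨n, hn⟩ := hd.nat x z
    refine ⟨n, fun y hy => ⟨0, Nat.zero_le _, ?_⟩⟩
    have h1 := hle y x
    have h2 := hd.symm y x
    have h3 := hd.nonneg y z
    rw [hf0]
    linarith
  classical
  refine ⟨Nat.find hex, not_lt.mp fun hlt => ?_, Nat.find_spec hex⟩
  set r := Nat.find hex with hr
  obtain ⟨k, hk1, hk2⟩ := hr₀ r hlt.le
  have hmin := Nat.find_min hex (m := r - 1) (by omega)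
  push Not at hmin
  obtain ⟨y, hy, hyf⟩ := hmin
  replace hyf : ∀ i ≤ L, (r : ℝ) ≤ e y (f i) := by
    intro i hi
    have h1 := hyf i hi
    obtain ⟨m, hm⟩ := he.nat y (f i)
    rw [hm] at h1 ⊢
    have : r - 1 < m := by exact_mod_cast h1
    exact_mod_cast (by omega : r ≤ m)
  -- an end point of the geodesic, or a point at `e`-distance exactly `2 * r` from `y`
  have side : ∀ x' i₀, i₀ ≤ L → f i₀ = x' → (∀ p, d x' p + d p y = d x' y → d x p + d p z = d x z) →
      ∃ p i, d x' p + d p y = d x' y ∧ i ≤ L ∧ e p (f i) ≤ r ∧ e y p ≤ 2 * r ∧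
        ∀ u, e p u + e u (f i) = e p (f i) → (r : ℝ) ≤ e y u := by
    intro x' i₀ hi₀ hfi₀ hx'
    by_cases hfar : ((2 * r : ℕ) : ℝ) ≤ e y x'
    · obtain ⟨p, hp, hep⟩ := exists_eq_on_geodesic hd.toDiscreteGeodesic he hle hfar
      obtain ⟨i, hi, hpi⟩ := Nat.find_spec hex p (hx' p hp)
      push_cast at hep
      refine ⟨p, i, hp, hi, hpi, hep.le, fun u hu => ?_⟩
      have t := he.tri y u p
      have s := he.symm u p
      have n := he.nonneg u (f i)
      linarith
    · push_cast at hfar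
      refine ⟨x', i₀, by rw [hd.self]; ring, hi₀, by rw [hfi₀, he.self]; positivity,
        (not_le.mp hfar).le, fun u hu => ?_⟩
      rw [hfi₀, he.self] at hu
      have h1 := he.nonneg x' u
      have h2 := he.nonneg u x'
      rw [← he.eq_of x' u (by linarith), ← hfi₀]
      exact hyf _ hi₀
  obtain ⟨p, i, hp, hi, hpi, hyp, hpu⟩ := side x 0 (Nat.zero_le _) hf0 (fun p hp => by
    have t := hd.tri p y z
    have t2 := hd.tri x p z
    linarith)
  obtain ⟨q, j, hq, hj, hqj, hyq, hqu⟩ := side z L le_rfl hfL (fun q hq => by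
    have t := hd.tri x y q
    have t2 := hd.tri x q z
    have s1 := hd.symm z q
    have s2 := hd.symm z y
    have s3 := hd.symm y q
    linarith)
  have hbtw : NearlyBtw d 0 p y q := by
    have t := hd.tri x p z
    have t2 := hd.tri p q z
    have s1 := hd.symm z q
    have s2 := hd.symm z y
    have s3 := hd.symm y q
    unfold NearlyBtw
    linarith
  have hr8 : (8 : ℝ) * r ≤ 2 ^ k := by exact_mod_cast hk1
  have hrpos : (0 : ℝ) ≤ r := by positivity
  -- an edge far from `y` nearly containing `y` is impossible
  have edge : ∀ u v, e u v ≤ 1 → NearlyBtw d (2 * δ + k * δ) u y v → (r : ℝ) ≤ e y u → False := by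
    intro u v huv hb hu
    obtain ⟨m, hm1, hm2⟩ := hd.exists_near_geodesic hb
    have h1 := hedge u v m huv hm1
    have h2 := hle y m
    have h3 := he.tri y m u
    have h4 := he.symm u m
    linarith
  have mono : ∀ {c a b}, c ≤ 2 * δ → NearlyBtw d (c + k * δ) a y b →
      NearlyBtw d (2 * δ + k * δ) a y b := fun hc h => by unfold NearlyBtw at *; linarith
  have mid : ∀ i j, i ≤ j → j ≤ L → e (f i) (f j) ≤ 6 * r → NearlyBtw d (2 * δ) (f i) y (f j) →
      False := by
    intro i j hij hj hfar hb
    rw [hf i j hij hj] at hfar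
    have hle : (j : ℝ) ≤ i + 2 ^ k := by linarith
    obtain ⟨l, v, hl1, hl2, hv, hlv⟩ := hd.exists_btw_of_path he.self y k hij
      (by exact_mod_cast hle)
      (fun l hl hl' => by rw [hf l (l + 1) (by omega) (by omega)]; push_cast; linarith) hb
    exact edge _ _ hv hlv (hyf l (by omega))
  have hij : e (f i) (f j) ≤ 6 * r := by
    have t1 := he.tri (f i) p (f j)
    have t2 := he.tri p y (f j)
    have t3 := he.tri y q (f j)
    have s1 := he.symm p (f i)
    have s2 := he.symm y p
    linarith
  rcases hd.btw_or_btw (z := f i) hbtw with h | h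
  · obtain ⟨u, v, huv, hb, hu⟩ := hd.exists_edge_of_btw he (k := k) (by linarith) h
    exact edge u v huv (mono (by linarith) hb) (hpu u hu)
  rcases hd.btw_or_btw (z := f j) h with h | h
  · rcases le_total i j with hij' | hij'
    · exact mid i j hij' hj hij (by unfold NearlyBtw at *; linarith)
    · exact mid j i hij' hi (by rwa [he.symm]) (hd.btw_symm (by unfold NearlyBtw at *; linarith))
  · obtain ⟨u, v, huv, hb, hu⟩ := hd.exists_edge_of_btw he (k := k) (a := q) (by linarith)
      (hd.btw_symm h)
    exact edge u v huv (mono (by linarith) hb) (hqu u hu)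

end DiscreteHyperbolic

end Geometry

section Geometry

variable {α : Type*} {d e : α → α → ℝ} {δ : ℝ}

namespace DiscreteHyperbolic

/-- Opposite sides of a quadrilateral whose sum is nearly maximal nearly intersect. -/
theorem exists_btw_btw (hd : DiscreteHyperbolic d δ) {w x y z : α}
    (h : d w x + d y z ≤ d w y + d x z + δ) :
    ∃ p, NearlyBtw d 0 w p y ∧ NearlyBtw d (4 * δ + 2) x p z := by
  have hδ := hd.one_le
  have t1 := hd.tri x w y
  have t2 := hd.tri w y x
  have t3 := hd.tri w x y
  have sxw := hd.symm x w
  have syx := hd.symm y x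
  set m := (d w x + d w y - d x y) / 2 with hm
  have hm0 : 0 ≤ m := by rw [hm]; linarith
  have h1 := Nat.floor_le hm0
  have h2 := Nat.lt_floor_add_one m
  obtain ⟨p, hp1, hp2⟩ := hd.split w y ⌊m⌋₊ (by linarith)
  refine ⟨p, by unfold NearlyBtw; linarith, ?_⟩
  have a1 := hd.fourPoint x p w y
  have a2 := hd.fourPoint z p w y
  have a3 := hd.fourPoint w z x y
  have s1 := hd.symm p w
  have s2 := hd.symm p y
  have s3 := hd.symm p z
  have s4 := hd.symm x z
  have s5 := hd.symm w z
  have s6 := hd.symm y z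
  unfold NearlyBtw
  rcases a1 with a1 | a1 <;> rcases a2 with a2 | a2 <;> rcases a3 with a3 | a3 <;> linarith

theorem reverse_triangle (hd : DiscreteHyperbolic d δ) (he : DiscreteGeodesic e)
    (hle : ∀ x y, e x y ≤ d x y) {C : ℝ}
    (hC : ∀ x y z, d x y + d y z = d x z → e x y + e y z ≤ e x z + C) {c : ℝ} {x y z : α}
    (h : NearlyBtw d c x y z) : NearlyBtw e (C + 2 * (c + δ)) x y z := by
  obtain ⟨p, hp1, hp2⟩ := hd.exists_near_geodesic h
  have h1 := hC x p z hp1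
  have h2 := hle y p
  have t1 := he.tri x p y
  have t2 := he.tri y p z
  have s := he.symm y p
  unfold NearlyBtw
  linarith

/-- A smaller discretely geodesic distance for which `d`-geodesics are coarse geodesics is again
hyperbolic. -/
theorem of_reverse_triangle (hd : DiscreteHyperbolic d δ) (he : DiscreteGeodesic e)
    (hle : ∀ x y, e x y ≤ d x y) {C : ℝ} (hC0 : 0 ≤ C)
    (hC : ∀ x y z, d x y + d y z = d x z → e x y + e y z ≤ e x z + C) :
    DiscreteHyperbolic e (2 * C + 12 * δ + 4) where
  toDiscreteGeodesic := he
  one_le := by linarith [hd.one_le]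
  fourPoint := by
    have key : ∀ w x y z, d w x + d y z ≤ d w y + d x z + δ →
        e w x + e y z ≤ e w y + e x z + (2 * C + 12 * δ + 4) := by
      intro w x y z h
      obtain ⟨p, hp1, hp2⟩ := hd.exists_btw_btw h
      have h1 := hd.reverse_triangle he hle hC hp1
      have h2 := hd.reverse_triangle he hle hC hp2
      have t1 := he.tri w p x
      have t2 := he.tri y p z
      have s1 := he.symm x p
      have s2 := he.symm y p
      unfold NearlyBtw at *
      linarith
    intro w x y z
    rcases hd.fourPoint w x y z with h | h
    · exact Or.inl (key w x y z h)
    · right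
      have := key w x z y (by rw [hd.symm z y, hd.symm x y] at *; linarith [hd.symm x y])
      rwa [he.symm z y] at this

end DiscreteHyperbolic

end Geometry

/-- A left-invariant hyperbolic distance on a group. -/
structure InvariantHyperbolic {G : Type*} [Group G] (d : G → G → ℝ) (δ : ℝ) : Prop
    extends DiscreteHyperbolic d δ where
  left : ∀ g x y, d (g * x) (g * y) = d x y

/-- The powers of `a` form a coarse geodesic line. -/
structure QuasiAxis {G : Type*} [Group G] (d : G → G → ℝ) (a : G) (c : ℝ) : Prop where
  one_le : 1 ≤ c
  step : d 1 a ≤ c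
  btw : ∀ i j k : ℤ, i ≤ j → j ≤ k → NearlyBtw d c (a ^ i) (a ^ j) (a ^ k)
  lower : ∀ n : ℤ, |(n : ℝ)| ≤ c * d 1 (a ^ n) + c

section Axis

variable {G : Type*} [Group G] {d : G → G → ℝ} {δ : ℝ}

namespace InvariantHyperbolic

theorem dist_zpow (hd : InvariantHyperbolic d δ) (a : G) (i j : ℤ) :
    d (a ^ i) (a ^ j) = d 1 (a ^ (j - i)) := by
  rw [← hd.left (a ^ i) 1, mul_one, ← zpow_add]
  congr 2
  ring

theorem dist_one_inv (hd : InvariantHyperbolic d δ) (g : G) : d 1 g⁻¹ = d 1 g := by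
  rw [← hd.left g, mul_one, mul_inv_cancel, hd.symm]

theorem dist_one_zpow_neg (hd : InvariantHyperbolic d δ) (a : G) (n : ℤ) :
    d 1 (a ^ (-n)) = d 1 (a ^ n) := by
  rw [zpow_neg, hd.dist_one_inv]

theorem dist_one_pow_le (hd : InvariantHyperbolic d δ) (a : G) (n : ℕ) :
    d 1 (a ^ n) ≤ n * d 1 a := by
  have := hd.dist_le_of_steps (f := fun i => a ^ i) (D := d 1 a) (Nat.zero_le n) fun i _ _ => by
    have := hd.dist_zpow a i (i + 1)
    rw [add_sub_cancel_left, zpow_one] at this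
    exact_mod_cast this.le
  simpa using this

theorem dist_one_zpow_le (hd : InvariantHyperbolic d δ) (a : G) (n : ℤ) :
    d 1 (a ^ n) ≤ |(n : ℝ)| * d 1 a := by
  obtain ⟨m, rfl | rfl⟩ := n.eq_nat_or_neg
  · simpa using hd.dist_one_pow_le a m
  · rw [hd.dist_one_zpow_neg]
    simpa using hd.dist_one_pow_le a m

theorem dist_zpow_le (hd : InvariantHyperbolic d δ) (a : G) (i j : ℤ) :
    d (a ^ i) (a ^ j) ≤ |(j : ℝ) - i| * d 1 a := by
  rw [hd.dist_zpow]
  exact_mod_cast hd.dist_one_zpow_le a (j - i)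

/-- If some power has a doubling defect small compared with its length, the powers form a coarse
geodesic. -/
theorem exists_btw_zpow (hd : InvariantHyperbolic d δ) {a : G} {n : ℕ} (hn : 0 < n)
    (h : d 1 (a ^ n) + 2 * δ < d 1 (a ^ (2 * n))) :
    ∃ c, ∀ i j k : ℤ, i ≤ j → j ≤ k → NearlyBtw d c (a ^ i) (a ^ j) (a ^ k) := by
  set c := 2 * d 1 (a ^ n) - d 1 (a ^ (2 * n)) with hc
  have hstep : ∀ i : ℤ, d (a ^ i) (a ^ (i + n)) = d 1 (a ^ n) := fun i => by
    rw [hd.dist_zpow, add_sub_cancel_left, zpow_natCast]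
  have hstep2 : ∀ i : ℤ, d (a ^ i) (a ^ (i + n + n)) = d 1 (a ^ (2 * n)) := fun i => by
    rw [hd.dist_zpow, show i + n + n - i = ((2 * n : ℕ) : ℤ) by push_cast; ring, zpow_natCast]
  have hc0 : 0 ≤ c := by
    have := hd.tri (a ^ (0 : ℤ)) (a ^ (0 + n : ℤ)) (a ^ (0 + n + n : ℤ))
    rw [hstep, hstep, hstep2] at this
    linarith
  refine ⟨c + 2 * δ + 2 * (n * d 1 a) + 2 * (n * d 1 a), fun i j k hij hjk => ?_⟩
  obtain ⟨p, hp⟩ := Int.eq_ofNat_of_zero_le (show 0 ≤ j - i by omega)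
  obtain ⟨q, hq⟩ := Int.eq_ofNat_of_zero_le (show 0 ≤ k - i by omega)
  have hb : NearlyBtw d (c + 2 * δ) (a ^ (i + n * (0 : ℕ) : ℤ)) (a ^ (i + n * (p / n : ℕ) : ℤ))
      (a ^ (i + n * (q / n : ℕ) : ℤ)) := by
    refine hd.btw_of_broken (x := fun t : ℕ => a ^ (i + n * t : ℤ)) (K := q / n)
      (s := d 1 (a ^ n)) ?_ ?_ hc0 (by linarith) (Nat.zero_le _)
      (Nat.div_le_div_right (by omega)) le_rfl
    · intro t _
      have e1 : (i + n * ((t + 1 : ℕ) : ℤ)) = i + n * t + n := by push_cast; ring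
      have e2 : (i + n * ((t + 2 : ℕ) : ℤ)) = i + n * t + n + n := by push_cast; ring
      simp only [e1, e2]
      unfold NearlyBtw
      rw [hstep, hstep, hstep2]
      linarith
    · intro t _
      have e1 : (i + n * ((t + 1 : ℕ) : ℤ)) = i + n * t + n := by push_cast; ring
      simp only [e1]
      rw [hstep]
  have near : ∀ m : ℕ, d (a ^ (i + n * (m / n : ℕ) : ℤ)) (a ^ (i + m : ℤ)) ≤ n * d 1 a := fun m => by
    have h1 := Nat.div_add_mod m n
    have h2 := Nat.mod_lt m hn
    have e : (i + m : ℤ) - (i + n * (m / n : ℕ)) = (m % n : ℕ) := by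
      have : (m : ℤ) = ((n * (m / n) + m % n : ℕ) : ℤ) := by rw [h1]
      push_cast at this ⊢
      linarith
    rw [hd.dist_zpow, e, zpow_natCast]
    refine (hd.dist_one_pow_le a _).trans (mul_le_mul_of_nonneg_right ?_ (hd.nonneg _ _))
    exact_mod_cast h2.le
  rw [show j = i + p by omega, show k = i + q by omega]
  have h1 := hd.btw_of_close_mid hb (near p)
  have h2 := hd.btw_of_close h1 (le_of_eq (hd.self _)) (near q)
  simp only [Nat.cast_zero, mul_zero, add_zero] at h2
  exact h2

theorem exists_quasiAxis (hd : InvariantHyperbolic d δ) {a : G} {A B : ℝ} (hA : 1 ≤ A)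
    (h : ∀ n : ℤ, |(n : ℝ)| / A - B ≤ d 1 (a ^ n)) : ∃ c, QuasiAxis d a c := by
  have hδ := hd.one_le
  have hA0 : 0 < A := by linarith
  have hlow : ∀ n : ℤ, |(n : ℝ)| ≤ A * d 1 (a ^ n) + A * B := fun n => by
    have := h n
    rw [sub_le_iff_le_add, div_le_iff₀ hA0] at this
    linarith
  have hdouble : ∃ n : ℕ, 0 < n ∧ d 1 (a ^ n) + 2 * δ < d 1 (a ^ (2 * n)) := by
    by_contra! hcon
    have hlog : ∀ k : ℕ, d 1 (a ^ (2 ^ k)) ≤ d 1 a + k * (2 * δ) := fun k => by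
      induction k with
      | zero => simp
      | succ k ih =>
        have := hcon (2 ^ k) (by positivity)
        rw [pow_succ', Nat.cast_succ]
        linarith
    obtain ⟨k, hk⟩ := exists_forall_mul_add_lt_two_pow (A * (2 * δ)) (A * d 1 a + A * B)
    have h1 := hk k le_rfl
    have h2 := hlow ((2 ^ k : ℕ) : ℤ)
    rw [zpow_natCast] at h2
    push_cast at h2
    rw [abs_of_nonneg (by positivity)] at h2
    have h3 := mul_le_mul_of_nonneg_left (hlog k) hA0.le
    linarith
  obtain ⟨n, hn, hn'⟩ := hdouble
  obtain ⟨c, hc⟩ := hd.exists_btw_zpow hn hn'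
  refine ⟨max (max c (d 1 a)) (max A (A * B)), ?_, ?_, ?_, ?_⟩
  · exact hA.trans ((le_max_left _ _).trans (le_max_right _ _))
  · exact (le_max_right _ _).trans (le_max_left _ _)
  · intro i j k hij hjk
    refine (hc i j k hij hjk).trans ?_
    have := (le_max_left c (d 1 a)).trans (le_max_left _ (max A (A * B)))
    linarith
  · intro n
    have h1 := (le_max_left A (A * B)).trans (le_max_right (max c (d 1 a)) _)
    have h2 := (le_max_right A (A * B)).trans (le_max_right (max c (d 1 a)) _)
    have h3 := mul_le_mul_of_nonneg_right h1 (hd.nonneg 1 (a ^ n))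
    have := hlow n
    linarith

end InvariantHyperbolic

namespace QuasiAxis

variable {a : G} {c : ℝ}

theorem exists_near (ha : QuasiAxis d a c) (hd : InvariantHyperbolic d δ) {c' : ℝ} {i k : ℤ}
    (hik : i ≤ k) (hc' : 0 ≤ c') {p : G} (hp : NearlyBtw d c' (a ^ i) p (a ^ k)) :
    ∃ t, i ≤ t ∧ t ≤ k ∧ d p (a ^ t) ≤ 3 * c + 2 * c' + 2 * δ := by
  have hδ := hd.one_le
  have hc := ha.one_le
  have hstep : ∀ j : ℤ, d (a ^ j) (a ^ (j + 1)) ≤ c := fun j => by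
    rw [hd.dist_zpow, add_sub_cancel_left, zpow_one]; exact ha.step
  rcases eq_or_lt_of_le hik with rfl | hlt
  · refine ⟨i, le_rfl, le_rfl, ?_⟩
    unfold NearlyBtw at hp
    rw [hd.self, hd.symm (a ^ i)] at hp
    linarith
  · obtain ⟨n, hn⟩ := Int.eq_ofNat_of_zero_le (show 0 ≤ k - i by omega)
    obtain rfl : k = i + n := by omega
    obtain ⟨j, -, hj, hb⟩ := hd.exists_btw_consecutive (y := fun j : ℕ => a ^ (i + j : ℤ))
      (c := c + c') (m := 0) (n := n) (by omega)
      (fun j _ hj => by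
        have := ha.btw (i + (0 : ℕ)) (i + j) (i + n) (by omega) (by omega)
        unfold NearlyBtw at *
        linarith) (p := p) (by
        unfold NearlyBtw at *
        simp only [Nat.cast_zero, add_zero]
        linarith)
    refine ⟨i + j, by omega, by omega, ?_⟩
    have h1 := hstep (i + j)
    unfold NearlyBtw at hb
    push_cast at hb
    rw [← add_assoc] at hb
    have h2 := hd.nonneg p (a ^ (i + j + 1))
    rw [hd.symm]
    linarith

theorem lower' (ha : QuasiAxis d a c) (hd : InvariantHyperbolic d δ) (i j : ℤ) :
    |(j : ℝ) - i| ≤ c * d (a ^ i) (a ^ j) + c := by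
  rw [hd.dist_zpow]
  exact_mod_cast ha.lower (j - i)

theorem exists_far (ha : QuasiAxis d a c) (R : ℝ) :
    ∃ n : ℕ, ∀ m : ℤ, (n : ℤ) ≤ |m| → R < d 1 (a ^ m) := by
  have hc := ha.one_le
  obtain ⟨n, hn⟩ := exists_nat_gt (c * R + c)
  refine ⟨n, fun m hm => ?_⟩
  have h1 := ha.lower m
  have h2 : (n : ℝ) ≤ |(m : ℝ)| := by exact_mod_cast hm
  by_contra! h3
  have := mul_le_mul_of_nonneg_left h3 (by linarith : 0 ≤ c)
  linarith

end QuasiAxis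

/-- The elements that commute with, or invert, a nontrivial power of `a`. -/
def elementarySubgroup (a : G) : Subgroup G where
  carrier := {g | ∃ m s : ℤ, m ≠ 0 ∧ (s = 1 ∨ s = -1) ∧ MulAut.conj g (a ^ m) = a ^ (s * m)}
  one_mem' := ⟨1, 1, one_ne_zero, Or.inl rfl, by simp⟩
  mul_mem' := by
    rintro g h ⟨m, s, hm, hs, hg⟩ ⟨n, t, hn, ht, hh⟩
    refine ⟨m * n, s * t, mul_ne_zero hm hn, by rcases hs with rfl | rfl <;> rcases ht with rfl | rfl <;> simp, ?_⟩
    rw [map_mul, MulAut.mul_apply, mul_comm m n, zpow_mul, map_zpow, hh, ← zpow_mul,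
      show t * n * m = m * (t * n) by ring, zpow_mul, map_zpow, hg, ← zpow_mul]
    congr 1
    ring
  inv_mem' := by
    rintro g ⟨m, s, hm, hs, hg⟩
    refine ⟨m, s, hm, hs, ?_⟩
    have h1 : MulAut.conj g (a ^ (s * m)) = a ^ m := by
      rw [mul_comm, zpow_mul, map_zpow, hg, ← zpow_mul]
      congr 1
      rcases hs with rfl | rfl <;> ring
    rw [← h1, map_inv, MulAut.inv_apply_self]

theorem self_mem_elementarySubgroup (a : G) : a ∈ elementarySubgroup a :=
  show ∃ m s : ℤ, m ≠ 0 ∧ (s = 1 ∨ s = -1) ∧ MulAut.conj a (a ^ m) = a ^ (s * m) from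
    ⟨1, 1, one_ne_zero, Or.inl rfl, by simp⟩

theorem zpow_mem_elementarySubgroup (a : G) (n : ℤ) : a ^ n ∈ elementarySubgroup a :=
  Subgroup.zpow_mem _ (self_mem_elementarySubgroup a) n

end Axis

/-- Acylindricity of left multiplication, phrased with finite sets. -/
def FinsetAcylindrical {G : Type*} [Group G] (d : G → G → ℝ) : Prop :=
  ∀ ε : ℝ, ∃ (R : ℝ) (N : ℕ), ∀ x y : G, R ≤ d x y → ∀ F : Finset G,
    (∀ g ∈ F, d x (g * x) ≤ ε ∧ d y (g * y) ≤ ε) → F.card ≤ N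

section Elementary

variable {G : Type*} [Group G] {d : G → G → ℝ} {δ : ℝ}

theorem AcylindricalWith.finsetAcylindrical (h : AcylindricalWith d (leftTranslation (G := G))) :
    FinsetAcylindrical d := by
  intro ε
  obtain ⟨R, N, -, H⟩ := h (max ε 1) (lt_max_of_lt_right one_pos)
  refine ⟨R, N, fun x y hxy F hF => ?_⟩
  obtain ⟨hfin, hcard⟩ := H x y hxy
  refine le_trans ?_ hcard
  rw [Nat.card_coe_set_eq, ← Set.ncard_coe_finset]
  exact Set.ncard_le_ncard (fun g hg => ⟨(hF g hg).1.trans (le_max_left _ _),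
    (hF g hg).2.trans (le_max_left _ _)⟩) hfin

theorem FinsetAcylindrical.acylindricalWith (h : FinsetAcylindrical d) :
    AcylindricalWith d (leftTranslation (G := G)) := by
  intro ε _
  obtain ⟨R, N, H⟩ := h ε
  refine ⟨max R 0, N, le_max_right _ _, fun x y hxy => ?_⟩
  have key : ∀ F : Finset G, (F : Set G) ⊆ {g : G | d x (leftTranslation g x) ≤ ε ∧
      d y (leftTranslation g y) ≤ ε} → F.card ≤ N := fun F hF =>
    H x y ((le_max_left _ _).trans hxy) F fun g hg => hF hg
  have hfin : {g : G | d x (leftTranslation g x) ≤ ε ∧ d y (leftTranslation g y) ≤ ε}.Finite := by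
    by_contra hinf
    obtain ⟨F, hF, hcard⟩ := Set.Infinite.exists_subset_card_eq hinf (N + 1)
    have := key F hF
    omega
  refine ⟨hfin, ?_⟩
  rw [Nat.card_coe_set_eq, Set.ncard_eq_toFinset_card _ hfin]
  exact key _ (by simp)

theorem FinsetAcylindrical.exists_eq (h : FinsetAcylindrical d) (ε : ℝ) :
    ∃ (R : ℝ) (N : ℕ), ∀ x y : G, R ≤ d x y → ∀ u : ℕ → G,
      (∀ k ≤ N, d x (u k * x) ≤ ε ∧ d y (u k * y) ≤ ε) → ∃ k l, k < l ∧ l ≤ N ∧ u k = u l := by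
  classical
  obtain ⟨R, N, H⟩ := h ε
  refine ⟨R, N, fun x y hxy u hu => ?_⟩
  have h1 := H x y hxy ((Finset.range (N + 1)).image u) (by
    intro g hg
    obtain ⟨k, hk, rfl⟩ := Finset.mem_image.mp hg
    exact hu k (by simpa [Nat.lt_succ_iff] using hk))
  obtain ⟨k, hk, l, hl, hkl, huv⟩ := Finset.exists_ne_map_eq_of_card_lt_of_maps_to
    (s := Finset.range (N + 1)) (t := (Finset.range (N + 1)).image u) (f := u)
    (by rw [Finset.card_range]; omega) (fun k hk => Finset.mem_image_of_mem u hk)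
  rw [Finset.mem_range] at hk hl
  rcases lt_or_gt_of_ne hkl with hlt | hlt
  · exact ⟨k, l, hlt, by omega, huv⟩
  · exact ⟨l, k, hlt, by omega, huv.symm⟩

namespace QuasiAxis

variable {a : G} {c : ℝ}

theorem mem_elementarySubgroup_of_parallel (hd : InvariantHyperbolic d δ)
    {R c₁ : ℝ} {N M : ℕ}
    (hN : ∀ x y : G, R ≤ d x y → ∀ u : ℕ → G,
      (∀ k ≤ N, d x (u k * x) ≤ 2 * c₁ ∧ d y (u k * y) ≤ 2 * c₁) → ∃ k l, k < l ∧ l ≤ N ∧ u k = u l)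
    (hM : ∀ m : ℤ, (M : ℤ) ≤ |m| → R < d 1 (a ^ m)) {g : G} {i i' s : ℤ} (hs : s = 1 ∨ s = -1)
    (h : ∀ k : ℕ, k ≤ N + M → d (g * a ^ (i + k)) (a ^ (i' + s * k)) ≤ c₁) :
    g ∈ elementarySubgroup a := by
  have key : ∀ k k₂ : ℕ, k + k₂ ≤ N + M →
      d (a ^ (i' + s * k₂)) (a ^ (-(s * k)) * g * a ^ (k : ℤ) * g⁻¹ * a ^ (i' + s * k₂)) ≤
        2 * c₁ := by
    intro k k₂ hk
    have h1 := h k₂ (by omega)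
    have h2 := h (k + k₂) hk
    rw [← hd.left (a ^ (-(s * k)))] at h2
    rw [← hd.left (a ^ (-(s * k)) * g * a ^ (k : ℤ) * g⁻¹)] at h1
    have e1 : a ^ (-(s * k)) * g * a ^ (k : ℤ) * g⁻¹ * (g * a ^ (i + k₂)) =
        a ^ (-(s * k)) * (g * a ^ (i + ((k + k₂ : ℕ) : ℤ))) := by
      rw [show i + ((k + k₂ : ℕ) : ℤ) = k + (i + k₂) by push_cast; ring, zpow_add a k]
      group
    have e2 : a ^ (-(s * k)) * a ^ (i' + s * ((k + k₂ : ℕ) : ℤ)) = a ^ (i' + s * k₂) := by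
      rw [← zpow_add]
      congr 1
      push_cast
      ring
    rw [e1] at h1
    rw [e2] at h2
    have t := hd.tri (a ^ (i' + s * k₂)) (a ^ (-(s * k)) * (g * a ^ (i + ((k + k₂ : ℕ) : ℤ))))
      (a ^ (-(s * k)) * g * a ^ (k : ℤ) * g⁻¹ * a ^ (i' + s * k₂))
    have s1 := hd.symm (a ^ (i' + s * k₂)) (a ^ (-(s * k)) * (g * a ^ (i + ((k + k₂ : ℕ) : ℤ))))
    linarith
  obtain ⟨k, l, hkl, -, huv⟩ := hN (a ^ (i' + s * (0 : ℕ))) (a ^ (i' + s * M)) (by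
    rw [hd.dist_zpow]
    refine (hM _ ?_).le
    rcases hs with rfl | rfl <;> simp) (fun k => a ^ (-(s * k)) * g * a ^ (k : ℤ) * g⁻¹)
    (fun k hk => ⟨key k 0 (by omega), key k M (by omega)⟩)
  refine ⟨l - k, s, by omega, hs, ?_⟩
  have huv' : a ^ (-(s * (l : ℤ))) * (g * a ^ (l : ℤ) * g⁻¹) =
      a ^ (-(s * (k : ℤ))) * (g * a ^ (k : ℤ) * g⁻¹) := by
    simpa only [mul_assoc] using huv.symm
  rw [MulAut.conj_apply, zpow_sub, mul_sub, zpow_sub]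
  rw [zpow_neg, zpow_neg, inv_mul_eq_iff_eq_mul] at huv'
  calc g * (a ^ (l : ℤ) * (a ^ (k : ℤ))⁻¹) * g⁻¹
      = (g * a ^ (l : ℤ) * g⁻¹) * (g * a ^ (k : ℤ) * g⁻¹)⁻¹ := by group
    _ = _ := by rw [huv']; group

/-- An element that keeps a long piece of the axis of `a` close to that axis is elementary. -/
theorem exists_mem_elementarySubgroup (ha : QuasiAxis d a c) (hd : InvariantHyperbolic d δ)
    (hac : FinsetAcylindrical d) {c' : ℝ} (hc' : 0 ≤ c') :
    ∃ C : ℕ, ∀ (g : G) (i j i' j' : ℤ), d (g * a ^ i) (a ^ i') ≤ c' → d (g * a ^ j) (a ^ j') ≤ c' →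
      (C : ℤ) ≤ |i - j| → g ∈ elementarySubgroup a := by
  have hδ := hd.one_le
  have hc := ha.one_le
  obtain ⟨R, N, hN⟩ := hac.exists_eq (2 * (5 * c' + c + δ))
  obtain ⟨M, hM⟩ := ha.exists_far R
  obtain ⟨C, hC⟩ := exists_nat_gt (c * (2 * c' + (N + M) * c) + c + (N + M))
  refine ⟨C, fun g => ?_⟩
  have key : ∀ i j i' j' : ℤ, i ≤ j → d (g * a ^ i) (a ^ i') ≤ c' → d (g * a ^ j) (a ^ j') ≤ c' →
      (C : ℤ) ≤ |i - j| → g ∈ elementarySubgroup a := by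
    intro i j i' j' hij hi hj hCij
    have hJ : (N + M : ℝ) ≤ j - i ∧ (N + M : ℝ) ≤ |(j' : ℝ) - i'| := by
      have h1 : (C : ℝ) ≤ j - i := by
        rw [abs_sub_comm, abs_of_nonneg (by omega)] at hCij
        exact_mod_cast hCij
      have h2 : (0 : ℝ) ≤ c * (2 * c' + (N + M) * c) + c := by positivity
      refine ⟨by linarith, ?_⟩
      by_contra! hlt
      have h3 := hd.dist_zpow_le a i' j'
      have h4 := ha.lower' hd i j
      have t1 := hd.tri (g * a ^ i) (a ^ i') (g * a ^ j)
      have t2 := hd.tri (a ^ i') (a ^ j') (g * a ^ j)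
      have s1 := hd.symm (a ^ j') (g * a ^ j)
      have h5 : |(j' : ℝ) - i'| * d 1 a ≤ (N + M) * c :=
        mul_le_mul hlt.le ha.step (hd.nonneg _ _) (by positivity)
      have h6 := hd.left g (a ^ i) (a ^ j)
      have h7 : d (a ^ i) (a ^ j) ≤ 2 * c' + (N + M) * c := by linarith
      have h8 := mul_le_mul_of_nonneg_left h7 (by linarith : 0 ≤ c)
      rw [abs_of_nonneg (by linarith [(Nat.cast_nonneg C : (0 : ℝ) ≤ C)])] at h4
      have h9 : (0 : ℝ) ≤ N + M := by positivity
      linarith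
    obtain ⟨hJ1, hJ2⟩ := hJ
    replace hJ1 : (N + M : ℤ) ≤ j - i := by exact_mod_cast hJ1
    replace hJ2 : (N + M : ℤ) ≤ |j' - i'| := by exact_mod_cast hJ2
    obtain ⟨s, hs, hsj⟩ : ∃ s : ℤ, (s = 1 ∨ s = -1) ∧ s * |j' - i'| = j' - i' := by
      rcases le_total 0 (j' - i') with h | h
      · exact ⟨1, Or.inl rfl, by rw [abs_of_nonneg h, one_mul]⟩
      · exact ⟨-1, Or.inr rfl, by rw [abs_of_nonpos h]; ring⟩
    refine mem_elementarySubgroup_of_parallel hd (R := R) (c₁ := 5 * c' + c + δ) (N := N)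
      (M := M) hN hM (i := i) (i' := i') hs fun k hk => ?_
    have b1 : NearlyBtw d (c + 2 * c' + 2 * c') (a ^ j') (g * a ^ (i + k)) (a ^ i') := by
      refine hd.btw_symm (hd.btw_of_close ?_ hi hj)
      have := ha.btw i (i + k) j (by omega) (by omega)
      unfold NearlyBtw at *
      rwa [hd.left, hd.left, hd.left]
    have b2 : NearlyBtw d c (a ^ j') (a ^ (i' + s * k)) (a ^ i') := by
      rcases hs with rfl | rfl
      · have : (N + M : ℤ) ≤ j' - i' := by rw [one_mul] at hsj; omega
        exact hd.btw_symm (ha.btw _ _ _ (by omega) (by omega))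
      · have : (N + M : ℤ) ≤ i' - j' := by omega
        exact ha.btw _ _ _ (by omega) (by omega)
    have h1 := hd.dist_le_of_btw (c := c + 4 * c') (by unfold NearlyBtw at *; linarith)
      (by unfold NearlyBtw at *; linarith) (p := g * a ^ (i + k)) (q := a ^ (i' + s * k))
      (x := a ^ j') (y := a ^ i')
    have h2 : |d (g * a ^ (i + k)) (a ^ i') - d (a ^ (i' + s * k)) (a ^ i')| ≤ c' := by
      have e : d (a ^ (i' + s * k)) (a ^ i') = d (g * a ^ (i + k)) (g * a ^ i) := by
        rw [hd.left, hd.dist_zpow, hd.dist_zpow]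
        rcases hs with rfl | rfl
        · congr 2; ring
        · rw [← hd.dist_one_zpow_neg]; congr 2; ring
      have t1 := hd.tri (g * a ^ (i + k)) (g * a ^ i) (a ^ i')
      have t2 := hd.tri (g * a ^ (i + k)) (a ^ i') (g * a ^ i)
      have s1 := hd.symm (a ^ i') (g * a ^ i)
      rw [e, abs_le]
      constructor <;> linarith
    linarith
  intro i j i' j' hi hj hCij
  rcases le_total i j with h | h
  · exact key i j i' j' h hi hj hCij
  · exact key j i j' i' h hj hi (by rwa [abs_sub_comm])

/-- Elementary elements stay uniformly close to the axis. -/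
theorem exists_near_of_mem (ha : QuasiAxis d a c) (hd : InvariantHyperbolic d δ) {x : G}
    (hx : x ∈ elementarySubgroup a) : ∃ t : ℤ, d x (a ^ t) ≤ 5 * c + 6 * δ := by
  have hδ := hd.one_le
  have hc := ha.one_le
  obtain ⟨m, s, hm, hs, hxm⟩ := hx
  obtain ⟨n, hn⟩ := ha.exists_far (d 1 x + c + 2 * δ)
  have hpow : ∀ k : ℤ, x * a ^ (m * k) = a ^ (s * m * k) * x := fun k => by
    rw [zpow_mul a (s * m), ← hxm, ← map_zpow, ← zpow_mul, MulAut.conj_apply]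
    group
  have hclose : ∀ k : ℤ, d (x * a ^ (m * k)) (a ^ (s * m * k)) ≤ d 1 x := fun k => by
    rw [hpow, hd.symm]
    simpa using (hd.left (a ^ (s * m * k)) 1 x).le
  have hfar : ∀ k : ℤ, (n : ℤ) ≤ |k| → d 1 x + c + 2 * δ < d (x * a ^ (m * k)) x := fun k hk => by
    have h := hd.left x 1 (a ^ (m * k))
    rw [mul_one, hd.symm] at h
    rw [h]
    refine hn _ ?_
    rw [abs_mul]
    have := Int.one_le_abs hm
    nlinarith [abs_nonneg k]
  have hb : ∀ k : ℤ, 0 ≤ m * k → (n : ℤ) ≤ |k| →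
      NearlyBtw d (c + 2 * δ) (a ^ (s * m * -k)) x (a ^ (s * m * k)) := fun k hk hk' => by
    refine hd.btw_of_far ?_ (hclose (-k)) (hclose k) (hfar _ (by rwa [abs_neg])) (hfar k hk')
    have := ha.btw (m * -k) 0 (m * k) (by linarith) hk
    unfold NearlyBtw at *
    rw [← hd.left x, ← hd.left x (a ^ (0 : ℤ)), ← hd.left x (a ^ (m * -k)) (a ^ (m * k))] at this
    simpa using this
  obtain ⟨k, hk, hk'⟩ : ∃ k : ℤ, 0 ≤ m * k ∧ (n : ℤ) ≤ |k| := by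
    rcases le_total 0 m with h | h
    · exact ⟨n, mul_nonneg h (by positivity), by simp⟩
    · exact ⟨-n, mul_nonneg_of_nonpos_of_nonpos h (by simp), by simp⟩
  have hb' := hb k hk hk'
  rcases le_total (s * m * -k) (s * m * k) with h | h
  · obtain ⟨t, -, -, ht⟩ := ha.exists_near hd h (by linarith) hb'
    exact ⟨t, by linarith⟩
  · obtain ⟨t, -, -, ht⟩ := ha.exists_near hd h (by linarith) (hd.btw_symm hb')
    exact ⟨t, by linarith⟩

/-- A quasi-axis element in the elementary subgroup of `a` is commensurable with `a`. -/
theorem exists_pow_eq_zpow (ha : QuasiAxis d a c) (hd : InvariantHyperbolic d δ)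
    (hac : FinsetAcylindrical d) {b : G} {cb : ℝ} (hb : QuasiAxis d b cb)
    (hmem : b ∈ elementarySubgroup a) : ∃ (p : ℕ) (q : ℤ), 0 < p ∧ q ≠ 0 ∧ b ^ p = a ^ q := by
  have hnear : ∀ k : ℕ, ∃ t : ℤ, d (b ^ (2 * k)) (a ^ t) ≤ 5 * c + 6 * δ := fun k =>
    ha.exists_near_of_mem hd (Subgroup.pow_mem _ hmem _)
  obtain ⟨m, s, hm, hs, hbm⟩ := hmem
  have hcomm : Commute (b ^ 2) (a ^ m) := by
    have h1 : MulAut.conj (b ^ 2) (a ^ m) = a ^ m := by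
      rw [pow_two, map_mul, MulAut.mul_apply, hbm, mul_comm s m, zpow_mul, map_zpow, hbm,
        ← zpow_mul]
      congr 1
      rcases hs with rfl | rfl <;> ring
    rw [MulAut.conj_apply, mul_inv_eq_iff_eq_mul] at h1
    exact h1
  choose t ht using hnear
  have hq : ∀ k, ∃ q : ℤ, d (a ^ (m * q)) (b ^ (2 * k)) ≤ 5 * c + 6 * δ + |(m : ℝ)| * c := fun k => by
    refine ⟨t k / m, ?_⟩
    have h1 := hd.dist_zpow_le a (m * (t k / m)) (t k)
    have h2 : |(t k : ℝ) - (m * (t k / m) : ℤ)| * d 1 a ≤ |(m : ℝ)| * c := by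
      refine mul_le_mul ?_ ha.step (hd.nonneg _ _) (abs_nonneg _)
      have e : (t k : ℤ) - m * (t k / m) = t k % m := by
        have := Int.mul_ediv_add_emod (t k) m; linarith
      rw [← Int.cast_sub, e]
      have h3 := Int.emod_nonneg (t k) hm
      have h4 := Int.emod_lt_abs (t k) hm
      rw [abs_of_nonneg (by exact_mod_cast h3)]
      exact_mod_cast h4.le
    have t1 := hd.tri (a ^ (m * (t k / m))) (a ^ t k) (b ^ (2 * k))
    have s1 := hd.symm (a ^ t k) (b ^ (2 * k))
    have := ht k
    linarith
  choose q hq using hq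
  set C := 5 * c + 6 * δ + |(m : ℝ)| * c with hC
  obtain ⟨R, N, hN⟩ := hac.exists_eq C
  obtain ⟨n, hn⟩ := ha.exists_far R
  have hmn : (n : ℤ) ≤ |m * n| := by
    rw [abs_mul, Nat.abs_cast]
    nlinarith [Int.one_le_abs hm, (Nat.cast_nonneg n : (0 : ℤ) ≤ n)]
  obtain ⟨k, l, hkl, -, huv⟩ := hN 1 (a ^ (m * n)) (hn _ hmn).le
    (fun k => (a ^ (m * q k))⁻¹ * b ^ (2 * k)) (fun k _ => by
      have h1 : d 1 ((a ^ (m * q k))⁻¹ * b ^ (2 * k)) ≤ C := by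
        rw [← hd.left (a ^ (m * q k)), mul_one, mul_inv_cancel_left]
        exact hq k
      refine ⟨by simpa using h1, ?_⟩
      have h2 : Commute ((a ^ (m * q k))⁻¹ * b ^ (2 * k)) (a ^ (m * n)) := by
        refine Commute.mul_left ?_ ?_
        · exact ((Commute.refl a).zpow_zpow _ _).inv_left
        · rw [pow_mul, zpow_mul]
          exact (hcomm.pow_left k).zpow_right n
      rw [h2.eq]
      have h3 := hd.left (a ^ (m * n)) 1 ((a ^ (m * q k))⁻¹ * b ^ (2 * k))
      rw [mul_one] at h3
      exact h3.trans_le h1)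
  have hpq : b ^ (2 * (l - k)) = a ^ (m * q l - m * q k) := by
    rw [inv_mul_eq_iff_eq_mul] at huv
    rw [zpow_sub, Nat.mul_sub, pow_sub _ (by omega), huv]
    group
  refine ⟨2 * (l - k), m * q l - m * q k, by omega, fun h0 => ?_, hpq⟩
  rw [h0, zpow_zero] at hpq
  obtain ⟨n, hn⟩ := hb.exists_far 0
  have := hn ((2 * (l - k) * n : ℕ) : ℤ) (by
    rw [Nat.abs_cast]
    exact_mod_cast Nat.le_mul_of_pos_left n (by omega))
  rw [zpow_natCast, pow_mul, hpq, one_pow, hd.self] at this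
  exact lt_irrefl _ this

end QuasiAxis

end Elementary

section Loxodromic

variable {G : Type*} [Group G] {d : G → G → ℝ} {δ : ℝ}

namespace InvariantHyperbolic

theorem exists_quasiAxis_of_loxodromic (hd : InvariantHyperbolic d δ) {g : G}
    (h : LoxodromicWith d leftTranslation g) : ∃ c, QuasiAxis d g c := by
  obtain ⟨x, A, B, hA, hB, H⟩ := h
  refine hd.exists_quasiAxis (A := A) (B := B + 2 * d 1 x) hA fun n => ?_
  have h1 := (H 0 n).1
  simp only [zdist, leftTranslation, zpow_zero, one_mul, Int.cast_zero, zero_sub, abs_neg] at h1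
  have t1 := hd.tri x 1 (g ^ n * x)
  have t2 := hd.tri 1 (g ^ n) (g ^ n * x)
  have h2 := hd.left (g ^ n) 1 x
  rw [mul_one] at h2
  have s1 := hd.symm x 1
  linarith

theorem loxodromic_of_le (hd : InvariantHyperbolic d δ) {g : G} {A B : ℝ} (hA : 1 ≤ A) (hB : 0 ≤ B)
    (h : ∀ n : ℤ, |(n : ℝ)| / A - B ≤ d 1 (g ^ n)) : LoxodromicWith d leftTranslation g := by
  refine ⟨1, max A (d 1 g), B, hA.trans (le_max_left _ _), hB, fun m n => ?_⟩
  simp only [zdist, leftTranslation, mul_one]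
  constructor
  · have h1 := h (n - m)
    rw [← hd.dist_zpow] at h1
    refine le_trans ?_ h1
    rw [abs_sub_comm]
    push_cast
    gcongr
    exact le_max_left _ _
  · have h1 := hd.dist_zpow_le g m n
    rw [abs_sub_comm, mul_comm] at h1
    have h2 := mul_le_mul_of_nonneg_right (le_max_right A (d 1 g)) (abs_nonneg ((m : ℝ) - n))
    linarith

/-- Commensurable elements are never independent. -/
theorem not_indepWith_of_pow_eq_zpow (hd : InvariantHyperbolic d δ) {a b : G} {p : ℕ} {q : ℤ}
    (hp : 0 < p) (hq : q ≠ 0) (h : b ^ p = a ^ q) (x : G) :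
    ¬ IndepWith d leftTranslation x a b := by
  intro hind
  have hsum : ∀ (u : ℕ → G) (n r : ℕ), r < n →
      d x (u r * x) ≤ ∑ i ∈ Finset.range n, d x (u i * x) := fun u n r hr =>
    Finset.single_le_sum (f := fun i => d x (u i * x)) (fun i _ => hd.nonneg _ _)
      (Finset.mem_range.mpr hr)
  obtain ⟨s, σ, hσ, hsσ⟩ : ∃ (s : Bool) (σ : ℤ), σ * |q| = q ∧
      ∀ n : ℕ, (if s then (n : ℤ) else -(n : ℤ)) = σ * n := by
    rcases le_total 0 q with h0 | h0
    · exact ⟨true, 1, by rw [abs_of_nonneg h0, one_mul], by simp⟩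
    · exact ⟨false, -1, by rw [abs_of_nonpos h0]; ring, by simp⟩
  have hpow : ∀ j : ℕ, b ^ (p * j) = a ^ (σ * (q.natAbs * j : ℕ)) := fun j => by
    rw [pow_mul, h, ← zpow_natCast, ← zpow_mul]
    congr 1
    push_cast
    rw [← mul_assoc, hσ]
  have hq' : 0 < q.natAbs := Int.natAbs_pos.mpr hq
  refine hind s true ⟨(∑ i ∈ Finset.range q.natAbs, d x (a ^ (σ * (i : ℤ)) * x)) +
    ∑ i ∈ Finset.range p, d x (b ^ i * x), ?_, ?_⟩
  · rintro _ ⟨n, rfl⟩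
    refine ⟨_, ⟨p * (n / q.natAbs), rfl⟩, ?_⟩
    have h1 := hsum (fun i => a ^ (σ * (i : ℤ))) _ _ (Nat.mod_lt n hq')
    have h2 : 0 ≤ ∑ i ∈ Finset.range p, d x (b ^ i * x) := Finset.sum_nonneg fun i _ => hd.nonneg _ _
    have e : a ^ (σ * (n : ℤ)) = a ^ (σ * (q.natAbs * (n / q.natAbs) : ℕ)) *
        a ^ (σ * ((n % q.natAbs : ℕ) : ℤ)) := by
      rw [← zpow_add, ← mul_add]
      congr 2
      exact_mod_cast (Nat.div_add_mod n q.natAbs).symm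
    simp only [leftTranslation, hsσ, if_true, zpow_natCast]
    rw [hpow, e, mul_assoc, hd.left, hd.symm]
    linarith
  · rintro _ ⟨n, rfl⟩
    refine ⟨_, ⟨q.natAbs * (n / p), rfl⟩, ?_⟩
    have h1 := hsum (fun i => b ^ i) _ _ (Nat.mod_lt n hp)
    have h2 : 0 ≤ ∑ i ∈ Finset.range q.natAbs, d x (a ^ (σ * (i : ℤ)) * x) :=
      Finset.sum_nonneg fun i _ => hd.nonneg _ _
    have e : b ^ n = b ^ (p * (n / p)) * b ^ (n % p) := by
      rw [← pow_add, Nat.div_add_mod]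
    simp only [leftTranslation, hsσ, if_true, zpow_natCast]
    rw [← hpow, e, mul_assoc, hd.left]
    linarith

end InvariantHyperbolic

end Loxodromic

/-- The sequence of partial products of `a ^ n 0 * h * a ^ n 1 * h * ⋯`. -/
def cornerSeq {G : Type*} [Group G] (a h : G) (n : ℕ → ℕ) : ℕ → G
  | 0 => 1
  | j + 1 => cornerSeq a h n j * a ^ n j * h

/-- The sequence `X` is a coarse geodesic, whose consecutive terms differ by a long power of `a`
followed by `h`. -/
structure PieceSeq {G : Type*} [Group G] (d : G → G → ℝ) (a h : G) (c lam : ℝ) (N : ℕ)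
    (X : ℕ → G) (n : ℕ → ℕ) : Prop where
  succ : ∀ j, X (j + 1) = X j * a ^ n j * h
  btw : ∀ i j k, i ≤ j → j ≤ k → NearlyBtw d c (X i) (X j) (X k)
  lower : ∀ i k : ℕ, i ≤ k → (k - i : ℝ) * lam ≤ d (X i) (X k)
  piece : ∀ j t, t ≤ n j → NearlyBtw d c (X j) (X j * a ^ t) (X (j + 1))
  le : ∀ j, N ≤ n j

section Pieces

variable {G : Type*} [Group G] {d : G → G → ℝ} {δ : ℝ} {a h : G} {c : ℝ}

theorem QuasiAxis.mono (ha : QuasiAxis d a c) {c' : ℝ} (hcc' : c ≤ c') (hd : InvariantHyperbolic d δ) :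
    QuasiAxis d a c' where
  one_le := ha.one_le.trans hcc'
  step := ha.step.trans hcc'
  btw i j k hij hjk := (ha.btw i j k hij hjk).trans (by linarith)
  lower n := by
    have h1 := ha.lower n
    have h2 := mul_le_mul_of_nonneg_right hcc' (hd.nonneg 1 (a ^ n))
    linarith

/-- Turning by `h ∉ elementarySubgroup a` between two pieces of axes produces a corner of bounded
defect. -/
theorem QuasiAxis.exists_corner_defect (ha : QuasiAxis d a c) (hd : InvariantHyperbolic d δ)
    (hac : FinsetAcylindrical d) (hh : h ∉ elementarySubgroup a) :
    ∃ K, 0 ≤ K ∧ ∀ n m : ℕ, NearlyBtw d K (h⁻¹ * (a ^ n)⁻¹) 1 (a ^ m * h) := by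
  have hδ := hd.one_le
  have hc := ha.one_le
  have hn := hd.nonneg 1 h
  obtain ⟨C, hC⟩ := ha.exists_mem_elementarySubgroup hd hac
    (c' := 3 * c + 2 * (c + δ + 2 * d 1 h) + 2 * δ) (by positivity)
  have hCc : 0 ≤ C * c := by positivity
  refine ⟨(2 * (C * c) + 2 * d 1 h + c + δ) + 2 * d 1 h, by positivity, fun n m => ?_⟩
  have small : ∀ k : ℕ, k ≤ C → d 1 (a ^ k) ≤ C * c := fun k hk =>
    (hd.dist_one_pow_le a k).trans (mul_le_mul (by exact_mod_cast hk) ha.step (hd.nonneg _ _)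
      (by positivity))
  have hend : d (a ^ m) (a ^ m * h) ≤ d 1 h := by
    have := hd.left (a ^ m) 1 h
    rw [mul_one] at this
    exact this.le
  suffices H : NearlyBtw d (2 * (C * c) + 2 * d 1 h + c + δ) (h⁻¹ * (a ^ n)⁻¹) 1 (a ^ m) by
    have := hd.btw_of_close H (le_of_eq (hd.self _)) hend
    unfold NearlyBtw at *
    linarith
  have hu : d 1 (h⁻¹ * (a ^ n)⁻¹) = d 1 (a ^ n * h) := by
    rw [← mul_inv_rev, hd.dist_one_inv]
  have hu' : d 1 (a ^ n * h) ≤ d 1 (a ^ n) + d 1 h := by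
    have := hd.left (a ^ n) 1 h
    rw [mul_one] at this
    have := hd.tri 1 (a ^ n) (a ^ n * h)
    linarith
  set u := h⁻¹ * (a ^ n)⁻¹ with hudef
  have su := hd.symm u 1
  by_cases hm : m ≤ C
  · have h1 := small m hm
    have t := hd.tri u (a ^ m) 1
    have s := hd.symm (a ^ m) 1
    unfold NearlyBtw
    linarith
  have h1 := small C le_rfl
  have hb : NearlyBtw d c 1 (a ^ C) (a ^ m) := by
    have := ha.btw 0 C m (by positivity) (by omega)
    simpa only [zpow_natCast, zpow_zero] using this
  rcases hd.btw_or_btw (z := u) hb with h2 | h2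
  · exfalso
    have h3 : NearlyBtw d (c + δ) h (h * a ^ C) (a ^ n)⁻¹ := by
      have e : (a ^ n)⁻¹ = h * u := by rw [hudef, mul_inv_cancel_left]
      have e1 := hd.left h 1 u
      have e2 := hd.left h 1 (a ^ C)
      have e3 := hd.left h (a ^ C) u
      unfold NearlyBtw at *
      rw [mul_one] at e1 e2
      rw [e]
      linarith
    have h4 := hd.btw_of_close h3 (hd.symm h 1).le (le_of_eq (hd.self _))
    obtain ⟨t, -, -, ht⟩ := ha.exists_near hd (c' := c + δ + 2 * d 1 h) (i := -n) (k := 0) (by simp)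
      (by positivity) (p := h * a ^ C) (by
        rw [zpow_zero, zpow_neg, zpow_natCast]
        refine hd.btw_symm (h4.trans ?_)
        linarith)
    refine hh (hC h 0 C 0 t ?_ ?_ (by simp))
    · rw [zpow_zero, mul_one, hd.symm]
      linarith
    · exact_mod_cast ht
  · have t1 := hd.tri u (a ^ C) 1
    have t2 := hd.tri 1 (a ^ C) (a ^ m)
    have s := hd.symm (a ^ C) 1
    unfold NearlyBtw at *
    linarith


/-- Sequences with long pieces are coarse geodesics, with constants that do not depend on the
lengths of the pieces. -/
theorem QuasiAxis.exists_pieceSeq (ha : QuasiAxis d a c) (hd : InvariantHyperbolic d δ)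
    (hac : FinsetAcylindrical d) (hh : h ∉ elementarySubgroup a) :
    ∃ c', QuasiAxis d a c' ∧ d 1 h ≤ c' ∧ ∀ (lam : ℝ) (N : ℕ), ∃ N₀ ≥ N, ∀ n : ℕ → ℕ,
      (∀ j, N₀ ≤ n j) → PieceSeq d a h c' lam N₀ (cornerSeq a h n) n := by
  have hδ := hd.one_le
  have hc := ha.one_le
  have hn := hd.nonneg 1 h
  obtain ⟨K, hK0, hK⟩ := ha.exists_corner_defect hd hac hh
  refine ⟨c + 2 * d 1 h + K + 2 * δ, ha.mono (by linarith) hd, by linarith, fun lam N => ?_⟩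
  obtain ⟨N₀, hN₀⟩ := ha.exists_far (max (K + 2 * δ + 1) (lam + K + δ) + d 1 h)
  refine ⟨max N N₀, le_max_left _ _, fun n hn => ?_⟩
  set X := cornerSeq a h n with hX
  have hsucc : ∀ j, X (j + 1) = X j * a ^ n j * h := fun j => rfl
  have hend : ∀ j, d (X j * a ^ n j) (X (j + 1)) = d 1 h := fun j => by
    have := hd.left (X j * a ^ n j) 1 h
    rwa [mul_one] at this
  have hstart : ∀ j t, d (X j) (X j * a ^ t) = d 1 (a ^ t) := fun j t => by
    have := hd.left (X j) 1 (a ^ t)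
    rwa [mul_one] at this
  have hcorner : ∀ i, NearlyBtw d K (X i) (X (i + 1)) (X (i + 2)) := fun i => by
    have h1 := hK (n i) (n (i + 1))
    unfold NearlyBtw at *
    rw [← hd.left (X (i + 1)), ← hd.left (X (i + 1)) 1,
      ← hd.left (X (i + 1)) (h⁻¹ * (a ^ n i)⁻¹) (a ^ n (i + 1) * h)] at h1
    have e1 : X (i + 1) * (h⁻¹ * (a ^ n i)⁻¹) = X i := by rw [hsucc]; group
    have e2 : X (i + 1) * (a ^ n (i + 1) * h) = X (i + 2) := by rw [hsucc (i + 1)]; group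
    rwa [e1, e2, mul_one] at h1
  have hstep : ∀ i, max (K + 2 * δ + 1) (lam + K + δ) < d (X i) (X (i + 1)) := fun i => by
    have h1 := hN₀ (n i) (by
      have := (le_max_right N N₀).trans (hn i)
      rw [Nat.abs_cast]; exact_mod_cast this)
    rw [zpow_natCast] at h1
    have h2 := hend i
    have h3 := hstart i (n i)
    have t := hd.tri (X i) (X (i + 1)) (X i * a ^ n i)
    have s := hd.symm (X (i + 1)) (X i * a ^ n i)
    linarith
  have hm1 := le_max_left (K + 2 * δ + 1) (lam + K + δ)
  have hm2 := le_max_right (K + 2 * δ + 1) (lam + K + δ)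
  refine ⟨hsucc, fun i j k hij hjk => ?_, fun i k hik => ?_, fun j t ht => ?_, hn⟩
  · have := hd.btw_of_broken (x := X) (K := k) (fun i _ => hcorner i) (fun i _ => (hstep i).le) hK0
      (by linarith) hij hjk le_rfl
    exact this.trans (by linarith)
  · have h1 := hd.mul_le_dist_of_broken (x := X) (K := k) (fun i _ => hcorner i)
      (fun i _ => (hstep i).le) hK0 (by linarith) hik le_rfl
    refine le_trans (mul_le_mul_of_nonneg_left (by linarith) ?_) h1
    have : (i : ℝ) ≤ k := by exact_mod_cast hik
    linarith
  · have h1 := ha.btw 0 t (n j) (by positivity) (by exact_mod_cast ht)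
    rw [zpow_zero, zpow_natCast, zpow_natCast] at h1
    have h2 : NearlyBtw d c (X j) (X j * a ^ t) (X j * a ^ n j) := by
      unfold NearlyBtw at *
      rw [hd.left, hstart, hstart]
      exact h1
    have h3 := hd.btw_of_close h2 (le_of_eq (hd.self _)) (hend j).le
    unfold NearlyBtw at *
    linarith

end Pieces

section Matching

variable {G : Type*} [Group G] {d : G → G → ℝ} {δ : ℝ} {a h : G} {c : ℝ}

theorem QuasiAxis.exists_near' (ha : QuasiAxis d a c) (hd : InvariantHyperbolic d δ) {c' : ℝ}
    {i k : ℤ} (hc' : 0 ≤ c') {p : G} (hp : NearlyBtw d c' (a ^ i) p (a ^ k)) :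
    ∃ t : ℤ, d p (a ^ t) ≤ 3 * c + 2 * c' + 2 * δ := by
  rcases le_total i k with h | h
  · obtain ⟨t, -, -, ht⟩ := ha.exists_near hd h hc' hp
    exact ⟨t, ht⟩
  · obtain ⟨t, -, -, ht⟩ := ha.exists_near hd h hc' (hd.btw_symm hp)
    exact ⟨t, ht⟩

namespace InvariantHyperbolic

theorem dist_self_mul (hd : InvariantHyperbolic d δ) (x g : G) : d x (x * g) = d 1 g := by
  have := hd.left x 1 g
  rwa [mul_one] at this

theorem dist_inv_mul (hd : InvariantHyperbolic d δ) (x y z : G) : d (x⁻¹ * y) z = d y (x * z) := by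
  rw [← hd.left x, mul_inv_cancel_left]

end InvariantHyperbolic

namespace PieceSeq

variable {lam : ℝ} {N : ℕ} {X X' : ℕ → G} {n n' : ℕ → ℕ}

theorem near (hX : PieceSeq d a h c lam N X n) (ha : QuasiAxis d a c) (hd : InvariantHyperbolic d δ)
    (hc : d 1 h ≤ c) {c' : ℝ} (hc' : 0 ≤ c') {p q : ℕ} (hpq : p ≤ q) {y : G}
    (hy : NearlyBtw d c' (X p) y (X q)) :
    ∃ j t : ℕ, p ≤ j ∧ j ≤ q ∧ t ≤ n j ∧ d y (X j * a ^ t) ≤ 11 * c + 4 * c' + 6 * δ := by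
  have hδ := hd.one_le
  have hc1 := ha.one_le
  rcases hpq.eq_or_lt with rfl | hlt
  · refine ⟨p, 0, le_rfl, le_rfl, Nat.zero_le _, ?_⟩
    unfold NearlyBtw at hy
    rw [hd.self, hd.symm (X p)] at hy
    rw [pow_zero, mul_one]
    linarith
  · obtain ⟨j, hpj, hjq, hb⟩ := hd.exists_btw_consecutive (c := c + c') hlt
      (fun j h1 h2 => (hX.btw p j q h1 h2).trans (by linarith)) (hy.trans (by linarith))
    have hend : d (X (j + 1)) (X j * a ^ n j) ≤ c := by
      rw [hX.succ, hd.symm, hd.dist_self_mul]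
      exact hc
    have hb' := hd.btw_of_close hb (le_of_eq (hd.self _)) hend
    rw [← mul_inv_cancel_left (X j) y] at hb'
    have hb'' : NearlyBtw d (2 * (c + c') + 2 * δ + 2 * c) (a ^ (0 : ℤ)) ((X j)⁻¹ * y)
        (a ^ (n j : ℤ)) := by
      unfold NearlyBtw at *
      rw [hd.dist_self_mul, hd.dist_self_mul, hd.left] at hb'
      rw [zpow_zero, zpow_natCast]
      linarith
    obtain ⟨t, ht0, htn, ht⟩ := ha.exists_near hd (by positivity) (by positivity) hb''
    obtain ⟨t, rfl⟩ := Int.eq_ofNat_of_zero_le ht0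
    rw [hd.dist_inv_mul, zpow_natCast] at ht
    exact ⟨j, t, hpj, hjq.le, by omega, by linarith⟩

theorem sep (hX : PieceSeq d a h c lam N X n) (hd : InvariantHyperbolic d δ) {j j₂ t t₂ : ℕ}
    (hj : j < j₂) (ht : t ≤ n j) (ht₂ : t₂ ≤ n j₂) :
    d (X j * a ^ t) (X (j + 1)) + d (X (j + 1)) (X j₂) + d (X j₂) (X j₂ * a ^ t₂) ≤
      d (X j * a ^ t) (X j₂ * a ^ t₂) + 4 * c := by
  have h1 := hX.btw j (j + 1) (j₂ + 1) (by omega) (by omega)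
  have h2 := hX.btw (j + 1) j₂ (j₂ + 1) (by omega) (by omega)
  have h3 := hX.piece j t ht
  have h4 := hX.piece j₂ t₂ ht₂
  have t1 := hd.tri (X j) (X j * a ^ t) (X (j₂ + 1))
  have t2 := hd.tri (X j * a ^ t) (X j₂ * a ^ t₂) (X (j₂ + 1))
  unfold NearlyBtw at *
  linarith

theorem inner (hX : PieceSeq d a h c lam N X n) (hd : InvariantHyperbolic d δ) {m j m' t : ℕ}
    (hm : m ≤ j) (hm' : j < m') (ht : t ≤ n j) :
    NearlyBtw d (3 * c) (X m) (X j * a ^ t) (X m') ∧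
      d (X m) (X j) ≤ d (X m) (X j * a ^ t) + 2 * c ∧
      d (X (j + 1)) (X m') ≤ d (X j * a ^ t) (X m') + 2 * c := by
  have h1 := hX.btw m j (j + 1) (by omega) (by omega)
  have h2 := hX.btw m (j + 1) m' (by omega) (by omega)
  have h3 := hX.btw j (j + 1) m' (by omega) (by omega)
  have h4 := hX.piece j t ht
  have t1 := hd.tri (X m) (X j) (X j * a ^ t)
  have t2 := hd.tri (X j * a ^ t) (X (j + 1)) (X m')
  have t3 := hd.tri (X m) (X j * a ^ t) (X (j + 1))
  have t4 := hd.tri (X j) (X j * a ^ t) (X m')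
  have n1 := hd.nonneg (X j) (X j * a ^ t)
  have n2 := hd.nonneg (X j * a ^ t) (X (j + 1))
  unfold NearlyBtw at *
  refine ⟨?_, ?_, ?_⟩ <;> linarith

theorem succ_notMem (hX : PieceSeq d a h c lam N X n) (hh : h ∉ elementarySubgroup a) (j : ℕ) :
    (X j)⁻¹ * X (j + 1) ∉ elementarySubgroup a := by
  rw [hX.succ, mul_assoc, inv_mul_cancel_left]
  intro hmem
  have := Subgroup.mul_mem _ (Subgroup.inv_mem _ (zpow_mem_elementarySubgroup a (n j))) hmem
  rw [zpow_natCast, inv_mul_cancel_left] at this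
  exact hh this

/-- Distinct terms lie in distinct cosets of the elementary subgroup. -/
theorem eq_of_mem (hX : PieceSeq d a h c lam N X n) (ha : QuasiAxis d a c)
    (hd : InvariantHyperbolic d δ) (hh : h ∉ elementarySubgroup a) {C : ℕ}
    (hC : ∀ (g : G) (i j i' j' : ℤ), d (g * a ^ i) (a ^ i') ≤ 29 * c + 26 * δ →
      d (g * a ^ j) (a ^ j') ≤ 29 * c + 26 * δ → (C : ℤ) ≤ |i - j| → g ∈ elementarySubgroup a)
    (hCN : C ≤ N) {j j' : ℕ} (hmem : (X j)⁻¹ * X j' ∈ elementarySubgroup a) : j = j' := by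
  have hδ := hd.one_le
  have hc1 := ha.one_le
  have key : ∀ j j', j < j' → (X j)⁻¹ * X j' ∉ elementarySubgroup a := by
    intro j j' hlt hmem
    rcases (Nat.succ_le_of_lt hlt).eq_or_lt with rfl | hlt'
    · exact hX.succ_notMem hh j hmem
    obtain ⟨r, hr⟩ := ha.exists_near_of_mem hd hmem
    rw [hd.dist_inv_mul] at hr
    have near : ∀ k ≤ n (j + 1), ∃ t : ℤ,
        d ((X j)⁻¹ * X (j + 1) * a ^ (k : ℤ)) (a ^ t) ≤ 29 * c + 26 * δ := by
      intro k hk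
      have h1 := (hX.inner hd (m := j) (j := j + 1) (m' := j') (by omega) (by omega) hk).1
      have h2 := hd.btw_of_close h1 (le_of_eq (hd.self _)) hr
      obtain ⟨t, ht⟩ := ha.exists_near' hd (c' := 13 * c + 12 * δ) (i := 0) (k := r)
        (p := (X j)⁻¹ * (X (j + 1) * a ^ k)) (by positivity) (by
          unfold NearlyBtw at *
          rw [hd.dist_inv_mul, hd.symm, hd.dist_inv_mul, zpow_zero, mul_one, ← hd.left (X j) 1,
            mul_one, hd.symm _ (X j)]
          linarith)
      refine ⟨t, ?_⟩
      rw [zpow_natCast, mul_assoc]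
      linarith
    obtain ⟨t, ht⟩ := near 0 (Nat.zero_le _)
    obtain ⟨t', ht'⟩ := near C (hCN.trans (hX.le _))
    exact hX.succ_notMem hh j (hC _ _ _ _ _ ht ht' (by simp))
  rcases lt_trichotomy j j' with hlt | heq | hlt
  · exact absurd hmem (key j j' hlt)
  · exact heq
  · refine absurd ?_ (key j' j hlt)
    have := Subgroup.inv_mem _ hmem
    rwa [mul_inv_rev, inv_inv] at this

/-- If a segment of a piece of `g • X` of length `2 * C` is tracked by `X'`, then some piece of
`X'` lies in the same coset of the elementary subgroup. -/
theorem exists_mem_of_track (hX' : PieceSeq d a h c lam N X' n') (ha : QuasiAxis d a c)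
    (hd : InvariantHyperbolic d δ) {C : ℕ} {c₀ : ℝ}
    (hC : ∀ (g : G) (i j i' j' : ℤ), d (g * a ^ i) (a ^ i') ≤ c₀ →
      d (g * a ^ j) (a ^ j') ≤ c₀ → (C : ℤ) ≤ |i - j| → g ∈ elementarySubgroup a)
    (hlam : 2 * C * c + 2 * c₀ + 4 * c < lam) {x : G} {τ T : ℕ} (hτ : τ + 2 * C ≤ T)
    (htrack : ∀ t ≤ T, ∃ j t', t' ≤ n' j ∧ d (x * a ^ t) (X' j * a ^ t') ≤ c₀) :
    ∃ j t t', τ ≤ t ∧ t ≤ τ + 2 * C ∧ t' ≤ n' j ∧ (X' j)⁻¹ * x ∈ elementarySubgroup a ∧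
      d (x * a ^ t) (X' j * a ^ t') ≤ c₀ := by
  have hc1 := ha.one_le
  have hd1 := ha.step
  have close : ∀ j j₂ t t' t₂ t₂' : ℕ, t' ≤ n' j → t₂' ≤ n' j₂ → τ ≤ t → t ≤ τ + 2 * C →
      τ ≤ t₂ → t₂ ≤ τ + 2 * C → d (x * a ^ t) (X' j * a ^ t') ≤ c₀ →
      d (x * a ^ t₂) (X' j₂ * a ^ t₂') ≤ c₀ → j₂ ≤ j + 1 := by
    intro j j₂ t t' t₂ t₂' ht' ht₂' h1 h2 h3 h4 h5 h6
    by_contra! hlt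
    have s1 := hX'.sep hd (by omega : j < j₂) ht' ht₂'
    have n1 := hd.nonneg (X' j * a ^ t') (X' (j + 1))
    have n2 := hd.nonneg (X' j₂) (X' j₂ * a ^ t₂')
    have l1 := hX'.lower (j + 1) j₂ hlt.le
    have hcc : 0 ≤ 2 * (C : ℝ) * c := by positivity
    have hc0 : 0 ≤ c₀ := (hd.nonneg _ _).trans h5
    have l2 : lam ≤ (j₂ - (j + 1 : ℕ) : ℝ) * lam := by
      refine le_mul_of_one_le_left (by linarith) ?_
      have : ((j + 1 : ℕ) : ℝ) + 1 ≤ j₂ := by exact_mod_cast hlt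
      linarith
    have e : d (x * a ^ t) (x * a ^ t₂) ≤ 2 * C * c := by
      rw [hd.left, ← zpow_natCast, ← zpow_natCast]
      refine (hd.dist_zpow_le a t t₂).trans (mul_le_mul ?_ hd1 (hd.nonneg _ _) (by positivity))
      have e1 : (τ : ℝ) ≤ t := by exact_mod_cast h1
      have e2 : (t : ℝ) ≤ τ + 2 * C := by exact_mod_cast h2
      have e3 : (τ : ℝ) ≤ t₂ := by exact_mod_cast h3
      have e4 : (t₂ : ℝ) ≤ τ + 2 * C := by exact_mod_cast h4
      rw [abs_le]
      push_cast
      constructor <;> linarith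
    have t1 := hd.tri (X' j * a ^ t') (x * a ^ t) (X' j₂ * a ^ t₂')
    have t2 := hd.tri (x * a ^ t) (x * a ^ t₂) (X' j₂ * a ^ t₂')
    have s2 := hd.symm (X' j * a ^ t') (x * a ^ t)
    linarith
  have same : ∀ j t t' t₂ t₂' : ℕ, (C : ℤ) ≤ |(t : ℤ) - t₂| → d (x * a ^ t) (X' j * a ^ t') ≤ c₀ →
      d (x * a ^ t₂) (X' j * a ^ t₂') ≤ c₀ → (X' j)⁻¹ * x ∈ elementarySubgroup a := by
    intro j t t' t₂ t₂' htt h1 h2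
    refine hC _ t t₂ t' t₂' ?_ ?_ htt
    · rwa [mul_assoc, hd.dist_inv_mul, zpow_natCast, zpow_natCast]
    · rwa [mul_assoc, hd.dist_inv_mul, zpow_natCast, zpow_natCast]
  obtain ⟨j₀, t₀, ht₀, h₀⟩ := htrack τ (by omega)
  obtain ⟨j₁, t₁, ht₁, h₁⟩ := htrack (τ + C) (by omega)
  obtain ⟨j₂, t₂, ht₂, h₂⟩ := htrack (τ + 2 * C) (by omega)
  have a01 := close _ _ _ _ _ _ ht₀ ht₁ (by omega) (by omega) (by omega) (by omega) h₀ h₁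
  have a10 := close _ _ _ _ _ _ ht₁ ht₀ (by omega) (by omega) (by omega) (by omega) h₁ h₀
  have a02 := close _ _ _ _ _ _ ht₀ ht₂ (by omega) (by omega) (by omega) (by omega) h₀ h₂
  have a20 := close _ _ _ _ _ _ ht₂ ht₀ (by omega) (by omega) (by omega) (by omega) h₂ h₀
  have a12 := close _ _ _ _ _ _ ht₁ ht₂ (by omega) (by omega) (by omega) (by omega) h₁ h₂
  have a21 := close _ _ _ _ _ _ ht₂ ht₁ (by omega) (by omega) (by omega) (by omega) h₂ h₁
  have : j₀ = j₁ ∨ j₀ = j₂ ∨ j₁ = j₂ := by omega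
  rcases this with rfl | rfl | rfl
  · exact ⟨j₀, _, _, by omega, by omega, ht₀, same _ _ _ _ _ (le_abs.mpr (Or.inr (by push_cast; omega))) h₀ h₁, h₀⟩
  · exact ⟨j₀, _, _, by omega, by omega, ht₀, same _ _ _ _ _ (le_abs.mpr (Or.inr (by push_cast; omega))) h₀ h₂, h₀⟩
  · exact ⟨j₁, _, _, by omega, by omega, ht₁, same _ _ _ _ _ (le_abs.mpr (Or.inr (by push_cast; omega))) h₁ h₂, h₁⟩

end PieceSeq

end Matching

section Matching

variable {G : Type*} [Group G] {d : G → G → ℝ} {δ : ℝ} {a h : G} {c : ℝ}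

namespace PieceSeq

variable {lam : ℝ} {N : ℕ} {X X' : ℕ → G} {n n' : ℕ → ℕ}

theorem track (hX : PieceSeq d a h c lam N X n) (hX' : PieceSeq d a h c lam N X' n')
    (ha : QuasiAxis d a c) (hd : InvariantHyperbolic d δ) (hc : d 1 h ≤ c) (hlam : 1 ≤ lam)
    {g : G} {s : ℝ} {m m' p q i : ℕ} (hm : d (g * X m) (X' p) ≤ s) (hm' : d (g * X m') (X' q) ≤ s)
    (hi : m + (s + 5 * c + 2 * δ) < i) (hi' : i + 1 + (s + 5 * c + 2 * δ) < m') :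
    ∀ t ≤ n i, ∃ j t', t' ≤ n' j ∧ d (g * X i * a ^ t) (X' j * a ^ t') ≤ 29 * c + 26 * δ := by
  have hδ := hd.one_le
  have hc1 := ha.one_le
  have hs : 0 ≤ s := (hd.nonneg _ _).trans hm
  intro t ht
  have hmi : m ≤ i := by
    have : (m : ℝ) ≤ i := by linarith
    exact_mod_cast this
  have him' : i + 1 ≤ m' := by
    have : (i : ℝ) + 1 ≤ m' := by linarith
    exact_mod_cast this
  obtain ⟨h1, h2, h3⟩ := hX.inner hd hmi him' ht
  have l1 := hX.lower m i hmi
  have l2 := hX.lower (i + 1) m' him'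
  push_cast at l2
  have l1' : (i - m : ℝ) ≤ (i - m) * lam := le_mul_of_one_le_right (by linarith) hlam
  have l2' : (m' - (i + 1) : ℝ) ≤ (m' - (i + 1)) * lam :=
    le_mul_of_one_le_right (by linarith) hlam
  have b : NearlyBtw d (3 * c + 2 * δ) (X' p) (g * X i * a ^ t) (X' q) := by
    have h1' : NearlyBtw d (3 * c) (g * X m) (g * X i * a ^ t) (g * X m') := by
      unfold NearlyBtw at *
      rw [mul_assoc, hd.left, hd.left, hd.left]
      exact h1
    refine hd.btw_of_far h1' hm hm' ?_ ?_
    · rw [mul_assoc, hd.left]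
      linarith
    · rw [mul_assoc, hd.left, hd.symm]
      linarith
  have fin : ∃ j t', t' ≤ n' j ∧ d (g * X i * a ^ t) (X' j * a ^ t') ≤
      11 * c + 4 * (3 * c + 2 * δ) + 6 * δ := by
    rcases le_total p q with hpq | hpq
    · obtain ⟨j, t', -, -, h4, h5⟩ := hX'.near ha hd hc (by positivity) hpq b
      exact ⟨j, t', h4, h5⟩
    · obtain ⟨j, t', -, -, h4, h5⟩ := hX'.near ha hd hc (by positivity) hpq (hd.btw_symm b)
      exact ⟨j, t', h4, h5⟩
  obtain ⟨j, t', h4, h5⟩ := fin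
  exact ⟨j, t', h4, by linarith⟩

/-- A tracked piece is close to a single piece of `X'`. -/
theorem exists_coset (hX' : PieceSeq d a h c lam N X' n') (ha : QuasiAxis d a c)
    (hd : InvariantHyperbolic d δ) (hh : h ∉ elementarySubgroup a) (hc : d 1 h ≤ c) {C : ℕ}
    (hC : ∀ (g : G) (i j i' j' : ℤ), d (g * a ^ i) (a ^ i') ≤ 29 * c + 26 * δ →
      d (g * a ^ j) (a ^ j') ≤ 29 * c + 26 * δ → (C : ℤ) ≤ |i - j| → g ∈ elementarySubgroup a)
    (hCN : C ≤ N) (hlam : 2 * C * c + 2 * (29 * c + 26 * δ) + 4 * c < lam) {x : G} {T : ℕ}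
    (hT : 2 * C ≤ T)
    (htrack : ∀ t ≤ T, ∃ j t', t' ≤ n' j ∧ d (x * a ^ t) (X' j * a ^ t') ≤ 29 * c + 26 * δ) :
    ∃ j s₁ s₂, s₁ ≤ n' j ∧ s₂ ≤ n' j ∧ (X' j)⁻¹ * x ∈ elementarySubgroup a ∧
      d x (X' j * a ^ s₁) ≤ 29 * c + 26 * δ + 2 * C * c + c ∧
      d (x * a ^ T * h) (X' j * a ^ s₂) ≤ 29 * c + 26 * δ + 2 * C * c + c := by
  have hc1 := ha.one_le
  have hstep : ∀ t t' : ℕ, t ≤ t' → t' ≤ t + 2 * C → d (x * a ^ t) (x * a ^ t') ≤ 2 * C * c := by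
    intro t t' h1 h2
    rw [hd.left, ← zpow_natCast, ← zpow_natCast]
    refine (hd.dist_zpow_le a t t').trans (mul_le_mul ?_ ha.step (hd.nonneg _ _) (by positivity))
    have e1 : (t : ℝ) ≤ t' := by exact_mod_cast h1
    have e2 : (t' : ℝ) ≤ t + 2 * C := by exact_mod_cast h2
    push_cast
    rw [abs_of_nonneg] <;> linarith
  obtain ⟨j, t, s₁, -, ht, hs₁, hmem, hds⟩ :=
    hX'.exists_mem_of_track ha hd hC hlam (τ := 0) (by omega) htrack
  obtain ⟨j', t₂, s₂, ht₂, ht₂', hs₂, hmem', hds₂⟩ :=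
    hX'.exists_mem_of_track ha hd hC hlam (τ := T - 2 * C) (by omega) htrack
  obtain rfl : j = j' := by
    refine hX'.eq_of_mem ha hd hh hC hCN ?_
    have := Subgroup.mul_mem _ hmem (Subgroup.inv_mem _ hmem')
    rwa [mul_inv_rev, inv_inv, mul_assoc, mul_inv_cancel_left] at this
  refine ⟨j, s₁, s₂, hs₁, hs₂, hmem, ?_, ?_⟩
  · have h1 := hstep 0 t (Nat.zero_le _) (by omega)
    rw [pow_zero, mul_one] at h1
    have h2 := hd.tri x (x * a ^ t) (X' j * a ^ s₁)
    linarith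
  · have h1 := hstep t₂ T (by omega) (by omega)
    have h2 := hd.dist_self_mul (x * a ^ T) h
    have h3 := hd.tri (x * a ^ T * h) (x * a ^ T) (X' j * a ^ s₂)
    have h4 := hd.tri (x * a ^ T) (x * a ^ t₂) (X' j * a ^ s₂)
    have h5 := hd.symm (x * a ^ T * h) (x * a ^ T)
    have h6 := hd.symm (x * a ^ T) (x * a ^ t₂)
    linarith

/-- If a point is close to two different pieces, these are consecutive and the point is close to
the corner between them. -/
theorem near_corner (hX' : PieceSeq d a h c lam N X' n') (hd : InvariantHyperbolic d δ) {c₃ : ℝ}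
    (hc : 0 ≤ c) (hlam : 2 * c₃ + 4 * c < lam) {x : G} {j j' s s' : ℕ} (hs : s ≤ n' j)
    (hs' : s' ≤ n' j') (h₁ : d x (X' j * a ^ s) ≤ c₃) (h₂ : d x (X' j' * a ^ s') ≤ c₃)
    (hjj : j ≠ j') :
    (j' = j + 1 ∨ j = j' + 1) ∧ d x (X' (max j j')) ≤ 3 * c₃ + 4 * c := by
  have hc₃ : 0 ≤ c₃ := (hd.nonneg _ _).trans h₁
  have key : ∀ j j' s s' : ℕ, s ≤ n' j → s' ≤ n' j' → d x (X' j * a ^ s) ≤ c₃ →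
      d x (X' j' * a ^ s') ≤ c₃ → j < j' → j' = j + 1 ∧ d x (X' j') ≤ 3 * c₃ + 4 * c := by
    intro j j' s s' hs hs' h₁ h₂ hlt
    have s1 := hX'.sep hd hlt hs hs'
    have t1 := hd.tri (X' j * a ^ s) x (X' j' * a ^ s')
    have s2 := hd.symm (X' j * a ^ s) x
    have s3 := hd.symm (X' j') (X' j' * a ^ s')
    have t2 := hd.tri x (X' j' * a ^ s') (X' j')
    have n1 := hd.nonneg (X' j * a ^ s) (X' (j + 1))
    have n2 := hd.nonneg (X' j') (X' j' * a ^ s')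
    have n3 := hd.nonneg (X' (j + 1)) (X' j')
    refine ⟨?_, by linarith⟩
    by_contra hne
    have l := hX'.lower (j + 1) j' (by omega)
    have l2 : lam ≤ (j' - (j + 1 : ℕ) : ℝ) * lam := by
      refine le_mul_of_one_le_left (by linarith) ?_
      have : ((j + 1 : ℕ) : ℝ) + 1 ≤ j' := by exact_mod_cast (by omega : j + 1 + 1 ≤ j')
      linarith
    linarith
  rcases hjj.lt_or_gt with hlt | hlt
  · obtain ⟨e, h3⟩ := key j j' s s' hs hs' h₁ h₂ hlt
    rw [max_eq_right hlt.le]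
    exact ⟨Or.inl e, h3⟩
  · obtain ⟨e, h3⟩ := key j' j s' s hs' hs h₂ h₁ hlt
    rw [max_eq_left hlt.le]
    exact ⟨Or.inr e, h3⟩

/-- Two sequences of long pieces which fellow travel have matching corners. -/
theorem exists_match (hX : PieceSeq d a h c lam N X n) (hX' : PieceSeq d a h c lam N X' n')
    (ha : QuasiAxis d a c) (hd : InvariantHyperbolic d δ) (hh : h ∉ elementarySubgroup a)
    (hc : d 1 h ≤ c) {C : ℕ}
    (hC : ∀ (g : G) (i j i' j' : ℤ), d (g * a ^ i) (a ^ i') ≤ 29 * c + 26 * δ →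
      d (g * a ^ j) (a ^ j') ≤ 29 * c + 26 * δ → (C : ℤ) ≤ |i - j| → g ∈ elementarySubgroup a)
    (hCN : 2 * C ≤ N) {C₂ : ℝ}
    (hC₂ : C₂ = 3 * (29 * c + 26 * δ + 2 * C * c + c) + 4 * c) (hlam : 2 * C₂ < lam)
    {g : G} {m₀ m₁ : ℕ}
    (htrack : ∀ i, m₀ ≤ i → i ≤ m₁ → ∀ t ≤ n i, ∃ j t', t' ≤ n' j ∧
      d (g * X i * a ^ t) (X' j * a ^ t') ≤ 29 * c + 26 * δ) :
    (∃ r : ℤ, ∀ i, m₀ < i → i ≤ m₁ → ∃ j : ℕ, (j : ℤ) = i + r ∧ d (g * X i) (X' j) ≤ C₂) ∨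
    (∃ r : ℤ, ∀ i, m₀ < i → i ≤ m₁ → ∃ j : ℕ, (j : ℤ) = r - i ∧ d (g * X i) (X' j) ≤ C₂) := by
  have hδ := hd.one_le
  have hc1 := ha.one_le
  have hCc : 0 ≤ (C : ℝ) * c := by positivity
  have hco : ∀ i, ∃ j s₁ s₂, m₀ ≤ i → i ≤ m₁ →
      s₁ ≤ n' j ∧ s₂ ≤ n' j ∧ (X' j)⁻¹ * (g * X i) ∈ elementarySubgroup a ∧
      d (g * X i) (X' j * a ^ s₁) ≤ 29 * c + 26 * δ + 2 * C * c + c ∧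
      d (g * X (i + 1)) (X' j * a ^ s₂) ≤ 29 * c + 26 * δ + 2 * C * c + c := by
    intro i
    by_cases hi : m₀ ≤ i ∧ i ≤ m₁
    · obtain ⟨j, s₁, s₂, h1⟩ := hX'.exists_coset ha hd hh hc hC (by omega) (by linarith)
        (hCN.trans (hX.le i)) (htrack i hi.1 hi.2)
      refine ⟨j, s₁, s₂, fun _ _ => ?_⟩
      have e : g * X i * a ^ n i * h = g * X (i + 1) := by simp only [hX.succ, mul_assoc]
      rwa [e] at h1
    · exact ⟨0, 0, 0, fun h1 h2 => absurd ⟨h1, h2⟩ hi⟩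
  choose J s₁ s₂ hJ using hco
  have hstep : ∀ i, m₀ ≤ i → i + 1 ≤ m₁ → (J (i + 1) = J i + 1 ∨ J i = J (i + 1) + 1) ∧
      d (g * X (i + 1)) (X' (max (J i) (J (i + 1)))) ≤ C₂ := by
    intro i h1 h2
    obtain ⟨-, a2, a3, -, a5⟩ := hJ i h1 (by omega)
    obtain ⟨b1, -, b3, b4, -⟩ := hJ (i + 1) (by omega) h2
    rw [hC₂]
    refine hX'.near_corner hd (by linarith) (by linarith) a2 b1 a5 b4 fun heq => ?_
    rw [← heq] at b3
    have := Subgroup.mul_mem _ (Subgroup.inv_mem _ a3) b3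
    refine hX.succ_notMem hh i ?_
    convert this using 1
    group
  have hne : ∀ i, m₀ ≤ i → i + 2 ≤ m₁ →
      max (J i) (J (i + 1)) ≠ max (J (i + 1)) (J (i + 2)) := by
    intro i h1 h2 heq
    have a1 := (hstep i h1 (by omega)).2
    have a2 := (hstep (i + 1) (by omega) h2).2
    rw [← heq] at a2
    have l := hX.lower (i + 1) (i + 2) (by omega)
    push_cast at l
    have t := hd.tri (g * X (i + 1)) (X' (max (J i) (J (i + 1)))) (g * X (i + 2))
    have s := hd.symm (X' (max (J i) (J (i + 1)))) (g * X (i + 2))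
    rw [hd.left] at t
    linarith
  rcases Nat.lt_or_ge m₀ m₁ with hlt | hge
  swap
  · exact Or.inl ⟨0, fun i h1 h2 => by omega⟩
  rcases (hstep m₀ le_rfl hlt).1 with h0 | h0
  · have hall : ∀ i, m₀ ≤ i → i + 1 ≤ m₁ → J (i + 1) = J i + 1 := by
      intro i hi
      induction i, hi using Nat.le_induction with
      | base => exact fun _ => h0
      | succ i hi ih =>
        intro h2
        have := ih (by omega)
        have h3 := (hstep (i + 1) (by omega) h2).1
        have h4 := hne i hi h2
        simp only [Nat.add_assoc, Nat.reduceAdd] at h3 ⊢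
        omega
    have hform : ∀ i, m₀ ≤ i → i ≤ m₁ → (J i : ℤ) = i + (J m₀ - m₀) := by
      intro i hi
      induction i, hi using Nat.le_induction with
      | base => intro _; ring
      | succ i hi ih =>
        intro h2
        have := ih (by omega)
        have := hall i hi h2
        push_cast
        omega
    refine Or.inl ⟨J m₀ - m₀, fun i h1 h2 => ⟨J i, hform i h1.le h2, ?_⟩⟩
    obtain ⟨i, rfl⟩ := Nat.exists_eq_succ_of_ne_zero (by omega : i ≠ 0)
    have h3 := (hstep i (by omega) h2).2
    have h4 := hall i (by omega) h2
    rwa [max_eq_right (by omega)] at h3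
  · have hall : ∀ i, m₀ ≤ i → i + 1 ≤ m₁ → J i = J (i + 1) + 1 := by
      intro i hi
      induction i, hi using Nat.le_induction with
      | base => exact fun _ => h0
      | succ i hi ih =>
        intro h2
        have := ih (by omega)
        have h3 := (hstep (i + 1) (by omega) h2).1
        have h4 := hne i hi h2
        simp only [Nat.add_assoc, Nat.reduceAdd] at h3 ⊢
        omega
    have hform : ∀ i, m₀ ≤ i → i ≤ m₁ → (J i : ℤ) = (J m₀ + m₀) - i := by
      intro i hi
      induction i, hi using Nat.le_induction with
      | base => intro _; ring
      | succ i hi ih =>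
        intro h2
        have := ih (by omega)
        have := hall i hi h2
        push_cast
        omega
    refine Or.inr ⟨J m₀ + m₀ + 1, fun i h1 h2 => ?_⟩
    obtain ⟨i, rfl⟩ := Nat.exists_eq_succ_of_ne_zero (by omega : i ≠ 0)
    have h3 := (hstep i (by omega) h2).2
    have h4 := hall i (by omega) h2
    rw [max_eq_left (by omega)] at h3
    refine ⟨J i, ?_, h3⟩
    have := hform i (by omega) (by omega)
    push_cast
    omega

end PieceSeq

/-- A family of coarse geodesics in which fellow travelling segments carry the same bits. -/
structure CodingFamily {G : Type*} [Group G] (d : G → G → ℝ) (c D K : ℝ)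
    (X : (ℕ → Bool) → ℕ → G) : Prop where
  btw : ∀ b i j k, i ≤ j → j ≤ k → NearlyBtw d c (X b i) (X b j) (X b k)
  lower : ∀ b (i k : ℕ), i ≤ k → (k - i : ℝ) ≤ d (X b i) (X b k)
  upper : ∀ b (i k : ℕ), i ≤ k → d (X b i) (X b k) ≤ (k - i : ℝ) * D
  exists_match : ∀ (b b' : ℕ → Bool) (g : G) (s : ℝ) (m m' p q : ℕ), d (g * X b m) (X b' p) ≤ s →
    d (g * X b m') (X b' q) ≤ s →
    (∃ r : ℤ, ∀ i : ℕ, m + (s + K) < i → i + (s + K) < m' →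
      ∃ j : ℕ, (j : ℤ) = i + r ∧ b i = b' j ∧ d (g * X b i) (X b' j) ≤ c) ∨
    (∃ r : ℤ, ∀ i : ℕ, m + (s + K) < i → i + (s + K) < m' →
      ∃ j : ℕ, (j : ℤ) = r - i ∧ b i = b' j ∧ d (g * X b i) (X b' (j + 1)) ≤ c)

theorem QuasiAxis.exists_codingFamily (ha : QuasiAxis d a c) (hd : InvariantHyperbolic d δ)
    (hac : FinsetAcylindrical d) (hh : h ∉ elementarySubgroup a) :
    ∃ c D K X, 0 ≤ c ∧ 1 ≤ D ∧ 0 ≤ K ∧ CodingFamily d c D K X := by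
  have hδ := hd.one_le
  obtain ⟨c, ha, hc, hex⟩ := ha.exists_pieceSeq hd hac hh
  have hc1 := ha.one_le
  obtain ⟨C, hC⟩ := ha.exists_mem_elementarySubgroup hd hac (c' := 29 * c + 26 * δ) (by positivity)
  set C₂ : ℝ := 3 * (29 * c + 26 * δ + 2 * C * c + c) + 4 * c with hC₂
  have hCc : 0 ≤ (C : ℝ) * c := by positivity
  obtain ⟨N₀, hN₀, hseq⟩ := hex (2 * C₂ + 1) (2 * C)
  obtain ⟨M, hM⟩ := ha.exists_far (d 1 (a ^ N₀) + 2 * c + 2 * C₂)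
  set e : Bool → ℕ := fun b => if b then max N₀ M else N₀ with he
  set X : (ℕ → Bool) → ℕ → G := fun b => cornerSeq a h fun i => e (b i) with hXdef
  have hX : ∀ b, PieceSeq d a h c (2 * C₂ + 1) N₀ (X b) fun i => e (b i) := fun b =>
    hseq _ fun j => by
      rcases b j <;> simp [he]
  have hlen : ∀ b i, d (X b i) (X b (i + 1)) = d 1 (a ^ e (b i) * h) := fun b i => by
    rw [(hX b).succ, mul_assoc, hd.dist_self_mul]
  have hbit : ∀ u v : Bool, |d 1 (a ^ e u * h) - d 1 (a ^ e v * h)| ≤ 2 * C₂ → u = v := by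
    have far := hM (max N₀ M : ℕ) (by rw [Nat.abs_cast]; exact_mod_cast le_max_right _ _)
    rw [zpow_natCast] at far
    have b1 := hd.tri 1 (a ^ N₀) (a ^ N₀ * h)
    have b2 := hd.tri 1 (a ^ max N₀ M * h) (a ^ max N₀ M)
    have b3 := hd.symm (a ^ max N₀ M * h) (a ^ max N₀ M)
    rw [hd.dist_self_mul] at b1
    rw [hd.dist_self_mul] at b3
    intro u v huv
    rw [abs_le] at huv
    rcases u <;> rcases v <;> simp only [he] at huv ⊢ <;> simp at huv ⊢ <;> linarith
  set D := max 1 (max (d 1 (a ^ e true * h)) (d 1 (a ^ e false * h))) with hD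
  refine ⟨C₂, D, 5 * c + 2 * δ + 2, X, by positivity, le_max_left _ _, by positivity, ?_, ?_, ?_, ?_⟩
  · intro b i j k h1 h2
    exact ((hX b).btw i j k h1 h2).trans (by linarith)
  · intro b i k hik
    refine le_trans (le_mul_of_one_le_right ?_ (by linarith)) ((hX b).lower i k hik)
    have : (i : ℝ) ≤ k := by exact_mod_cast hik
    linarith
  · intro b i k hik
    refine hd.dist_le_of_steps (f := X b) (D := D) hik fun j _ _ => ?_
    rw [hlen, hD]
    rcases b j <;> simp
  · intro b b' g s m m' p q hm hm'
    have hs : 0 ≤ s := (hd.nonneg _ _).trans hm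
    set m₀ := ⌊m + (s + 5 * c + 2 * δ)⌋₊ + 1 with hm₀
    have hm₀' : m + (s + 5 * c + 2 * δ) < m₀ := by
      rw [hm₀]; push_cast; exact Nat.lt_floor_add_one _
    have hm₀'' : (m₀ : ℝ) ≤ m + (s + 5 * c + 2 * δ) + 1 := by
      rw [hm₀]; push_cast
      have := Nat.floor_le (a := m + (s + 5 * c + 2 * δ)) (by positivity)
      linarith
    set m₁ := ⌈m' - (s + 5 * c + 2 * δ)⌉₊ - 2 with hm₁
    have hlow : ∀ i : ℕ, m + (s + (5 * c + 2 * δ + 2)) < i → m₀ < i := fun i hi => by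
      have : (m₀ : ℝ) < i := by linarith
      exact_mod_cast this
    have hupp : ∀ i : ℕ, i + (s + (5 * c + 2 * δ + 2)) < m' → i + 1 ≤ m₁ := fun i hi => by
      have h1 : ((i + 2 : ℕ) : ℝ) < m' - (s + 5 * c + 2 * δ) := by push_cast; linarith
      have := Nat.lt_ceil.mpr h1
      omega
    have key := (hX b).exists_match (hX b') ha hd hh hc hC hN₀ hC₂ (by linarith)
      (g := g) (m₀ := m₀) (m₁ := m₁) fun i h1 h2 => by
        rcases Nat.eq_zero_or_pos m₁ with h0 | hpos
        · have : 0 < m₀ := Nat.succ_pos _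
          omega
        refine (hX b).track (hX b') ha hd hc (by linarith) hm hm' ?_ ?_
        · have : (m₀ : ℝ) ≤ i := by exact_mod_cast h1
          linarith
        · have : i + 1 < ⌈m' - (s + 5 * c + 2 * δ)⌉₊ := by omega
          have := Nat.lt_ceil.mp this
          push_cast at this
          linarith
    have hcmp : ∀ {i j j' : ℕ} , d (g * X b i) (X b' j) ≤ C₂ →
        d (g * X b (i + 1)) (X b' j') ≤ C₂ →
        |d (X b i) (X b (i + 1)) - d (X b' j) (X b' j')| ≤ 2 * C₂ := by
      intro i j j' h1 h2
      rw [← hd.left g]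
      have t1 := hd.tri (g * X b i) (X b' j) (g * X b (i + 1))
      have t2 := hd.tri (X b' j) (X b' j') (g * X b (i + 1))
      have t3 := hd.tri (X b' j) (g * X b i) (X b' j')
      have t4 := hd.tri (g * X b i) (g * X b (i + 1)) (X b' j')
      have s1 := hd.symm (g * X b i) (X b' j)
      have s2 := hd.symm (g * X b (i + 1)) (X b' j')
      rw [abs_le]
      constructor <;> linarith
    rcases key with ⟨r, hr⟩ | ⟨r, hr⟩
    · refine Or.inl ⟨r, fun i h1 h2 => ?_⟩
      obtain ⟨j, hj, h3⟩ := hr i (hlow i h1) (by have := hupp i h2; omega)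
      obtain ⟨j', hj', h4⟩ := hr (i + 1) (by have := hlow i h1; omega) (hupp i h2)
      obtain rfl : j' = j + 1 := by push_cast at hj'; omega
      have := hcmp h3 h4
      rw [hlen, hlen] at this
      exact ⟨j, hj, hbit _ _ this, h3⟩
    · refine Or.inr ⟨r - 1, fun i h1 h2 => ?_⟩
      obtain ⟨j, hj, h3⟩ := hr i (hlow i h1) (by have := hupp i h2; omega)
      obtain ⟨j', hj', h4⟩ := hr (i + 1) (by have := hlow i h1; omega) (hupp i h2)
      obtain rfl : j = j' + 1 := by push_cast at hj'; omega
      have := hcmp h3 h4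
      rw [hd.symm (X b' (j' + 1)), hlen, hlen] at this
      exact ⟨j', by push_cast at hj'; omega, hbit _ _ this, h3⟩

end Matching

section Toeplitz

/-- Every third term is `false`, every third term is `true`, the other ones are given by `A`. -/
def interleave (A : ℕ → Bool) (k : ℕ) : Bool :=
  if k % 3 = 0 then false else if k % 3 = 1 then true else A (k / 3)

/-- The Toeplitz sequence whose term of index `i` depends on the `2`-adic valuation of `i + 1`. -/
def toeplitzBits (A : ℕ → Bool) (i : ℕ) : Bool :=
  interleave A (padicValInt 2 (i + 1))

theorem interleave_injective {A A' : ℕ → Bool} (h : ∀ k, interleave A k = interleave A' k) :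
    A = A' := by
  funext k
  have := h (3 * k + 2)
  have h1 : (3 * k + 2) % 3 = 2 := by omega
  have h2 : (3 * k + 2) / 3 = k := by omega
  simpa [interleave, h1, h2] using this

theorem not_interleave_const (A : ℕ → Bool) (k : ℕ) (u : Bool) (h₁ : interleave A (k + 1) = u)
    (h₂ : interleave A (k + 2) = u) (h₃ : interleave A (k + 3) = u) : False := by
  have e0 : ∀ m, m % 3 = 0 → interleave A m = false := fun m hm => by simp [interleave, hm]
  have e1 : ∀ m, m % 3 = 1 → interleave A m = true := fun m hm => by simp [interleave, hm]
  have : k % 3 = 0 ∨ k % 3 = 1 ∨ k % 3 = 2 := by omega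
  rcases this with h | h | h
  · rw [e1 (k + 1) (by omega)] at h₁
    rw [e0 (k + 3) (by omega)] at h₃
    exact absurd (h₁.trans h₃.symm) (by decide)
  · rw [e0 (k + 2) (by omega)] at h₂
    rw [e1 (k + 3) (by omega)] at h₃
    exact absurd (h₂.trans h₃.symm) (by decide)
  · rw [e0 (k + 1) (by omega)] at h₁
    rw [e1 (k + 2) (by omega)] at h₂
    exact absurd (h₁.trans h₂.symm) (by decide)

theorem padicValInt_two_eq {z w : ℤ} {k : ℕ} (h : z = 2 ^ k * (2 * w + 1)) :
    padicValInt 2 z = k := by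
  have h0 : (2 * w + 1 : ℤ) ≠ 0 := by omega
  have h1 : ¬ ((2 : ℕ) : ℤ) ∣ (2 * w + 1) := by omega
  have : Fact (Nat.Prime 2) := ⟨Nat.prime_two⟩
  rw [h, padicValInt.mul (by positivity) h0, padicValInt.eq_zero_of_not_dvd h1, add_zero,
    show ((2 : ℤ) ^ k) = ((2 ^ k : ℕ) : ℤ) by push_cast; rfl, padicValInt.of_nat,
    padicValNat.prime_pow]

theorem exists_eq_two_pow_mul {z : ℤ} (hz : z ≠ 0) : ∃ (k : ℕ) (w : ℤ), z = 2 ^ k * (2 * w + 1) := by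
  obtain ⟨n, hn, h⟩ := (Int.finiteMultiplicity_iff.mpr ⟨by norm_num, hz⟩ :
    FiniteMultiplicity (2 : ℤ) z).exists_eq_pow_mul_and_not_dvd
  exact ⟨_, n / 2, by rw [show 2 * (n / 2) + 1 = n by omega]; exact hn⟩

theorem exists_mem_window (lo k : ℕ) {L : ℕ} (hL : 2 ^ (k + 1) ≤ L) :
    ∃ (i : ℕ) (w : ℤ), lo ≤ i ∧ i < lo + L ∧ (i : ℤ) + 1 = 2 ^ k * (2 * w + 1) := by
  have hdiv := Nat.div_add_mod (lo + 2 ^ k) (2 ^ (k + 1))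
  have hmod := Nat.mod_lt (lo + 2 ^ k) (show 0 < 2 ^ (k + 1) by positivity)
  set q := (lo + 2 ^ k) / 2 ^ (k + 1) with hq
  have hpow : 2 ^ (k + 1) = 2 * 2 ^ k := by ring
  have hpos : 0 < 2 ^ k := by positivity
  refine ⟨2 ^ (k + 1) * q + 2 ^ k - 1, q, ?_, ?_, ?_⟩
  · omega
  · omega
  · rw [Nat.cast_sub (by omega)]
    push_cast
    ring

variable {A A' : ℕ → Bool} {σ r : ℤ} {lo L : ℕ}

theorem toeplitz_window_lt
    (h : ∀ i, lo ≤ i → i < lo + L → ∃ j : ℕ, (j : ℤ) + 1 = r + σ * (i + 1) ∧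
      toeplitzBits A i = toeplitzBits A' j) {v : ℕ} {w : ℤ} (hr : r = 2 ^ v * (2 * w + 1)) :
    L < 2 ^ (v + 4) := by
  by_contra! hL
  have key : ∀ u : ℕ, u < 3 → interleave A (v + (u + 1)) = interleave A' v := by
    intro u hu
    have hpow : 2 ^ (v + (u + 1) + 1) ≤ L :=
      (Nat.pow_le_pow_right (by norm_num) (by omega)).trans hL
    obtain ⟨i, w', h1, h2, h3⟩ := exists_mem_window lo (v + (u + 1)) hpow
    obtain ⟨j, hj, hb⟩ := h i h1 h2
    have e : (j : ℤ) + 1 = 2 ^ v * (2 * (w + σ * 2 ^ u * (2 * w' + 1)) + 1) := by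
      rw [hj, h3, hr]; ring
    unfold toeplitzBits at hb
    rwa [padicValInt_two_eq h3, padicValInt_two_eq e] at hb
  exact not_interleave_const A v _ (key 0 (by norm_num)) (key 1 (by norm_num)) (key 2 (by norm_num))

theorem interleave_eq_of_window (hσ : σ = 1 ∨ σ = -1)
    (h : ∀ i, lo ≤ i → i < lo + L → ∃ j : ℕ, (j : ℤ) + 1 = r + σ * (i + 1) ∧
      toeplitzBits A i = toeplitzBits A' j) {k : ℕ} (hL : 2 ^ (k + 4) ≤ L) :
    interleave A k = interleave A' k := by
  obtain ⟨z, hz⟩ : ∃ z, r = 2 ^ (k + 1) * z := by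
    by_cases hr0 : r = 0
    · exact ⟨0, by simp [hr0]⟩
    · obtain ⟨v, w, hr⟩ := exists_eq_two_pow_mul hr0
      have hlt := (toeplitz_window_lt h hr).trans_le' hL
      have hv := (Nat.pow_lt_pow_iff_right (by norm_num)).mp hlt
      obtain ⟨t, rfl⟩ := Nat.exists_eq_add_of_le (show k + 1 ≤ v by omega)
      exact ⟨2 ^ t * (2 * w + 1), by rw [hr]; ring⟩
  obtain ⟨i, w', h1, h2, h3⟩ := exists_mem_window lo k (L := L)
    ((Nat.pow_le_pow_right (by norm_num) (by omega)).trans hL)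
  obtain ⟨j, hj, hb⟩ := h i h1 h2
  have e : ∃ w'' : ℤ, (j : ℤ) + 1 = 2 ^ k * (2 * w'' + 1) := by
    rw [hj, h3, hz]
    rcases hσ with rfl | rfl
    · exact ⟨z + w', by ring⟩
    · exact ⟨z - w' - 1, by ring⟩
  obtain ⟨w'', e⟩ := e
  unfold toeplitzBits at hb
  rwa [padicValInt_two_eq h3, padicValInt_two_eq e] at hb

theorem toeplitz_window_lt_abs
    (h : ∀ i, lo ≤ i → i < lo + L → ∃ j : ℕ, (j : ℤ) + 1 = r + σ * (i + 1) ∧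
      toeplitzBits A i = toeplitzBits A' j) (hr : r ≠ 0) : (L : ℤ) < 16 * |r| := by
  obtain ⟨v, w, hvw⟩ := exists_eq_two_pow_mul hr
  have h1 := toeplitz_window_lt h hvw
  have h2 : (2 : ℤ) ^ v ≤ |r| := by
    rw [hvw, abs_mul, abs_of_pos (by positivity : (0 : ℤ) < 2 ^ v)]
    exact le_mul_of_one_le_right (by positivity) (Int.one_le_abs (by omega))
  have h3 : (L : ℤ) < 2 ^ (v + 4) := by exact_mod_cast h1
  rw [pow_add] at h3
  linarith

end Toeplitz

namespace CodingFamily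

variable {G : Type*} [Group G] {d : G → G → ℝ} {δ c D K : ℝ} {X : (ℕ → Bool) → ℕ → G}

theorem abs_sub_le (hX : CodingFamily d c D K X) (hd : InvariantHyperbolic d δ) (b : ℕ → Bool)
    (i j : ℕ) : |(i : ℝ) - j| ≤ d (X b i) (X b j) := by
  rcases le_total i j with h | h
  · rw [abs_sub_comm, abs_of_nonneg (by simpa using h)]
    exact hX.lower b i j h
  · rw [abs_of_nonneg (by simpa using h), hd.symm]
    exact hX.lower b j i h

/-- An element which moves two far apart terms of a Toeplitz geodesic by a small amount almost fixes
some term in between. -/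
theorem exists_near_fixed (hX : CodingFamily d c D K X) (hd : InvariantHyperbolic d δ) (hc : 0 ≤ c)
    (hD : 1 ≤ D) (hK : 0 ≤ K) :
    ∃ κ, 0 ≤ κ ∧ ∀ (A : ℕ → Bool) (g : G) (s : ℝ) (m m' : ℕ), (m : ℝ) + κ * (s + 1) ≤ m' →
      d (g * X (toeplitzBits A) m) (X (toeplitzBits A) m) ≤ s →
      d (g * X (toeplitzBits A) m') (X (toeplitzBits A) m') ≤ s →
      ∃ i, m ≤ i ∧ i ≤ m' ∧ d (g * X (toeplitzBits A) i) (X (toeplitzBits A) i) ≤ c := by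
  refine ⟨6 + 2 * K + 16 * (c + 1 + (K + 1) * (D + 1)), by positivity, ?_⟩
  intro A g s m m' hmm hm hm'
  have hs : 0 ≤ s := (hd.nonneg _ _).trans hm
  set b := toeplitzBits A with hb
  set W := c + s + (s + K + 1) * (D + 1) with hW
  have hlen : (m : ℝ) + (2 * (s + K) + 4 + 16 * W) ≤ m' := by
    refine le_trans ?_ hmm
    rw [hW]
    have h1 : 0 ≤ s * K := by positivity
    have h2 : 0 ≤ s * c := by positivity
    have h3 : 0 ≤ s * K * (D + 1) := by positivity
    nlinarith
  have hW0 : 0 ≤ W := by positivity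
  set lo := ⌊m + (s + K)⌋₊ + 1 with hlo
  have hlo1 : m + (s + K) < lo := by
    rw [hlo]; push_cast; exact Nat.lt_floor_add_one _
  have hlo2 : (lo : ℝ) ≤ m + (s + K) + 1 := by
    rw [hlo]; push_cast
    have := Nat.floor_le (a := m + (s + K)) (by positivity)
    linarith
  have hmlo : m ≤ lo := by
    have : (m : ℝ) ≤ lo := by linarith
    exact_mod_cast this
  set hi := ⌈m' - (s + K)⌉₊ with hhi
  have hhi1 : m' - (s + K) ≤ hi := Nat.le_ceil _
  have hhi2 : ∀ i : ℕ, i < hi → i + (s + K) < m' := fun i h => by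
    have := Nat.lt_ceil.mp h
    linarith
  have hlohi : lo < hi := by
    have : (lo : ℝ) < hi := by linarith
    exact_mod_cast this
  have start : ∀ i j : ℕ, i = lo → d (g * X b i) (X b j) ≤ c →
      |(j : ℝ) - m| ≤ c + s + (s + K + 1) * D := by
    rintro i j rfl h
    refine (hX.abs_sub_le hd b j m).trans ?_
    have h1 := hX.upper b m lo hmlo
    have h2 : ((lo : ℝ) - m) * D ≤ (s + K + 1) * D :=
      mul_le_mul_of_nonneg_right (by linarith) (by linarith)
    have t1 := hd.tri (X b j) (g * X b lo) (X b m)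
    have t2 := hd.tri (g * X b lo) (g * X b m) (X b m)
    have s1 := hd.symm (X b j) (g * X b lo)
    have s2 := hd.symm (X b m) (X b lo)
    rw [hd.left] at t2
    linarith
  rcases hX.exists_match b b g s m m' m m' hm hm' with ⟨r, hr⟩ | ⟨r, hr⟩
  · have h0 : r = 0 := by
      by_contra hr0
      have hlt := toeplitz_window_lt_abs (A := A) (A' := A) (σ := 1) (r := r) (lo := lo)
        (L := hi - lo) (fun i h1 h2 => by
          obtain ⟨j, hj, hbit, -⟩ := hr i
            (hlo1.trans_le (by exact_mod_cast h1)) (hhi2 i (by omega))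
          exact ⟨j, by linarith, hbit⟩) hr0
      obtain ⟨j, hj, -, h3⟩ := hr lo hlo1 (hhi2 lo hlohi)
      have h4 := start lo j rfl h3
      have h5 : (r : ℝ) = j - lo := by
        have : r = j - lo := by omega
        exact_mod_cast this
      have h6 : ((hi - lo : ℕ) : ℝ) < 16 * |(r : ℝ)| := by exact_mod_cast hlt
      rw [Nat.cast_sub hlohi.le] at h6
      have h7 : |(r : ℝ)| ≤ W := by
        rw [h5, abs_le]
        rw [abs_le] at h4
        constructor <;> linarith
      linarith
    obtain ⟨j, hj, -, h3⟩ := hr lo hlo1 (hhi2 lo hlohi)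
    obtain rfl : j = lo := by omega
    refine ⟨lo, hmlo, ?_, h3⟩
    have := hhi2 lo hlohi
    have : (lo : ℝ) ≤ m' := by linarith
    exact_mod_cast this
  · exfalso
    obtain ⟨j, hj, -, h3⟩ := hr lo hlo1 (hhi2 lo hlohi)
    have h4 := start lo _ rfl h3
    have hlast : m + (s + K) < (hi - 1 : ℕ) :=
      hlo1.trans_le (by exact_mod_cast (by omega : lo ≤ hi - 1))
    obtain ⟨j', hj', -, h3'⟩ := hr (hi - 1) hlast (hhi2 _ (by omega))
    have hhi3 := hhi2 (hi - 1) (by omega)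
    have hcast : ((hi - 1 : ℕ) : ℝ) = hi - 1 := by
      rw [Nat.cast_sub (by omega)]; simp
    have hle : hi - 1 ≤ m' := by
      have : ((hi - 1 : ℕ) : ℝ) ≤ m' := by linarith
      exact_mod_cast this
    have h5 : |((j' + 1 : ℕ) : ℝ) - m'| ≤ c + s + (s + K + 1) * D := by
      refine (hX.abs_sub_le hd b (j' + 1) m').trans ?_
      have h1 := hX.upper b (hi - 1) m' hle
      have h2 : ((m' : ℝ) - (hi - 1 : ℕ)) * D ≤ (s + K + 1) * D :=
        mul_le_mul_of_nonneg_right (by rw [hcast]; linarith) (by linarith)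
      have t1 := hd.tri (X b (j' + 1)) (g * X b (hi - 1)) (X b m')
      have t2 := hd.tri (g * X b (hi - 1)) (g * X b m') (X b m')
      have s1 := hd.symm (X b (j' + 1)) (g * X b (hi - 1))
      rw [hd.left] at t2
      linarith
    have h6 : j' ≤ j := by omega
    have h6' : (j' : ℝ) ≤ j := by exact_mod_cast h6
    rw [abs_le] at h4 h5
    push_cast at h4 h5
    linarith

end CodingFamily

/-- Geodesics of `d` between points at `e`-distance at most one stay close to a translate of `X`. -/
def ShadowedEdges {G : Type*} [Group G] (d e : G → G → ℝ) (C : ℝ) (X : ℕ → G) : Prop :=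
  ∀ x y, e x y ≤ 1 → ∃ k, ∀ p, d x p + d p y = d x y → ∃ n, d p (k * X n) ≤ C

section Shadow

variable {G : Type*} [Group G] {d e : G → G → ℝ} {δ c D K C : ℝ}

/-- A point close to a geodesic is close to a geodesic with the same endpoints as some step of a given
path. -/
theorem DiscreteHyperbolic.exists_btw_succ_of_path {α : Type*} {d : α → α → ℝ}
    (hd : DiscreteHyperbolic d δ) {f : ℕ → α} {M k : ℕ} (hk : M ≤ 2 ^ k) {w : α} (h : NearlyBtw d c (f 0) w (f M)) :
    ∃ t ≤ M, NearlyBtw d (c + k * δ) (f t) w (f (t + 1)) := by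
  classical
  set e : α → α → ℝ := fun x y =>
    if x = y ∨ ∃ t ≤ M, x = f t ∧ y = f (t + 1) then 0 else 2 with he
  have hstep : ∀ i, 0 ≤ i → i < M → e (f i) (f (i + 1)) ≤ 1 := fun i _ hi => by
    rw [he]
    simp only
    rw [if_pos (Or.inr ⟨i, hi.le, rfl, rfl⟩)]
    norm_num
  obtain ⟨i, v, -, hi, hv, hb⟩ := hd.exists_btw_of_path (e := e) (fun x => by simp [he]) w k
    (Nat.zero_le M) (by simpa using hk) hstep h
  by_cases hcase : f i = v ∨ ∃ t ≤ M, f i = f t ∧ v = f (t + 1)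
  · rcases hcase with rfl | ⟨t, ht, h1, h2⟩
    · refine ⟨i, hi, ?_⟩
      have s := hd.symm w (f i)
      have t := hd.tri w (f i) (f (i + 1))
      unfold NearlyBtw at *
      rw [hd.self] at hb
      linarith
    · refine ⟨t, ht, ?_⟩
      rwa [← h1, ← h2]
  · rw [he] at hv
    simp only [if_neg hcase] at hv
    norm_num at hv

theorem ShadowedEdges.exists_cover {X : ℕ → G} (hX : ShadowedEdges d e C X)
    (hd : InvariantHyperbolic d δ) (he : DiscreteGeodesic e) {M k : ℕ} (hk : M ≤ 2 ^ k) {x y : G}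
    (hxy : e x y ≤ M) :
    ∃ κ : ℕ → G, ∀ w c, NearlyBtw d c x w y →
      ∃ t ≤ M, ∃ n, d w (κ t * X n) ≤ c + k * δ + δ + C := by
  obtain ⟨L, hL⟩ := he.nat x y
  have hLM : L ≤ M := by rw [hL] at hxy; exact_mod_cast hxy
  obtain ⟨f, hf0, hfL, hf⟩ := he.exists_path L hL
  set f' : ℕ → G := fun t => f (min t L) with hf'
  have hedge : ∀ t, e (f' t) (f' (t + 1)) ≤ 1 := fun t => by
    rcases lt_or_ge t L with h | h
    · simp only [hf', min_eq_left h.le, min_eq_left (Nat.succ_le_of_lt h)]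
      exact (hf t h).le
    · simp only [hf', min_eq_right h, min_eq_right (h.trans (Nat.le_succ t)), he.self]
      norm_num
  choose κ hκ using fun t => hX _ _ (hedge t)
  refine ⟨κ, fun w c hw => ?_⟩
  obtain ⟨t, ht, hb⟩ := hd.exists_btw_succ_of_path (f := f') (w := w) (c := c) hk
    (by simpa only [hf', min_eq_right hLM, Nat.zero_min, hf0, hfL] using hw)
  obtain ⟨p, hp1, hp2⟩ := hd.exists_near_geodesic hb
  obtain ⟨n, hn⟩ := hκ t p hp1
  refine ⟨t, ht, n, ?_⟩
  have := hd.tri w p (κ t * X n)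
  linarith

/-- Different Toeplitz sequences give different coned-off metrics. -/
theorem CodingFamily.eq_of_bounded {X : (ℕ → Bool) → ℕ → G} (hX : CodingFamily d c D K X)
    (hd : InvariantHyperbolic d δ) (hK : 0 ≤ K) (he : DiscreteGeodesic e) {A A' : ℕ → Bool}
    (hedge : ShadowedEdges d e C (X (toeplitzBits A'))) {M : ℕ}
    (hM : ∀ q, e (X (toeplitzBits A) 0) (X (toeplitzBits A) q) ≤ M) : A = A' := by
  obtain ⟨k, hk⟩ : ∃ k, M ≤ 2 ^ k := ⟨M, Nat.lt_two_pow_self.le⟩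
  refine interleave_injective fun v => ?_
  set C' := c + k * δ + δ + C with hC'
  set H := ⌈2 * (C' + K) + 2 ^ (v + 4) + 3⌉₊ with hH
  obtain ⟨κ, hκ⟩ := hedge.exists_cover hd he hk (hM ((M + 1) * H))
  have hpt : ∀ i : ℕ, ∃ t n, i ≤ M + 1 → t ≤ M ∧
      d (X (toeplitzBits A) (i * H)) (κ t * X (toeplitzBits A') n) ≤ C' := by
    intro i
    by_cases hi : i ≤ M + 1
    · obtain ⟨t, ht, n, hn⟩ := hκ _ c (hX.btw (toeplitzBits A) 0 (i * H) ((M + 1) * H)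
        (Nat.zero_le _) (Nat.mul_le_mul_right _ hi))
      exact ⟨t, n, fun _ => ⟨ht, hn⟩⟩
    · exact ⟨0, 0, fun h => absurd h hi⟩
  choose t n htn using hpt
  obtain ⟨i₁, hi₁, i₂, hi₂, hne, ht⟩ := Finset.exists_ne_map_eq_of_card_lt_of_maps_to
    (s := Finset.range (M + 2)) (t := Finset.range (M + 1)) (f := t) (by simp) (fun i hi => by
      have := (htn i (by simpa [Nat.lt_succ_iff] using hi)).1
      simpa [Nat.lt_succ_iff] using this)
  have hgood : ∀ i ∈ Finset.range (M + 2), i ≤ M + 1 := fun i hi => by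
    simpa [Nat.lt_succ_iff] using hi
  wlog hlt : i₁ < i₂ generalizing i₁ i₂
  · exact this i₂ hi₂ i₁ hi₁ hne.symm ht.symm (by omega)
  have h1 := (htn i₁ (hgood i₁ hi₁)).2
  have h2 := (htn i₂ (hgood i₂ hi₂)).2
  rw [← ht] at h2
  rw [← hd.left (κ (t i₁))⁻¹, inv_mul_cancel_left] at h1 h2
  have hC0 : 0 ≤ C' := (hd.nonneg _ _).trans h1
  have hlen : (i₁ * H : ℕ) + (2 * (C' + K) + 2 ^ (v + 4) + 3) ≤ (i₂ * H : ℕ) := by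
    have h3 : ((i₁ * H : ℕ) : ℝ) + H ≤ (i₂ * H : ℕ) := by
      have : i₁ * H + H ≤ i₂ * H := by
        rw [← Nat.succ_mul]; exact Nat.mul_le_mul_right _ hlt
      exact_mod_cast this
    have h4 : 2 * (C' + K) + 2 ^ (v + 4) + 3 ≤ H := Nat.le_ceil _
    linarith
  obtain ⟨lo, hlo1, hlo2⟩ : ∃ lo : ℕ, (i₁ * H : ℕ) + (C' + K) < lo ∧
      (lo : ℝ) + 2 ^ (v + 4) + (C' + K) < (i₂ * H : ℕ) := by
    have h5 : 0 ≤ ((i₁ * H : ℕ) : ℝ) + (C' + K) := by positivity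
    refine ⟨⌊(i₁ * H : ℕ) + (C' + K)⌋₊ + 1, ?_, ?_⟩
    · rw [Nat.cast_succ]
      exact Nat.lt_floor_add_one _
    · have := Nat.floor_le h5
      rw [Nat.cast_succ]
      linarith
  have hrange : ∀ i, lo ≤ i → i < lo + 2 ^ (v + 4) →
      (i₁ * H : ℕ) + (C' + K) < (i : ℝ) ∧ (i : ℝ) + (C' + K) < (i₂ * H : ℕ) := fun i h3 h4 => by
    have h5 : (lo : ℝ) ≤ i := by exact_mod_cast h3
    have h6 : (i : ℝ) < lo + 2 ^ (v + 4) := by exact_mod_cast h4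
    constructor <;> linarith
  rcases hX.exists_match _ _ _ _ _ _ _ _ h1 h2 with ⟨r, hr⟩ | ⟨r, hr⟩
  · refine interleave_eq_of_window (σ := 1) (r := r) (lo := lo) (Or.inl rfl) (fun i h3 h4 => ?_)
      le_rfl
    obtain ⟨j, hj, hb, -⟩ := hr i (hrange i h3 h4).1 (hrange i h3 h4).2
    exact ⟨j, by linarith, hb⟩
  · refine interleave_eq_of_window (σ := -1) (r := r + 2) (lo := lo) (Or.inr rfl)
      (fun i h3 h4 => ?_) le_rfl
    obtain ⟨j, hj, hb, -⟩ := hr i (hrange i h3 h4).1 (hrange i h3 h4).2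
    exact ⟨j, by linarith, hb⟩

end Shadow

/-- A large finite set of naturals has two elements which are far apart, but close compared with its
diameter. -/
theorem Finset.exists_gap_of_card_lt {I : Finset ℕ} {lo hi m g : ℕ}
    (hI : ∀ v ∈ I, lo ≤ v ∧ v ≤ hi) (hm : 0 < m) (hcard : m * g < I.card) :
    ∃ i ∈ I, ∃ j ∈ I, i + g ≤ j ∧ j ≤ i + ((hi - lo) / m + 1) := by
  set W := (hi - lo) / m + 1 with hW
  have hW0 : 0 < W := Nat.succ_pos _
  obtain ⟨q, -, hq⟩ := Finset.exists_lt_card_fiber_of_mul_lt_card_of_maps_to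
    (s := I) (t := Finset.range m) (f := fun v => (v - lo) / W) (n := g) (fun v hv => by
      have := hI v hv
      rw [Finset.mem_range, Nat.div_lt_iff_lt_mul hW0]
      have h1 := Nat.lt_mul_div_succ (hi - lo) hm
      rw [hW]
      omega) (by simpa using hcard)
  set F := I.filter fun v => (v - lo) / W = q with hF
  have hne : F.Nonempty := Finset.card_pos.mp (by omega)
  have hmin := F.min'_mem hne
  have hmax := F.max'_mem hne
  refine ⟨F.min' hne, (Finset.mem_filter.mp hmin).1, F.max' hne, (Finset.mem_filter.mp hmax).1,
    ?_, ?_⟩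
  · have hsub : F ⊆ Finset.Icc (F.min' hne) (F.max' hne) := fun v hv =>
      Finset.mem_Icc.mpr ⟨F.min'_le v hv, F.le_max' v hv⟩
    have := Finset.card_le_card hsub
    rw [Nat.card_Icc] at this
    omega
  · have h1 := (Finset.mem_filter.mp hmin).2
    have h2 := (Finset.mem_filter.mp hmax).2
    have h3 := hI _ (Finset.mem_filter.mp hmin).1
    have h4 := hI _ (Finset.mem_filter.mp hmax).1
    have h5 := Nat.div_add_mod (F.min' hne - lo) W
    have h6 := Nat.div_add_mod (F.max' hne - lo) W
    have h7 := Nat.mod_lt (F.max' hne - lo) hW0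
    rw [h1] at h5
    rw [h2] at h6
    omega

namespace CodingFamily

variable {G : Type*} [Group G] {d e : G → G → ℝ} {δ c D K : ℝ} {X : (ℕ → Bool) → ℕ → G}

/-- Along a translate of a Toeplitz geodesic, a set of points `g * u` on which the elements `g' * g⁻¹`
act almost like translations has bounded cardinality. -/
theorem exists_card_le (hX : CodingFamily d c D K X) (hd : InvariantHyperbolic d δ) (hc : 0 ≤ c)
    (hD : 1 ≤ D) (hK : 0 ≤ K) (c' C : ℝ) (N : ℕ) :
    ∃ B : ℕ, ∀ (A : ℕ → Bool) (Z : Finset G) (u k : G) (n : G → ℕ),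
      (∀ g ∈ Z, d (g * u) (k * X (toeplitzBits A) (n g)) ≤ c') →
      (∀ v, (Z.filter fun g => n g = v).card ≤ N) →
      (∀ g ∈ Z, ∀ g' ∈ Z, ∀ g₁ ∈ Z, ∀ g₂ ∈ Z, ∀ v v' : ℕ, n g₁ ≤ v → v ≤ n g₂ → n g₁ ≤ v' →
        v' ≤ n g₂ → d (g' * g⁻¹ * (k * X (toeplitzBits A) v)) (k * X (toeplitzBits A) v) ≤
          d (g' * g⁻¹ * (k * X (toeplitzBits A) v')) (k * X (toeplitzBits A) v') + C) →
      Z.card ≤ B := by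
  obtain ⟨κ, hκ0, hκ⟩ := hX.exists_near_fixed hd hc hD hK
  obtain ⟨gap, hgap⟩ := exists_nat_gt (c + C + 4 * c')
  obtain ⟨m, hm⟩ := exists_nat_gt (2 * κ * D)
  obtain ⟨ℓ₀, hℓ₀⟩ := exists_nat_gt (2 * κ * (D + 4 * c' + C + 1))
  refine ⟨N * (m * gap + ℓ₀ + 1), fun A Z u k n hn hfib hdisp => ?_⟩
  by_contra! hlt
  set b := toeplitzBits A with hb
  set I := Z.image n with hI
  have hcardI : m * gap + ℓ₀ + 1 < I.card := by
    have h1 := Finset.card_le_mul_card_image (f := n) Z N fun v _ => hfib v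
    exact Nat.lt_of_mul_lt_mul_left (hlt.trans_le h1)
  have hne : I.Nonempty := Finset.card_pos.mp (by omega)
  have hIcc : ∀ v ∈ I, I.min' hne ≤ v ∧ v ≤ I.max' hne := fun v hv =>
    ⟨I.min'_le v hv, I.le_max' v hv⟩
  have hm0 : 0 < m := by
    have : (0 : ℝ) < m := lt_of_le_of_lt (by positivity) hm
    exact_mod_cast this
  obtain ⟨i, hi, j, hj, hij, hji⟩ := Finset.exists_gap_of_card_lt hIcc hm0
    (by omega : m * gap < I.card)
  obtain ⟨g₁, hg₁, hn₁⟩ := Finset.mem_image.mp (I.min'_mem hne)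
  obtain ⟨g₂, hg₂, hn₂⟩ := Finset.mem_image.mp (I.max'_mem hne)
  have hℓ : ℓ₀ ≤ I.max' hne - I.min' hne := by
    have hsub : I ⊆ Finset.Icc (I.min' hne) (I.max' hne) := fun v hv =>
      Finset.mem_Icc.mpr (hIcc v hv)
    have := Finset.card_le_card hsub
    rw [Nat.card_Icc] at this
    omega
  have hlohi : I.min' hne ≤ I.max' hne := I.min'_le _ (I.max'_mem hne)
  have hiI := hIcc i hi
  have hjI := hIcc j hj
  set lo := I.min' hne with hlo
  set hi' := I.max' hne with hhi
  obtain ⟨g, hg, rfl⟩ := Finset.mem_image.mp hi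
  obtain ⟨g', hg', rfl⟩ := Finset.mem_image.mp hj
  have hd₁ := hn g hg
  have hd₂ := hn g' hg'
  set f := g' * g⁻¹ with hf
  have hfg : f * (g * u) = g' * u := by rw [hf]; group
  have hdisp' : ∀ v v' : ℕ, lo ≤ v → v ≤ hi' → lo ≤ v' → v' ≤ hi' →
      d (f * (k * X b v)) (k * X b v) ≤ d (f * (k * X b v')) (k * X b v') + C :=
    fun v v' h1 h2 h3 h4 => hdisp g hg g' hg' g₁ hg₁ g₂ hg₂ v v' (hn₁.trans_le h1)
      (h2.trans hn₂.ge) (hn₁.trans_le h3) (h4.trans hn₂.ge)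
  have hnear : d (f * (k * X b (n g))) (k * X b (n g)) ≤ d (g' * u) (g * u) + 2 * c' := by
    have t1 := hd.tri (f * (k * X b (n g))) (f * (g * u)) (k * X b (n g))
    have t2 := hd.tri (f * (g * u)) (g * u) (k * X b (n g))
    rw [hd.left, hd.symm _ (g * u)] at t1
    rw [hfg] at t1 t2
    linarith
  have hnear' : d (g' * u) (g * u) ≤ d (f * (k * X b (n g))) (k * X b (n g)) + 2 * c' := by
    have t1 := hd.tri (f * (g * u)) (f * (k * X b (n g))) (g * u)
    have t2 := hd.tri (f * (k * X b (n g))) (k * X b (n g)) (g * u)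
    have t3 := hd.symm (k * X b (n g)) (g * u)
    rw [hd.left] at t1
    rw [hfg] at t1
    linarith
  have hijr : (n g : ℝ) + gap ≤ n g' := by exact_mod_cast hij
  have hdiv : (((hi' - lo) / m : ℕ) : ℝ) ≤ (hi' - lo : ℝ) / m := by
    rw [← Nat.cast_sub hlohi]
    exact Nat.cast_div_le
  have hjir : (n g' : ℝ) ≤ n g + ((hi' - lo : ℝ) / m + 1) := by
    have : (n g' : ℝ) ≤ n g + (((hi' - lo) / m : ℕ) + 1) := by exact_mod_cast hji
    linarith
  have hupper : d (g' * u) (g * u) ≤ D * ((hi' - lo : ℝ) / m + 1) + 2 * c' := by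
    have h1 := hX.upper b (n g) (n g') (by omega)
    rw [← hd.left k, hd.symm] at h1
    have h2 : ((n g' : ℝ) - n g) * D ≤ ((hi' - lo : ℝ) / m + 1) * D :=
      mul_le_mul_of_nonneg_right (by linarith) (by linarith)
    have t1 := hd.tri (g' * u) (k * X b (n g')) (g * u)
    have t2 := hd.tri (k * X b (n g')) (k * X b (n g)) (g * u)
    have t3 := hd.symm (k * X b (n g)) (g * u)
    linarith
  have hlower : (gap : ℝ) ≤ d (g' * u) (g * u) + 2 * c' := by
    have h1 := hX.lower b (n g) (n g') (by omega)
    rw [← hd.left k] at h1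
    have t1 := hd.tri (k * X b (n g)) (g * u) (k * X b (n g'))
    have t2 := hd.tri (g * u) (g' * u) (k * X b (n g'))
    rw [hd.symm _ (g * u)] at t1
    rw [hd.symm (g * u) (g' * u)] at t2
    linarith
  set s := D * ((hi' - lo : ℝ) / m + 1) + 4 * c' + C with hs
  have hconj : ∀ v, d (k⁻¹ * f * k * X b v) (X b v) = d (f * (k * X b v)) (k * X b v) := fun v => by
    rw [← hd.left k]
    congr 1
    group
  have hlen : (lo : ℝ) + κ * (s + 1) ≤ hi' := by
    have h1 : (ℓ₀ : ℝ) ≤ hi' - lo := by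
      rw [← Nat.cast_sub hlohi]
      exact_mod_cast hℓ
    have h2 : κ * D * ((hi' - lo : ℝ) / m) ≤ (hi' - lo : ℝ) / 2 := by
      rw [mul_div_assoc', div_le_div_iff₀ (by exact_mod_cast hm0) (by norm_num)]
      have h0 : (0 : ℝ) ≤ hi' - lo := (Nat.cast_nonneg ℓ₀).trans h1
      nlinarith
    have h3 : κ * (s + 1) = κ * D * ((hi' - lo : ℝ) / m) + κ * (D + 4 * c' + C + 1) := by
      rw [hs]; ring
    linarith
  obtain ⟨v, hv1, hv2, hv⟩ := hκ A (k⁻¹ * f * k) s lo hi' hlen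
    (by
      rw [hconj]
      have := hdisp' lo (n g) le_rfl hlohi hiI.1 hiI.2
      linarith)
    (by
      rw [hconj]
      have := hdisp' hi' (n g) hlohi le_rfl hiI.1 hiI.2
      linarith)
  rw [hconj] at hv
  have := hdisp' (n g) v hiI.1 hiI.2 hv1 hv2
  linarith

theorem exists_card_le_of_btw (hX : CodingFamily d c D K X) (hd : InvariantHyperbolic d δ)
    (hc : 0 ≤ c) (hD : 1 ≤ D) (hK : 0 ≤ K) (he : DiscreteGeodesic e) {A : ℕ → Bool} {C₁ : ℝ}
    (hC₁ : 0 ≤ C₁) (hedge : ShadowedEdges d e C₁ (X (toeplitzBits A))) (M : ℕ) {c₁ : ℝ}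
    (hc₁ : 0 ≤ c₁) :
    ∃ c' c₂, 0 ≤ c' ∧ 0 ≤ c₂ ∧ ∀ (C : ℝ) (N : ℕ), 0 ≤ C → ∃ B : ℕ,
      ∀ (x y u : G) (Z : Finset G), e x y ≤ M → (∀ g ∈ Z, NearlyBtw d c₁ x (g * u) y) →
      (∀ (p : G) (F : Finset G), F ⊆ Z → (∀ g ∈ F, d (g * u) p ≤ c') → F.card ≤ N) →
      (∀ g ∈ Z, ∀ g' ∈ Z, ∀ w w', NearlyBtw d c₂ x w y → NearlyBtw d c₂ x w' y →
        d (g' * g⁻¹ * w) w ≤ d (g' * g⁻¹ * w') w' + C) → Z.card ≤ B := by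
  have hδ := hd.one_le
  obtain ⟨k, hk⟩ : ∃ k, M ≤ 2 ^ k := ⟨M, Nat.lt_two_pow_self.le⟩
  set c' := c₁ + k * δ + δ + C₁ with hc'
  have hc'0 : 0 ≤ c' := by positivity
  refine ⟨c', 2 * c₁ + δ + c + 4 * c', hc'0, by positivity, fun C N hC => ?_⟩
  obtain ⟨B, hB⟩ := hX.exists_card_le hd hc hD hK c' C N
  refine ⟨B * (M + 1), fun x y u Z hxy hZ hfib hdisp => ?_⟩
  classical
  obtain ⟨κ, hκ⟩ := hedge.exists_cover hd he hk hxy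
  have hpt : ∀ g, ∃ t n, g ∈ Z → t ≤ M ∧ d (g * u) (κ t * X (toeplitzBits A) n) ≤ c' := by
    intro g
    by_cases hg : g ∈ Z
    · obtain ⟨t, ht, n, hn⟩ := hκ _ _ (hZ g hg)
      exact ⟨t, n, fun _ => ⟨ht, hn⟩⟩
    · exact ⟨0, 0, fun h => absurd h hg⟩
  choose t n htn using hpt
  have := Finset.card_le_mul_card_image_of_maps_to (s := Z) (t := Finset.range (M + 1)) (f := t)
    (fun g hg => by simpa [Nat.lt_succ_iff] using (htn g hg).1) B fun τ _ => by
      refine hB A (Z.filter fun g => t g = τ) u (κ τ) n (fun g hg => ?_) (fun v => ?_) ?_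
      · obtain ⟨h1, rfl⟩ := Finset.mem_filter.mp hg
        exact (htn g h1).2
      · refine hfib (κ τ * X (toeplitzBits A) v) _
          ((Finset.filter_subset _ _).trans (Finset.filter_subset _ _)) fun g hg => ?_
        obtain ⟨hg', rfl⟩ := Finset.mem_filter.mp hg
        obtain ⟨h1, rfl⟩ := Finset.mem_filter.mp hg'
        exact (htn g h1).2
      · intro g hg g' hg' g₁ hg₁ g₂ hg₂ v v' h1 h2 h3 h4
        obtain ⟨h5, rfl⟩ := Finset.mem_filter.mp hg₁
        obtain ⟨h6, h6'⟩ := Finset.mem_filter.mp hg₂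
        have a1 := (htn g₁ h5).2
        have a2 := (htn g₂ h6).2
        rw [h6'] at a2
        have hbt : ∀ v, n g₁ ≤ v → v ≤ n g₂ →
            NearlyBtw d (2 * c₁ + δ + c + 4 * c') x (κ (t g₁) * X (toeplitzBits A) v) y := by
          intro v hv hv'
          have b1 : NearlyBtw d c (κ (t g₁) * X (toeplitzBits A) (n g₁))
              (κ (t g₁) * X (toeplitzBits A) v) (κ (t g₁) * X (toeplitzBits A) (n g₂)) := by
            have := hX.btw (toeplitzBits A) _ _ _ hv hv'
            unfold NearlyBtw at *
            rwa [hd.left, hd.left, hd.left]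
          have b2 := hd.btw_of_close b1 (hd.symm _ (g₁ * u) ▸ a1) (hd.symm _ (g₂ * u) ▸ a2)
          have key : ∀ p q, NearlyBtw d c₁ x p y → NearlyBtw d c₁ x q y → d x p ≤ d x q →
              NearlyBtw d (c + 2 * c' + 2 * c') p (κ (t g₁) * X (toeplitzBits A) v) q →
              NearlyBtw d (2 * c₁ + δ + c + 4 * c') x (κ (t g₁) * X (toeplitzBits A) v) y := by
            intro p q hp hq hpq hw
            have b3 := (hd.btw_order hp hq hpq).1
            have b4 := (hd.btw_inner b3 hw).2
            have t1 := hd.tri (κ (t g₁) * X (toeplitzBits A) v) q y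
            unfold NearlyBtw at *
            linarith
          rcases le_total (d x (g₁ * u)) (d x (g₂ * u)) with h | h
          · exact key _ _ (hZ _ h5) (hZ _ h6) h b2
          · exact key _ _ (hZ _ h6) (hZ _ h5) h (hd.btw_symm b2)
        exact hdisp g (Finset.mem_filter.mp hg).1 g' (Finset.mem_filter.mp hg').1 _ _
          (hbt v h1 h2) (hbt v' h3 h4)
  simpa using this

end CodingFamily

/-- The distance `e` is smaller than `d`, concatenations along `d`-geodesics are coarsely additive
for `e`, and a translation-like set of elements cannot be large near an `e`-bounded `d`-geodesic. -/
structure CoarseQuotient {G : Type*} [Group G] (d e : G → G → ℝ) (C : ℝ) : Prop where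
  nonneg : 0 ≤ C
  le : ∀ x y, e x y ≤ d x y
  btw : ∀ c x y z, NearlyBtw d c x y z → NearlyBtw e (2 * c + C) x y z
  exists_card_le : ∀ (M : ℕ) (c₁ : ℝ), 0 ≤ c₁ → ∃ c' c₂, 0 ≤ c' ∧ 0 ≤ c₂ ∧
    ∀ (C : ℝ) (N : ℕ), 0 ≤ C → ∃ B : ℕ,
      ∀ (x y u : G) (Z : Finset G), e x y ≤ M → (∀ g ∈ Z, NearlyBtw d c₁ x (g * u) y) →
      (∀ (p : G) (F : Finset G), F ⊆ Z → (∀ g ∈ F, d (g * u) p ≤ c') → F.card ≤ N) →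
      (∀ g ∈ Z, ∀ g' ∈ Z, ∀ w w', NearlyBtw d c₂ x w y → NearlyBtw d c₂ x w' y →
        d (g' * g⁻¹ * w) w ≤ d (g' * g⁻¹ * w') w' + C) → Z.card ≤ B

section Quotient

variable {G : Type*} [Group G] {d e : G → G → ℝ} {δ δ' C : ℝ}

/-- The points of a quasi-axis which are close to a given point are boundedly many. -/
theorem QuasiAxis.exists_card_le {a : G} {c : ℝ} (ha : QuasiAxis d a c)
    (hd : InvariantHyperbolic d δ) (r : ℝ) :
    ∃ N : ℕ, ∀ (p : G) (F : Finset G), (∀ g ∈ F, ∃ i : ℤ, g = a ^ i) → (∀ g ∈ F, d g p ≤ r) →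
      F.card ≤ N := by
  classical
  obtain ⟨L, hL⟩ := exists_nat_gt (c * (2 * r) + c)
  refine ⟨2 * L + 1, fun p F hF hp => ?_⟩
  have hc := ha.one_le
  rcases F.eq_empty_or_nonempty with rfl | ⟨g₀, hg₀⟩
  · simp
  obtain ⟨i₀, rfl⟩ := hF g₀ hg₀
  have hsub : F ⊆ (Finset.Icc (i₀ - L) (i₀ + L)).image fun i : ℤ => a ^ i := fun g hg => by
    obtain ⟨i, rfl⟩ := hF g hg
    have h1 := ha.lower' hd i₀ i
    have h2 := hd.tri (a ^ i₀) p (a ^ i)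
    rw [hd.symm p] at h2
    have h3 : c * d (a ^ i₀) (a ^ i) ≤ c * (2 * r) :=
      mul_le_mul_of_nonneg_left (by linarith [hp _ hg, hp _ hg₀]) (by linarith)
    have h4 : |(i : ℝ) - i₀| ≤ L := by linarith
    have h5 : |i - i₀| ≤ L := by exact_mod_cast h4
    rw [abs_le] at h5
    exact Finset.mem_image.mpr ⟨i, Finset.mem_Icc.mpr ⟨by linarith, by linarith⟩, rfl⟩
  refine (Finset.card_le_card hsub).trans (Finset.card_image_le.trans ?_)
  rw [Int.card_Icc]
  omega

namespace CoarseQuotient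

theorem exists_le_dist_one_pow (h : CoarseQuotient d e C) (hd : InvariantHyperbolic d δ) {a : G}
    {c : ℝ} (ha : QuasiAxis d a c) (r : ℝ) : ∃ n : ℕ, r ≤ e 1 (a ^ n) := by
  classical
  by_contra! hlt
  have hc := ha.one_le
  have hδ := hd.one_le
  obtain ⟨M, hM⟩ := exists_nat_gt r
  obtain ⟨c', c₂, hc', hc₂, hB⟩ := h.exists_card_le M c (by linarith)
  obtain ⟨N, hN⟩ := ha.exists_card_le hd c'
  set s := 3 * c + 2 * c₂ + 2 * δ with hs
  obtain ⟨B, hB⟩ := hB (4 * s) N (by positivity)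
  have hinj : Function.Injective fun n : ℕ => a ^ n := by
    refine fun i j hij => ?_
    by_contra hne
    obtain ⟨k, hk0, hk⟩ : ∃ k : ℤ, k ≠ 0 ∧ a ^ k = 1 :=
      ⟨i - j, by omega, by simpa [zpow_sub, mul_inv_eq_one] using hij⟩
    obtain ⟨n, hn⟩ := ha.exists_far 0
    have := hn (k * n) (by
      rw [abs_mul, Nat.abs_cast]
      exact le_mul_of_one_le_left (by positivity) (Int.one_le_abs hk0))
    rw [zpow_mul, hk, one_zpow, hd.self] at this
    exact lt_irrefl _ this
  have hcard := hB 1 (a ^ B) 1 ((Finset.range (B + 1)).image fun n => a ^ n) ((hlt B).le.trans hM.le)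
    (fun g hg => by
      obtain ⟨i, hi, rfl⟩ := Finset.mem_image.mp hg
      have := ha.btw 0 i B (by positivity) (by simpa [Nat.lt_succ_iff] using hi)
      simpa using this)
    (fun p F hF hp => by
      refine hN p F (fun g hg => ?_) (by simpa using hp)
      obtain ⟨i, -, rfl⟩ := Finset.mem_image.mp (hF hg)
      exact ⟨i, by simp⟩)
    (fun g hg g' hg' w w' hw hw' => by
      obtain ⟨i, -, rfl⟩ := Finset.mem_image.mp hg
      obtain ⟨j, -, rfl⟩ := Finset.mem_image.mp hg'
      have hij : a ^ j * (a ^ i)⁻¹ = a ^ ((j : ℤ) - i) := by simp [zpow_sub]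
      rw [hij]
      have key : ∀ w, NearlyBtw d c₂ 1 w (a ^ B) →
          |d (a ^ ((j : ℤ) - i) * w) w - d 1 (a ^ ((j : ℤ) - i))| ≤ 2 * s := fun w hw => by
        obtain ⟨t, -, -, ht⟩ := ha.exists_near hd (i := 0) (k := B) (by positivity) hc₂
          (p := w) (by simpa using hw)
        have e1 : d (a ^ ((j : ℤ) - i) * a ^ t) (a ^ t) = d 1 (a ^ ((j : ℤ) - i)) := by
          rw [← zpow_add, hd.dist_zpow, ← hd.dist_one_zpow_neg]
          congr 2
          ring
        have e2 := hd.left (a ^ ((j : ℤ) - i)) w (a ^ t)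
        have t1 := hd.tri (a ^ ((j : ℤ) - i) * w) (a ^ ((j : ℤ) - i) * a ^ t) w
        have t2 := hd.tri (a ^ ((j : ℤ) - i) * a ^ t) (a ^ t) w
        have t3 := hd.tri (a ^ ((j : ℤ) - i) * a ^ t) (a ^ ((j : ℤ) - i) * w) (a ^ t)
        have t4 := hd.tri (a ^ ((j : ℤ) - i) * w) w (a ^ t)
        have s1 := hd.symm (a ^ t) w
        have s2 := hd.symm (a ^ ((j : ℤ) - i) * a ^ t) (a ^ ((j : ℤ) - i) * w)
        rw [abs_le]
        constructor <;> linarith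
      have k1 := abs_le.mp (key w hw)
      have k2 := abs_le.mp (key w' hw')
      linarith)
  rw [Finset.card_image_of_injective _ hinj, Finset.card_range] at hcard
  omega

theorem loxodromic (h : CoarseQuotient d e C) (hd : InvariantHyperbolic d δ)
    (he : InvariantHyperbolic e δ') {a : G} (ha : LoxodromicWith d leftTranslation a) :
    LoxodromicWith e leftTranslation a := by
  obtain ⟨c, ha⟩ := hd.exists_quasiAxis_of_loxodromic ha
  have hc := ha.one_le
  have hC := h.nonneg
  set E := 2 * c + C with hE
  obtain ⟨n₀, hn₀⟩ := h.exists_le_dist_one_pow hd ha (E + 1)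
  have hn0 : 1 ≤ n₀ := by
    rcases Nat.eq_zero_or_pos n₀ with rfl | h0
    · rw [pow_zero, he.self] at hn₀
      linarith
    · exact h0
  have hadd : ∀ m n : ℕ, e 1 (a ^ m) + e 1 (a ^ n) ≤ e 1 (a ^ (m + n)) + E := fun m n => by
    have h1 := h.btw _ _ _ _ (ha.btw 0 m (m + n) (by positivity) (by linarith [Int.natCast_nonneg n]))
    rw [NearlyBtw, he.dist_zpow a m, add_sub_cancel_left] at h1
    have h2 : a ^ ((m : ℤ) + n) = a ^ (m + n) := by exact_mod_cast zpow_natCast a (m + n)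
    rwa [h2, zpow_natCast, zpow_natCast, zpow_zero] at h1
  have hmul : ∀ k : ℕ, (k : ℝ) ≤ e 1 (a ^ (n₀ * k)) := fun k => by
    induction k with
    | zero => simp [he.self]
    | succ k ih =>
      have := hadd (n₀ * k) n₀
      rw [← Nat.mul_succ] at this
      push_cast
      linarith
  have hnat : ∀ n : ℕ, (n : ℝ) / n₀ - (1 + E) ≤ e 1 (a ^ n) := fun n => by
    have h1 := hadd (n₀ * (n / n₀)) (n % n₀)
    rw [Nat.div_add_mod] at h1
    have h2 := hmul (n / n₀)
    have h3 := he.nonneg 1 (a ^ (n % n₀))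
    have h4 : (n : ℝ) / n₀ < (n / n₀ : ℕ) + 1 := by
      rw [div_lt_iff₀ (by exact_mod_cast hn0)]
      exact_mod_cast Nat.lt_mul_of_div_lt (Nat.lt_succ_self _) hn0
    linarith
  refine he.loxodromic_of_le (A := n₀) (B := 1 + E) (by exact_mod_cast hn0) (by positivity)
    fun n => ?_
  obtain ⟨m, rfl | rfl⟩ := n.eq_nat_or_neg
  · simpa using hnat m
  · rw [he.dist_one_zpow_neg]
    simpa using hnat m

theorem loxodromic_iff (h : CoarseQuotient d e C) (hd : InvariantHyperbolic d δ)
    (he : InvariantHyperbolic e δ') (a : G) :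
    LoxodromicWith e leftTranslation a ↔ LoxodromicWith d leftTranslation a := by
  refine ⟨fun ha => ?_, h.loxodromic hd he⟩
  obtain ⟨c, ha⟩ := he.exists_quasiAxis_of_loxodromic ha
  have hc := ha.one_le
  refine hd.loxodromic_of_le (A := c) (B := 1) hc zero_le_one fun n => ?_
  rw [sub_le_iff_le_add, div_le_iff₀ (by linarith)]
  have := ha.lower n
  have := mul_le_mul_of_nonneg_left (h.le 1 (a ^ n)) (by linarith : 0 ≤ c)
  linarith

end CoarseQuotient

end Quotient

section Quotient

variable {G : Type*} [Group G] {d e : G → G → ℝ} {δ δ' C : ℝ}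

namespace CoarseQuotient

/-- An element moving `x` and `y` a little moves the middle of a geodesic from `x` to `y` along
itself. -/
theorem btw_mul (h : CoarseQuotient d e C) (hd : InvariantHyperbolic d δ)
    (he : InvariantHyperbolic e δ') {c η : ℝ} {x y w f : G} (hw : NearlyBtw d c x w y)
    (hfx : e x (f * x) ≤ η) (hfy : e y (f * y) ≤ η) (hxw : η + 2 * c + 4 * δ + C < e x w)
    (hyw : η + 2 * c + 4 * δ + C < e y w) : NearlyBtw d (c + 2 * δ) x (f * w) y := by
  have hδ := hd.one_le
  have hfw : NearlyBtw d c (f * x) (f * w) (f * y) := by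
    unfold NearlyBtw at *
    rwa [hd.left, hd.left, hd.left]
  have hx := he.left f x w
  have hy := he.left f y w
  have n1 := he.nonneg (f * w) x
  have n2 := he.nonneg y (f * w)
  have s1 := he.symm x (f * x)
  have s2 := he.symm (f * y) (f * w)
  rcases hd.btw_or_btw (z := x) hfw with h1 | h1
  · have := h.btw _ _ _ _ h1
    unfold NearlyBtw at this
    linarith
  rcases hd.btw_or_btw (z := y) h1 with h2 | h2
  · unfold NearlyBtw at *
    linarith
  · have := h.btw _ _ _ _ h2
    unfold NearlyBtw at this
    linarith

/-- An element moving `x` and `y` a little moves all points in the middle of a geodesic from `x` to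
`y` by roughly the same amount. -/
theorem dist_mul_le (h : CoarseQuotient d e C) (hd : InvariantHyperbolic d δ)
    (he : InvariantHyperbolic e δ') {c η : ℝ} {x y w w' f : G} (hc : 0 ≤ c) (hη : 0 ≤ η)
    (hw : NearlyBtw d c x w y) (hw' : NearlyBtw d c x w' y) (hfx : e x (f * x) ≤ η)
    (hfy : e y (f * y) ≤ η) (hxw : e w w' + 2 * C + 2 * η + 8 * δ + 4 + 2 * c < e x w)
    (hyw : e w w' + 2 * C + 2 * η + 8 * δ + 4 + 2 * c < e y w)
    (hxw' : e w w' + 2 * C + 2 * η + 8 * δ + 4 + 2 * c < e x w')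
    (hyw' : e w w' + 2 * C + 2 * η + 8 * δ + 4 + 2 * c < e y w') :
    d (f * w) w ≤ d (f * w') w' + (c + 4 * δ) := by
  have hδ := hd.one_le
  have hC := h.nonneg
  have n0 := he.nonneg w w'
  have b1 := h.btw_mul hd he hw hfx hfy (by linarith) (by linarith)
  have b2 := h.btw_mul hd he hw' hfx hfy (by linarith) (by linarith)
  have key : ∀ v v', e v v' + 2 * C + 2 * η + 8 * δ + 4 + 2 * c < e y v →
      ¬ d (f * v) y + d (f * v') (f * y) ≤ d (f * v) (f * v') + d y (f * y) + δ := by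
    intro v v' hv hle
    obtain ⟨p, hp1, hp2⟩ := hd.exists_btw_btw hle
    have k1 := h.btw _ _ _ _ hp1
    have k2 := h.btw _ _ _ _ hp2
    unfold NearlyBtw at k1 k2
    rw [he.left] at k1
    have n1 := he.nonneg p (f * v')
    have n2 := he.nonneg p (f * y)
    have t1 := he.tri y p (f * v)
    have t2 := he.tri (f * y) y (f * v)
    have s1 := he.symm p (f * v)
    have s2 := he.symm y (f * y)
    rw [he.left] at t2
    linarith
  have fp1 := hd.fourPoint (f * w) y (f * w') (f * y)
  have fp2 := hd.fourPoint (f * w') y (f * w) (f * y)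
  have k1 := key w w' hyw
  have k2 := key w' w (by rwa [he.symm])
  replace fp1 := fp1.resolve_left k1
  replace fp2 := fp2.resolve_left k2
  rw [hd.left, hd.left] at fp1 fp2
  have b0 : NearlyBtw d (c + 2 * δ) x w y := by unfold NearlyBtw at *; linarith
  have d1 := hd.dist_le_of_btw b1 b0
  have t1 := hd.tri (f * w') w' y
  have t2 := hd.tri w' (f * w') y
  have s1 := hd.symm w' (f * w')
  have s3 := hd.symm y (f * w')
  have s4 := hd.symm y (f * w)
  have d2 : |d (f * w) y - d w y| ≤ d (f * w') w' + δ := by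
    rw [abs_le]
    constructor <;> linarith
  linarith

theorem finsetAcylindrical (h : CoarseQuotient d e C) (hd : InvariantHyperbolic d δ)
    (he : InvariantHyperbolic e δ') (hac : FinsetAcylindrical d) : FinsetAcylindrical e := by
  intro ε₀
  have hδ := hd.one_le
  have hδ' := he.one_le
  have hC := h.nonneg
  set ε := max ε₀ 0 with hε
  have hε0 : 0 ≤ ε := le_max_right _ _
  set ε' := ε + 4 * δ + C + δ' with hε'
  have hε'0 : 0 ≤ ε' := by positivity
  obtain ⟨M, hM⟩ := exists_nat_gt (2 * ε')
  obtain ⟨c', c₂, hc', hc₂, hB⟩ := h.exists_card_le M (6 * δ) (by positivity)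
  obtain ⟨R₁', N, hN⟩ := hac (2 * c' + 6 * δ)
  obtain ⟨R₁, hR₁⟩ := exists_nat_gt R₁'
  obtain ⟨B, hB⟩ := hB (c₂ + 5 * δ + 4 * δ) N (by positivity)
  set ρ := 3 * ε' + 2 * c₂ + C with hρ
  have hρ0 : 0 ≤ ρ := by positivity
  obtain ⟨R₀, hR₀⟩ := exists_nat_gt (R₁ + 3 * ρ + 4 * C + 8 * ε + 50 * δ + 10 * c₂ + 10)
  have hR₁0 : (0 : ℝ) ≤ R₁ := Nat.cast_nonneg _
  refine ⟨2 * R₀ + R₁, B, fun x y hxy F hF => ?_⟩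
  replace hF : ∀ g ∈ F, e x (g * x) ≤ ε ∧ e y (g * y) ≤ ε := fun g hg =>
    ⟨(hF g hg).1.trans (le_max_left _ _), (hF g hg).2.trans (le_max_left _ _)⟩
  obtain ⟨u, hu, hxu⟩ := DiscreteHyperbolic.exists_eq_on_geodesic hd.toDiscreteGeodesic he.toDiscreteGeodesic h.le
    (x := y) (y := x) (r := R₀) (by linarith)
  have tu := he.tri x u y
  obtain ⟨v, hv, huv⟩ := DiscreteHyperbolic.exists_eq_on_geodesic hd.toDiscreteGeodesic he.toDiscreteGeodesic h.le
    (x := y) (y := u) (r := R₁) (by linarith)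
  have tv := he.tri u v y
  have hu0 : NearlyBtw d 0 x u y := hd.btw_symm (by unfold NearlyBtw; linarith)
  have hv0 : NearlyBtw d 0 x v y := hd.btw_symm (by
    have := hd.tri v u x
    have := hd.tri y v x
    unfold NearlyBtw
    linarith)
  have hxv : (R₀ : ℝ) - C ≤ e x v := by
    have hb : NearlyBtw d 0 x u v := hd.btw_symm (by
      have := hd.tri y v x
      unfold NearlyBtw
      linarith)
    have := h.btw _ _ _ _ hb
    unfold NearlyBtw at this
    linarith
  have s1 := he.symm u y
  have s2 := he.symm v y
  have hgu : ∀ g ∈ F, NearlyBtw d (2 * δ) x (g * u) y := fun g hg => by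
    simpa using h.btw_mul hd he hu0 (hF g hg).1 (hF g hg).2 (by linarith) (by linarith)
  have hgv : ∀ g ∈ F, NearlyBtw d (2 * δ) x (g * v) y := fun g hg => by
    simpa using h.btw_mul hd he hv0 (hF g hg).1 (hF g hg).2 (by linarith) (by linarith)
  have hdiff : ∀ g ∈ F, ∀ g' ∈ F, ∀ z, e z (g * z) ≤ ε → e z (g' * z) ≤ ε →
      e z (g' * g⁻¹ * z) ≤ 2 * ε := fun g _ g' _ z h1 h2 => by
    have t := he.tri z (g' * z) (g' * g⁻¹ * z)
    have e1 : e (g' * z) (g' * g⁻¹ * z) = e z (g * z) := by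
      rw [mul_assoc, he.left, ← he.left g, mul_inv_cancel_left, he.symm]
    linarith
  have heu : ∀ g ∈ F, e u (g * u) ≤ ε' := fun g hg => by
    have b1 := he.btw_symm (h.btw _ _ _ _ (hgu g hg))
    have b2 := he.btw_symm (h.btw _ _ _ _ hu0)
    have b3 : NearlyBtw e (2 * (2 * δ) + C) y u x := by unfold NearlyBtw at *; linarith
    have k := he.dist_le_of_btw b3 b1
    have t1 := he.tri (g * u) (g * x) x
    have t2 := he.tri (g * u) x (g * x)
    rw [he.left] at t1 t2
    have s3 := he.symm (g * x) x
    have : |e u x - e (g * u) x| ≤ ε := by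
      rw [abs_le]
      constructor <;> linarith [(hF g hg).1]
    linarith
  rcases F.eq_empty_or_nonempty with rfl | hne
  · simp
  obtain ⟨g₁, hg₁, hmin⟩ := F.exists_min_image (fun g => d x (g * u)) hne
  obtain ⟨g₂, hg₂, hmax⟩ := F.exists_max_image (fun g => d x (g * u)) hne
  have h12 : e (g₁ * u) (g₂ * u) ≤ 2 * ε' := by
    have := he.tri (g₁ * u) u (g₂ * u)
    rw [he.symm (g₁ * u) u] at this
    linarith [heu g₁ hg₁, heu g₂ hg₂]
  have hcore : ∀ w, NearlyBtw d c₂ (g₁ * u) w (g₂ * u) →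
      NearlyBtw d (c₂ + 5 * δ) x w y ∧ e u w ≤ ρ := fun w hw => by
    have b1 := (hd.btw_order (hgu g₁ hg₁) (hgu g₂ hg₂) (hmin g₂ hg₂)).1
    have b2 := (hd.btw_inner b1 hw).2
    have b3 := hgu g₂ hg₂
    have b4 := h.btw _ _ _ _ hw
    have t1 := hd.tri w (g₂ * u) y
    have t2 := he.tri u (g₁ * u) w
    have n1 := he.nonneg w (g₂ * u)
    have := heu g₁ hg₁
    unfold NearlyBtw at *
    constructor <;> linarith
  refine hB (g₁ * u) (g₂ * u) u F (h12.trans hM.le) (fun g hg => ?_) (fun p F' hF' hp => ?_) ?_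
  · have := hd.btw_order_three (hgu g₁ hg₁) (hgu g hg) (hgu g₂ hg₂) (hmin g hg) (hmax g hg)
    unfold NearlyBtw at *
    linarith
  · classical
    rcases F'.eq_empty_or_nonempty with rfl | ⟨g₀, hg₀⟩
    · simp
    rw [← Finset.card_image_of_injective F' (mul_right_injective g₀⁻¹)]
    refine hN u v (hR₁.le.trans (huv ▸ h.le u v)) _ fun f hf => ?_
    obtain ⟨g, hg, rfl⟩ := Finset.mem_image.mp hf
    have hgF := hF' hg
    have hg₀F := hF' hg₀
    have e1 : ∀ z, d z (g₀⁻¹ * g * z) = d (g * g₀⁻¹ * (g₀ * z)) (g₀ * z) := fun z => by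
      rw [← hd.left g₀, hd.symm]
      congr 1
      group
    have e2 : d (g * g₀⁻¹ * (g₀ * u)) (g₀ * u) ≤ 2 * c' := by
      have := hd.tri (g * u) p (g₀ * u)
      rw [hd.symm p] at this
      rw [show g * g₀⁻¹ * (g₀ * u) = g * u by group]
      linarith [hp g hg, hp g₀ hg₀]
    have bd : ∀ z, e x z ≤ e x (g₀ * z) + ε ∧ e y z ≤ e y (g₀ * z) + ε := fun z => by
      have t1 := he.tri (g₀ * x) x (g₀ * z)
      have t2 := he.tri (g₀ * y) y (g₀ * z)
      rw [he.left, he.symm _ x] at t1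
      rw [he.left, he.symm _ y] at t2
      constructor <;> linarith [(hF g₀ hg₀F).1, (hF g₀ hg₀F).2]
    have e3 := h.dist_mul_le hd he (c := 2 * δ) (η := 2 * ε) (by linarith) (by linarith)
      (hgv g₀ hg₀F) (hgu g₀ hg₀F)
      (hdiff _ hg₀F _ hgF x (hF g₀ hg₀F).1 (hF g hgF).1)
      (hdiff _ hg₀F _ hgF y (hF g₀ hg₀F).2 (hF g hgF).2)
      (by rw [he.left, he.symm]; linarith [bd v])
      (by rw [he.left, he.symm]; linarith [bd v])
      (by rw [he.left, he.symm]; linarith [bd u])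
      (by rw [he.left, he.symm]; linarith [bd u])
    simp only [e1]
    constructor <;> linarith
  · intro g hg g' hg' w w' hw hw'
    obtain ⟨b1, r1⟩ := hcore w hw
    obtain ⟨b2, r2⟩ := hcore w' hw'
    have t0 := he.tri w u w'
    have t1 := he.tri x w u
    have t2 := he.tri y w u
    have t3 := he.tri x w' u
    have t4 := he.tri y w' u
    have s3 := he.symm w u
    have s4 := he.symm w' u
    exact h.dist_mul_le hd he (c := c₂ + 5 * δ) (η := 2 * ε) (by linarith) (by linarith) b1 b2
      (hdiff _ hg _ hg' x (hF g hg).1 (hF g' hg').1)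
      (hdiff _ hg _ hg' y (hF g hg).2 (hF g' hg').2)
      (by linarith) (by linarith) (by linarith) (by linarith)

end CoarseQuotient

end Quotient

theorem DiscreteHyperbolic.fourPointHyperbolic {α : Type*} {d : α → α → ℝ} {δ : ℝ}
    (hd : DiscreteHyperbolic d δ) : FourPointHyperbolic d := by
  refine ⟨δ, zero_le_one.trans hd.one_le, fun w x y z => ?_⟩
  have hδ := hd.one_le
  have s := hd.symm y z
  unfold gromovProd
  rw [sub_le_iff_le_add, min_le_iff]
  rcases hd.fourPoint w z x y with h | h
  · right; linarith [hd.symm z y]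
  · left; linarith [hd.symm z x]

section WordMetric

variable {G : Type*} [Group G] {S T : Set G}

theorem wordLength_prod_le {l : List G} (hl : ∀ s ∈ l, s ∈ S ∨ s⁻¹ ∈ S) :
    wordLength S l.prod ≤ l.length :=
  Nat.sInf_le ⟨l, rfl, hl, rfl⟩

theorem wordLength_one : wordLength S (1 : G) = 0 :=
  Nat.le_zero.mp (wordLength_prod_le (S := S) (l := []) (by simp))

theorem wordLength_le_one_of_mem {g : G} (h : g ∈ S ∨ g⁻¹ ∈ S) : wordLength S g ≤ 1 := by
  simpa using wordLength_prod_le (S := S) (l := [g]) (by simpa using h)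

namespace IsGenSet

theorem mono (hS : IsGenSet S) (h : S ⊆ T) : IsGenSet T :=
  top_unique (hS.symm.trans_le (Subgroup.closure_mono h))

theorem exists_list (hS : IsGenSet S) (g : G) :
    ∃ l : List G, l.length = wordLength S g ∧ (∀ s ∈ l, s ∈ S ∨ s⁻¹ ∈ S) ∧ l.prod = g := by
  have hg : g ∈ (Subgroup.closure S).toSubmonoid := by
    rw [hS]
    trivial
  rw [Subgroup.closure_toSubmonoid] at hg
  obtain ⟨l, hl, rfl⟩ := Submonoid.exists_list_of_mem_closure hg
  have hne : {n : ℕ | ∃ m : List G, m.length = n ∧ (∀ s ∈ m, s ∈ S ∨ s⁻¹ ∈ S) ∧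
      m.prod = l.prod}.Nonempty := ⟨l.length, l, rfl, fun s hs => by simpa using hl s hs, rfl⟩
  exact Nat.sInf_mem hne

theorem wordLength_mul_le (hS : IsGenSet S) (g h : G) :
    wordLength S (g * h) ≤ wordLength S g + wordLength S h := by
  obtain ⟨l, hl, hlS, rfl⟩ := hS.exists_list g
  obtain ⟨m, hm, hmS, rfl⟩ := hS.exists_list h
  rw [← hl, ← hm, ← List.length_append, ← List.prod_append]
  refine wordLength_prod_le fun s hs => ?_
  exact (List.mem_append.mp hs).elim (hlS s) (hmS s)

theorem wordLength_inv_le (hS : IsGenSet S) (g : G) : wordLength S g⁻¹ ≤ wordLength S g := by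
  obtain ⟨l, hl, hlS, rfl⟩ := hS.exists_list g
  rw [← hl, List.prod_inv_reverse]
  refine (wordLength_prod_le fun s hs => ?_).trans_eq (by simp)
  obtain ⟨t, ht, rfl⟩ := List.mem_map.mp (List.mem_reverse.mp hs)
  rw [inv_inv]
  exact (hlS t ht).symm

theorem wordLength_inv (hS : IsGenSet S) (g : G) : wordLength S g⁻¹ = wordLength S g :=
  (hS.wordLength_inv_le g).antisymm (by simpa using hS.wordLength_inv_le g⁻¹)

theorem wordLength_le_one (hS : IsGenSet S) {g : G} (h : wordLength S g ≤ 1) :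
    g = 1 ∨ g ∈ S ∨ g⁻¹ ∈ S := by
  obtain ⟨l, hl, hlS, rfl⟩ := hS.exists_list g
  rw [← hl] at h
  match l, h with
  | [], _ => simp
  | [a], _ => exact Or.inr (by simpa using hlS)

theorem discreteGeodesic (hS : IsGenSet S) : DiscreteGeodesic (wordDist S) where
  self x := by simp [wordDist, wordLength_one]
  eq_of x y h := by
    obtain ⟨l, hl, -, hp⟩ := hS.exists_list (x⁻¹ * y)
    rw [wordDist, Nat.cast_eq_zero] at h
    rw [h, List.length_eq_zero_iff] at hl
    rw [hl, List.prod_nil] at hp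
    exact inv_mul_eq_one.mp hp.symm
  symm x y := by
    rw [wordDist, wordDist, ← hS.wordLength_inv (x⁻¹ * y)]
    simp
  tri x y z := by
    have := hS.wordLength_mul_le (x⁻¹ * y) (y⁻¹ * z)
    rw [show x⁻¹ * y * (y⁻¹ * z) = x⁻¹ * z by group] at this
    unfold wordDist
    exact_mod_cast this
  nat x y := ⟨_, rfl⟩
  split x y n hn := by
    obtain ⟨l, hl, hlS, hp⟩ := hS.exists_list (x⁻¹ * y)
    have hnl : n ≤ wordLength S (x⁻¹ * y) := by
      unfold wordDist at hn
      exact_mod_cast hn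
    have h1 : wordLength S (l.take n).prod ≤ n :=
      (wordLength_prod_le fun s hs => hlS s (List.mem_of_mem_take hs)).trans (by simp)
    have h2 : wordLength S (l.drop n).prod ≤ wordLength S (x⁻¹ * y) - n :=
      (wordLength_prod_le fun s hs => hlS s (List.mem_of_mem_drop hs)).trans (by simp [hl])
    have h3 := hS.wordLength_mul_le (l.take n).prod (l.drop n).prod
    rw [List.prod_take_mul_prod_drop, hp] at h3
    have h4 : (l.drop n).prod = (x * (l.take n).prod)⁻¹ * y := by
      rw [mul_inv_rev, mul_assoc, ← hp, ← List.prod_take_mul_prod_drop l n, inv_mul_cancel_left]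
    refine ⟨x * (l.take n).prod, ?_, ?_⟩
    · rw [wordDist, inv_mul_cancel_left]
      exact_mod_cast (by omega : wordLength S (l.take n).prod = n)
    · rw [wordDist, wordDist, ← h4, ← Nat.cast_sub hnl]
      exact_mod_cast (by omega :
        wordLength S (l.drop n).prod = wordLength S (x⁻¹ * y) - n)

end IsGenSet

theorem wordDist_mul_left (g x y : G) : wordDist S (g * x) (g * y) = wordDist S x y := by
  simp [wordDist, mul_assoc]

theorem wordDist_anti (hS : IsGenSet S) (h : S ⊆ T) (x y : G) : wordDist T x y ≤ wordDist S x y := by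
  obtain ⟨l, hl, hlS, hp⟩ := hS.exists_list (x⁻¹ * y)
  rw [wordDist, wordDist, ← hl, ← hp]
  exact_mod_cast wordLength_prod_le fun s hs => (hlS s hs).imp (@h s) (@h s⁻¹)

theorem IsGenSet.exists_invariantHyperbolic (hS : IsGenSet S)
    (h : FourPointHyperbolic (wordDist S)) : ∃ δ, InvariantHyperbolic (wordDist S) δ := by
  obtain ⟨δ, -, h⟩ := h
  refine ⟨max 1 (2 * δ), { hS.discreteGeodesic with
    one_le := le_max_left _ _
    left := wordDist_mul_left
    fourPoint := fun w x y z => ?_ }⟩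
  have h1 := h w y z x
  have h2 := le_max_right 1 (2 * δ)
  have s := hS.discreteGeodesic.symm x y
  unfold gromovProd at h1
  rw [sub_le_iff_le_add, min_le_iff] at h1
  rcases h1 with h1 | h1
  · right; linarith
  · left; linarith

end WordMetric

section Coned

variable {G : Type*} [Group G] {S : Set G} {d e : G → G → ℝ} {δ c D C : ℝ} {x : ℕ → G}

/-- The generating set `S` together with all elements joining two terms of the sequence `x`. -/
def conedSet (S : Set G) (x : ℕ → G) : Set G :=
  S ∪ Set.range fun p : ℕ × ℕ => (x p.1)⁻¹ * x p.2

theorem wordDist_conedSet_le_one (g : G) (i j : ℕ) :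
    wordDist (conedSet S x) (g * x i) (g * x j) ≤ 1 := by
  rw [wordDist_mul_left, wordDist]
  exact_mod_cast wordLength_le_one_of_mem (S := conedSet S x) (Or.inl (Or.inr ⟨(i, j), rfl⟩))

theorem InvariantHyperbolic.exists_near_of_btw (hd : InvariantHyperbolic d δ) (hc : 0 ≤ c)
    (hD : 0 ≤ D) (hx : ∀ i j k, i ≤ j → j ≤ k → NearlyBtw d c (x i) (x j) (x k))
    (hs : ∀ i, d (x i) (x (i + 1)) ≤ D) {i j : ℕ} {p : G} (hp : NearlyBtw d 0 (x i) p (x j)) :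
    ∃ n, d p (x n) ≤ D + 2 * c + 2 * δ := by
  have hδ := hd.one_le
  wlog hij : i ≤ j generalizing i j
  · exact this (hd.btw_symm hp) (by omega)
  rcases hij.eq_or_lt with rfl | hij
  · refine ⟨i, ?_⟩
    have := hd.nonneg (x i) p
    unfold NearlyBtw at hp
    rw [hd.self] at hp
    linarith
  · obtain ⟨n, -, -, hn⟩ := hd.exists_btw_consecutive hij
      (fun j h1 h2 => hx _ _ _ h1 h2) (p := p) (by unfold NearlyBtw at *; linarith)
    refine ⟨n, ?_⟩
    have := hd.nonneg p (x (n + 1))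
    have := hs n
    rw [hd.symm]
    unfold NearlyBtw at hn
    linarith

theorem IsGenSet.shadowedEdges_conedSet (hS : IsGenSet S)
    (hd : InvariantHyperbolic (wordDist S) δ) (hc : 0 ≤ c) (hD : 0 ≤ D)
    (hx : ∀ i j k, i ≤ j → j ≤ k → NearlyBtw (wordDist S) c (x i) (x j) (x k))
    (hs : ∀ i, wordDist S (x i) (x (i + 1)) ≤ D) :
    ShadowedEdges (wordDist S) (wordDist (conedSet S x)) (D + 2 * c + 2 * δ) x := by
  have hδ := hd.one_le
  intro y z hyz
  have near : ∀ (k : G) (i j : ℕ), k * x i = y → k * x j = z → ∀ p,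
      wordDist S y p + wordDist S p z = wordDist S y z →
      ∃ n, wordDist S p (k * x n) ≤ D + 2 * c + 2 * δ := by
    rintro k i j rfl rfl p hp
    obtain ⟨n, hn⟩ := hd.exists_near_of_btw hc hD hx hs (i := i) (j := j) (p := k⁻¹ * p) (by
      unfold NearlyBtw
      rw [← hd.left k, ← hd.left k (k⁻¹ * p), ← hd.left k (x i), mul_inv_cancel_left, hp, add_zero])
    exact ⟨n, by rwa [← hd.left k, mul_inv_cancel_left] at hn⟩
  have short : wordDist S y z ≤ 1 → ∃ k, ∀ p,
      wordDist S y p + wordDist S p z = wordDist S y z →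
      ∃ n, wordDist S p (k * x n) ≤ D + 2 * c + 2 * δ := fun h1 =>
    ⟨y * (x 0)⁻¹, fun p hp => ⟨0, by
      rw [inv_mul_cancel_right, hd.symm]
      linarith [hd.nonneg p z]⟩⟩
  have hword : ∀ g, g ∈ S ∨ g⁻¹ ∈ S → (wordLength S g : ℝ) ≤ 1 := fun g hg => by
    exact_mod_cast wordLength_le_one_of_mem hg
  unfold wordDist at hyz
  rcases (hS.mono Set.subset_union_left).wordLength_le_one (by exact_mod_cast hyz)
    with h | (h | ⟨⟨i, j⟩, h⟩) | (h | ⟨⟨i, j⟩, h⟩)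
  · refine short ?_
    rw [wordDist, h, wordLength_one]
    norm_num
  · exact short (hword _ (Or.inl h))
  · refine ⟨y * (x i)⁻¹, near _ i j (by simp) ?_⟩
    rw [mul_assoc]
    exact (congrArg (y * ·) h).trans (mul_inv_cancel_left y z)
  · exact short (hword _ (Or.inr h))
  · refine ⟨z * (x i)⁻¹, near _ j i ?_ (by simp)⟩
    rw [mul_assoc]
    exact (congrArg (z * ·) h).trans (by group)

theorem CodingFamily.exists_coarseQuotient {K : ℝ} {X : (ℕ → Bool) → ℕ → G} (hS : IsGenSet S)
    (hd : InvariantHyperbolic (wordDist S) δ) (hX : CodingFamily (wordDist S) c D K X) (hc : 0 ≤ c)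
    (hD : 1 ≤ D) (hK : 0 ≤ K) (A : ℕ → Bool) :
    ∃ C δ', CoarseQuotient (wordDist S) (wordDist (conedSet S (X (toeplitzBits A)))) C ∧
      InvariantHyperbolic (wordDist (conedSet S (X (toeplitzBits A)))) δ' := by
  have hδ := hd.one_le
  set x := X (toeplitzBits A) with hx
  have hsub : S ⊆ conedSet S x := Set.subset_union_left
  have he := (hS.mono hsub).discreteGeodesic
  have hle := wordDist_anti hS hsub
  have hedge := hS.shadowedEdges_conedSet hd hc (zero_le_one.trans hD) (hX.btw (toeplitzBits A))
    fun i => by simpa using hX.upper (toeplitzBits A) i (i + 1) (by omega)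
  set C₁ := D + 2 * c + 2 * δ with hC₁
  obtain ⟨C, hC0, hC⟩ := hd.exists_reverse_triangle he hle (C₀ := 2 * C₁ + 1) fun y z p hyz hp => by
    obtain ⟨k, hk⟩ := hedge y z hyz
    obtain ⟨m, hm⟩ := hk y (by rw [hd.self, zero_add])
    obtain ⟨n, hn⟩ := hk p hp
    have h1 := wordDist_conedSet_le_one (S := S) (x := x) k m n
    have h2 := hle y (k * x m)
    have h3 := hle p (k * x n)
    have t1 := he.tri y (k * x m) p
    have t2 := he.tri (k * x m) (k * x n) p
    have s := he.symm p (k * x n)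
    linarith
  refine ⟨C + 2 * δ, _, ⟨by positivity, hle, fun c y z w h => ?_, fun M c₁ hc₁ =>
    hX.exists_card_le_of_btw hd hc hD hK he (by positivity) hedge M hc₁⟩,
    { hd.of_reverse_triangle he hle hC0 hC with left := wordDist_mul_left }⟩
  have := hd.reverse_triangle he hle hC h
  unfold NearlyBtw at *
  linarith

theorem CodingFamily.eq_of_genSetDominated {K : ℝ} {X : (ℕ → Bool) → ℕ → G} (hS : IsGenSet S)
    (hd : InvariantHyperbolic (wordDist S) δ) (hX : CodingFamily (wordDist S) c D K X) (hc : 0 ≤ c)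
    (hD : 1 ≤ D) (hK : 0 ≤ K) {A A' : ℕ → Bool}
    (h : GenSetDominated (conedSet S (X (toeplitzBits A'))) (conedSet S (X (toeplitzBits A)))) :
    A = A' := by
  obtain ⟨M, hM⟩ := h
  have hedge := hS.shadowedEdges_conedSet hd hc (zero_le_one.trans hD) (hX.btw (toeplitzBits A'))
    fun i => by simpa using hX.upper (toeplitzBits A') i (i + 1) (by omega)
  refine hX.eq_of_bounded hd hK (hS.mono Set.subset_union_left).discreteGeodesic hedge (M := M)
    fun q => ?_
  unfold wordDist
  exact_mod_cast hM _ (Or.inr ⟨(0, q), rfl⟩)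

end Coned

/-- [ABO, Theorem 2.11]. -/
theorem stmt_5 {G : Type*} [Group G] (S : Set G) (hgen : IsGenSet S)
    (hhyp : FourPointHyperbolic (wordDist S))
    (hacyl : AcylindricalWith (wordDist S) (leftTranslation (G := G)))
    (hgt : ∃ g h : G, LoxodromicWith (wordDist S) leftTranslation g ∧
      LoxodromicWith (wordDist S) leftTranslation h ∧
      ∃ x : G, IndepWith (wordDist S) leftTranslation x g h) :
    ∃ F : Set (Set G), Cardinal.continuum ≤ Cardinal.mk F ∧
      (F.Pairwise fun T T' => ¬ GenSetEquiv T T') ∧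
      ∀ T ∈ F, IsGenSet T ∧ FourPointHyperbolic (wordDist T) ∧
        AcylindricalWith (wordDist T) (leftTranslation (G := G)) ∧
        {g : G | LoxodromicWith (wordDist T) leftTranslation g} =
          {g : G | LoxodromicWith (wordDist S) leftTranslation g} := by
  obtain ⟨δ, hd⟩ := hgen.exists_invariantHyperbolic hhyp
  obtain ⟨a, b, ha, hb, x, hab⟩ := hgt
  have hac := hacyl.finsetAcylindrical
  obtain ⟨ca, ha⟩ := hd.exists_quasiAxis_of_loxodromic ha
  obtain ⟨cb, hb⟩ := hd.exists_quasiAxis_of_loxodromic hb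
  obtain ⟨c, D, K, X, hc, hD, hK, hX⟩ := ha.exists_codingFamily hd hac (h := b) fun hmem => by
    obtain ⟨p, q, hp, hq, hpq⟩ := ha.exists_pow_eq_zpow hd hac hb hmem
    exact hd.not_indepWith_of_pow_eq_zpow hp hq hpq x hab
  set T : (ℕ → Bool) → Set G := fun A => conedSet S (X (toeplitzBits A)) with hT
  have hdom : ∀ A A', GenSetDominated (T A') (T A) → A = A' := fun A A' h =>
    hX.eq_of_genSetDominated hgen hd hc hD hK h
  have hinj : Function.Injective T := fun A A' hAA' => hdom A A' ⟨1, fun t ht =>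
    wordLength_le_one_of_mem (Or.inl (hAA' ▸ ht))⟩
  refine ⟨Set.range T, ?_, ?_, ?_⟩
  · have h := Cardinal.mk_range_eq_of_injective hinj
    rw [← Cardinal.lift_le.{0}, ← Cardinal.lift_continuum.{_, 0}, h]
    simp
  · rintro _ ⟨A, rfl⟩ _ ⟨A', rfl⟩ hne h
    exact hne (congrArg T (hdom A A' h.2))
  · rintro _ ⟨A, rfl⟩
    obtain ⟨C, δ', hq, he⟩ := hX.exists_coarseQuotient hgen hd hc hD hK A
    exact ⟨hgen.mono Set.subset_union_left, he.fourPointHyperbolic,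
      (hq.finsetAcylindrical hd he hac).acylindricalWith, Set.ext (hq.loxodromic_iff hd he)⟩
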